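/- Let 1 < p, q ≤ ∞ and 1/2 < s < ∞ with 1/p + 1/q = 1/s. For n ∈ ℤ set ψ_{k,n}(x) := 2^k ψ(2^k x + n), and for Schwartz f, g : ℝ → ℂ and a finite set Λ ⊆ ℤ define the truncated shifted paraproduct Π_{n,Λ}(f,g)(x) := Σ_{k∈Λ} ((f ∗ ψ_{k,n})·(g ∗ ψ_{k,n})) ∗ φ_k(x). Then there is a constant C, depending only on φ and the exponents (and not on n or Λ), such that for every n ∈ ℤ, every finite Λ ⊆ ℤ, and all Schwartz f, g: ‖Π_{n,Λ}(f,g)‖_{L^s(ℝ)} ≤ C · (log(2 + |n|))² · ‖f‖_{L^p(ℝ)} ‖g‖_{L^q(ℝ)}. -/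

import Mathlib

open MeasureTheory ENNReal NNReal

/-- Convolution on `ℝ`: `(f ∗ g)(x) = ∫ f(t) g(x − t) dt`. -/
noncomputable def conv (f g : ℝ → ℂ) : ℝ → ℂ := fun x => ∫ t, f t * g (x - t)

/-- The Fourier transform `f̂(ξ) = ∫ f(x) e^{−2πixξ} dx`. -/
noncomputable def ft1 (f : ℝ → ℂ) (ξ : ℝ) : ℂ :=
  ∫ x, f x * Complex.exp (((-2) * Real.pi * x * ξ : ℝ) * Complex.I)

/-- The `L¹`-normalized dyadic dilation `u_k(x) = 2^k u(2^k x)`. -/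
noncomputable def dil (u : ℝ → ℂ) (k : ℤ) : ℝ → ℂ :=
  fun x => (2 : ℂ) ^ k * u ((2 : ℝ) ^ k * x)

/-- The shifted dilation `u_{k,n}(x) = 2^k u(2^k x + n)`. -/
noncomputable def dilShift (u : ℝ → ℂ) (k n : ℤ) : ℝ → ℂ :=
  fun x => (2 : ℂ) ^ k * u ((2 : ℝ) ^ k * x + (n : ℝ))

/-- The function `ψ` with `ψ̂(ξ) = φ̂(ξ/2) − φ̂(ξ)`, i.e. `ψ(x) = 2φ(2x) − φ(x)`. -/
noncomputable def psiOf (φ : ℝ → ℂ) : ℝ → ℂ := fun x => 2 * φ (2 * x) - φ x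

/-- The truncated shifted paraproduct
`Π_{n,Λ}(f,g) = Σ_{k∈Λ} ((f ∗ ψ_{k,n})·(g ∗ ψ_{k,n})) ∗ φ_k`. -/
noncomputable def paraShift (φ : ℝ → ℂ) (n : ℤ) (Λ : Finset ℤ) (f g : ℝ → ℂ) : ℝ → ℂ :=
  fun x => ∑ k ∈ Λ,
    conv (fun y => conv f (dilShift (psiOf φ) k n) y * conv g (dilShift (psiOf φ) k n) y)
      (dil φ k) x

/-- The Lebesgue (quasi)norm with exponent `t ∈ (0, ∞]` of an `ℝ≥0∞`-valued function,
interpreted as the essential supremum when `t = ∞`. -/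
noncomputable def LqNorm {X : Type*} [MeasurableSpace X] (μ : Measure X) (t : ℝ≥0∞)
    (φ : X → ℝ≥0∞) : ℝ≥0∞ :=
  if t = ∞ then essSup φ μ else (∫⁻ x, φ x ^ t.toReal ∂μ) ^ (1 / t.toReal)

namespace ShiftedParaproduct

open scoped FourierTransform SchwartzMap

/-- The dyadic interval `{y : ⌊2^k y⌋ = m}`. -/
def dyadic (q : ℤ × ℤ) : Set ℝ := {y | ⌊(2 : ℝ) ^ q.1 * y⌋ = q.2}

/-- The threefold dilate of a dyadic interval. -/
def dyadicTriple (q : ℤ × ℤ) : Set ℝ :=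
  {y | q.2 - 1 ≤ ⌊(2 : ℝ) ^ q.1 * y⌋ ∧ ⌊(2 : ℝ) ^ q.1 * y⌋ ≤ q.2 + 1}

lemma measurable_floor_dil (k : ℤ) : Measurable (fun y : ℝ => ⌊(2 : ℝ) ^ k * y⌋) :=
  Int.measurable_floor.comp (measurable_const.mul measurable_id)

lemma measurableSet_dyadic (q : ℤ × ℤ) : MeasurableSet (dyadic q) :=
  measurable_floor_dil q.1 (measurableSet_singleton q.2)

lemma measurableSet_dyadicTriple (q : ℤ × ℤ) : MeasurableSet (dyadicTriple q) :=
  measurable_floor_dil q.1 (measurableSet_Icc (a := q.2 - 1) (b := q.2 + 1))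

lemma two_zpow_pos (k : ℤ) : (0 : ℝ) < 2 ^ k := by positivity

lemma volume_floor_preimage (k a b : ℤ) :
    volume {y : ℝ | a ≤ ⌊(2 : ℝ) ^ k * y⌋ ∧ ⌊(2 : ℝ) ^ k * y⌋ ≤ b} =
      ENNReal.ofReal (((b : ℝ) + 1 - a) * 2 ^ (-k)) := by
  have h2 := two_zpow_pos k
  have : {y : ℝ | a ≤ ⌊(2 : ℝ) ^ k * y⌋ ∧ ⌊(2 : ℝ) ^ k * y⌋ ≤ b} =
      Set.Ico ((a : ℝ) * 2 ^ (-k)) (((b : ℝ) + 1) * 2 ^ (-k)) := by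
    ext y
    simp only [Set.mem_ofPred_eq, Set.mem_Ico, zpow_neg, ← div_eq_mul_inv]
    rw [Int.le_floor, ← Int.lt_add_one_iff, Int.floor_lt]
    rw [div_le_iff₀ h2, lt_div_iff₀ h2]
    push_cast
    rw [mul_comm y]
  rw [this, Real.volume_Ico]
  congr 1
  ring

lemma volume_dyadic (q : ℤ × ℤ) : volume (dyadic q) = ENNReal.ofReal (2 ^ (-q.1)) := by
  have : dyadic q = {y : ℝ | q.2 ≤ ⌊(2 : ℝ) ^ q.1 * y⌋ ∧ ⌊(2 : ℝ) ^ q.1 * y⌋ ≤ q.2} := by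
    ext y
    simp only [dyadic, Set.mem_ofPred_eq]
    constructor
    · rintro h; omega
    · rintro ⟨h, h'⟩; omega
  rw [this, volume_floor_preimage]
  congr 1
  ring

lemma volume_dyadicTriple (q : ℤ × ℤ) : volume (dyadicTriple q) = 3 * volume (dyadic q) := by
  rw [volume_dyadic, dyadicTriple, volume_floor_preimage]
  rw [show (3 : ℝ≥0∞) = ENNReal.ofReal 3 by norm_num, ← ENNReal.ofReal_mul (by norm_num)]
  congr 1
  push_cast
  ring

lemma volume_dyadic_ne_zero (q : ℤ × ℤ) : volume (dyadic q) ≠ 0 := by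
  rw [volume_dyadic]
  simpa using two_zpow_pos _

lemma volume_dyadic_ne_top (q : ℤ × ℤ) : volume (dyadic q) ≠ ∞ := by
  rw [volume_dyadic]; simp

lemma floor_dil_of_le {j k : ℤ} (h : j ≤ k) (y : ℝ) :
    ⌊(2 : ℝ) ^ j * y⌋ = ⌊(2 : ℝ) ^ k * y⌋ / ((2 : ℤ) ^ (k - j).toNat) := by
  have h1 : (2 : ℝ) ^ j * y = ((2 : ℝ) ^ k * y) / (((2 ^ (k - j).toNat : ℕ)) : ℝ) := by
    have h3 : ((2 : ℝ) ^ (k - j).toNat) = (2 : ℝ) ^ (k - j) := by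
      rw [← zpow_natCast, Int.toNat_of_nonneg (by omega)]
    have := two_zpow_pos j
    have := two_zpow_pos k
    push_cast
    rw [h3, zpow_sub₀ (by norm_num)]
    field_simp
  rw [h1, Int.floor_div_natCast]
  push_cast
  rfl

lemma mem_dyadic_floor (k : ℤ) (y : ℝ) : y ∈ dyadic (k, ⌊(2 : ℝ) ^ k * y⌋) := rfl

lemma dyadic_subset {q r : ℤ × ℤ} (h : r.1 ≤ q.1) {y : ℝ} (hq : y ∈ dyadic q)
    (hr : y ∈ dyadic r) : dyadic q ⊆ dyadic r := by
  intro z hz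
  simp only [dyadic, Set.mem_ofPred_eq] at *
  rw [floor_dil_of_le h] at hr ⊢
  rw [hz, ← hq, hr]

lemma dyadic_disjoint_or_subset {q r : ℤ × ℤ} (h : r.1 ≤ q.1) :
    Disjoint (dyadic q) (dyadic r) ∨ dyadic q ⊆ dyadic r := by
  by_cases hd : Disjoint (dyadic q) (dyadic r)
  · exact Or.inl hd
  · obtain ⟨y, h1, h2⟩ := Set.not_disjoint_iff.1 hd
    exact Or.inr (dyadic_subset h h1 h2)

lemma dyadic_nonempty (q : ℤ × ℤ) : (dyadic q).Nonempty := by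
  rw [Set.nonempty_iff_ne_empty]
  intro h
  have := volume_dyadic_ne_zero q
  simp [h] at this

lemma le_abs_sub_of_not_mem_triple {q : ℤ × ℤ} {x y : ℝ} (hx : x ∉ dyadicTriple q)
    (hy : y ∈ dyadic q) : (2 : ℝ) ^ (-q.1) ≤ |x - y| := by
  have h2 := two_zpow_pos q.1
  simp only [dyadic, dyadicTriple, Set.mem_ofPred_eq, not_and_or, not_le] at *
  rw [zpow_neg, inv_eq_one_div, div_le_iff₀ h2]
  have e : |x - y| * 2 ^ q.1 = |2 ^ q.1 * x - 2 ^ q.1 * y| := by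
    rw [← mul_sub, abs_mul, abs_of_pos h2, mul_comm]
  rw [e]
  have a1 := Int.floor_le ((2 : ℝ) ^ q.1 * x)
  have a2 := Int.lt_floor_add_one ((2 : ℝ) ^ q.1 * x)
  have a3 := Int.floor_le ((2 : ℝ) ^ q.1 * y)
  have a4 := Int.lt_floor_add_one ((2 : ℝ) ^ q.1 * y)
  rw [hy] at a3 a4
  rcases hx with h | h
  · have : (⌊(2 : ℝ) ^ q.1 * x⌋ : ℝ) + 1 ≤ (q.2 : ℝ) - 1 := by exact_mod_cast h
    rw [abs_sub_comm]
    exact le_trans (by linarith) (le_abs_self _)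
  · have : (q.2 : ℝ) + 1 + 1 ≤ (⌊(2 : ℝ) ^ q.1 * x⌋ : ℝ) := by exact_mod_cast h
    exact le_trans (by linarith) (le_abs_self _)

lemma abs_sub_le_of_mem_dyadic {q : ℤ × ℤ} {x y : ℝ} (hx : x ∈ dyadic q)
    (hy : y ∈ dyadic q) : |x - y| ≤ (2 : ℝ) ^ (-q.1) := by
  have h2 := two_zpow_pos q.1
  simp only [dyadic, Set.mem_ofPred_eq] at *
  rw [zpow_neg, inv_eq_one_div, le_div_iff₀ h2]
  have e : |x - y| * 2 ^ q.1 = |2 ^ q.1 * x - 2 ^ q.1 * y| := by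
    rw [← mul_sub, abs_mul, abs_of_pos h2, mul_comm]
  rw [e]
  exact (Int.abs_sub_lt_one_of_floor_eq_floor (hx.trans hy.symm)).le

/-- A point in the triple of a dyadic interval lies in the triple of every dyadic ancestor. -/
lemma mem_triple_of_subset {q r : ℤ × ℤ} (h : r.1 ≤ q.1) (hs : dyadic q ⊆ dyadic r) {x : ℝ}
    (hx : x ∈ dyadicTriple q) : x ∈ dyadicTriple r := by
  obtain ⟨y, hy⟩ := dyadic_nonempty q
  have hy' := hs hy
  simp only [dyadic, dyadicTriple, Set.mem_ofPred_eq] at *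
  rw [floor_dil_of_le h] at hy' ⊢
  rw [hy] at hy'
  have hN : (0 : ℤ) < 2 ^ (q.1 - r.1).toNat := by positivity
  have hN1 : (1 : ℤ) ≤ 2 ^ (q.1 - r.1).toNat := hN
  generalize (2 : ℤ) ^ (q.1 - r.1).toNat = N at *
  generalize ⌊(2 : ℝ) ^ q.1 * x⌋ = a at *
  rw [← hy']
  have b1 : q.2 - 1 ≥ N * (q.2 / N - 1) := by
    have := Int.mul_ediv_self_le (x := q.2) hN.ne'
    nlinarith
  have b2 : q.2 + 1 < N * (q.2 / N + 2) := by
    have := Int.lt_mul_ediv_self_add (x := q.2) hN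
    nlinarith
  constructor
  · rw [Int.le_ediv_iff_mul_le hN]; nlinarith
  · rw [← Int.lt_add_one_iff, Int.ediv_lt_iff_lt_mul hN]; nlinarith

/-- The dyadic intervals on which the average of `w` exceeds `t`. -/
def heavy (w : ℝ → ℝ≥0∞) (t : ℝ≥0∞) : Set (ℤ × ℤ) :=
  {q | t * volume (dyadic q) < ∫⁻ y in dyadic q, w y}

/-- The maximal dyadic intervals on which the average of `w` exceeds `t`. -/
def stopping (w : ℝ → ℝ≥0∞) (t : ℝ≥0∞) : Set (ℤ × ℤ) :=
  {q | q ∈ heavy w t ∧ ∀ r ∈ heavy w t, r.1 < q.1 → Disjoint (dyadic q) (dyadic r)}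

/-- The union of the stopping intervals, i.e. a superlevel set of the dyadic maximal function. -/
def stopSet (w : ℝ → ℝ≥0∞) (t : ℝ≥0∞) : Set ℝ := ⋃ q : stopping w t, dyadic q

/-- The union of the triples of a family of dyadic intervals. -/
def tripleUnion (Q : Set (ℤ × ℤ)) : Set ℝ := ⋃ q : Q, dyadicTriple q

lemma measurableSet_stopSet (w : ℝ → ℝ≥0∞) (t : ℝ≥0∞) : MeasurableSet (stopSet w t) :=
  MeasurableSet.iUnion fun q => measurableSet_dyadic q

lemma measurableSet_tripleUnion (Q : Set (ℤ × ℤ)) : MeasurableSet (tripleUnion Q) :=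
  MeasurableSet.iUnion fun q => measurableSet_dyadicTriple q

lemma stopping_pairwise (w : ℝ → ℝ≥0∞) (t : ℝ≥0∞) :
    Pairwise (fun q r : stopping w t => Disjoint (dyadic q) (dyadic r)) := by
  intro q r hqr
  rcases lt_trichotomy q.1.1 r.1.1 with h | h | h
  · exact (r.2.2 q q.2.1 h).symm
  · rw [Set.disjoint_left]
    intro y h1 h2
    apply hqr
    apply Subtype.ext
    apply Prod.ext h
    simp only [dyadic, Set.mem_ofPred_eq] at h1 h2
    rw [← h1, ← h2, h]
  · exact q.2.2 r r.2.1 h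

lemma exists_stopping {w : ℝ → ℝ≥0∞} {t : ℝ≥0∞} (hw : ∫⁻ y, w y ≠ ∞) (ht : t ≠ 0)
    {q : ℤ × ℤ} (hq : q ∈ heavy w t) : ∃ r ∈ stopping w t, r.1 ≤ q.1 ∧ dyadic q ⊆ dyadic r := by
  obtain ⟨y, hy⟩ := dyadic_nonempty q
  have hb : ∃ b : ℤ, ∀ k : ℤ, (k, ⌊(2 : ℝ) ^ k * y⌋) ∈ heavy w t → b ≤ k := by
    have hlim : ∃ N : ℕ, ∫⁻ y, w y < t * ENNReal.ofReal (2 ^ N) := by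
      obtain ⟨N, hN⟩ := ENNReal.exists_nat_mul_gt ht hw
      refine ⟨N, hN.trans_le ?_⟩
      rw [mul_comm]
      gcongr
      rw [ENNReal.ofReal_pow (by norm_num)]
      simp only [ENNReal.ofReal_ofNat]
      exact_mod_cast N.lt_two_pow_self.le
    obtain ⟨N, hN⟩ := hlim
    refine ⟨-N, fun k hk => ?_⟩
    by_contra hlt
    push Not at hlt
    simp only [heavy, Set.mem_ofPred_eq, volume_dyadic] at hk
    have h1 := hk.trans_le ((setLIntegral_le_lintegral _ _).trans hN.le)
    have h2 : ENNReal.ofReal (2 ^ N) ≤ ENNReal.ofReal (2 ^ (-k)) := by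
      apply ENNReal.ofReal_le_ofReal
      rw [← zpow_natCast]
      exact zpow_le_zpow_right₀ (by norm_num) (by omega)
    exact absurd h1 (not_lt.2 (by gcongr))
  have hq' : (q.1, ⌊(2 : ℝ) ^ q.1 * y⌋) ∈ heavy w t := by
    have : ⌊(2 : ℝ) ^ q.1 * y⌋ = q.2 := hy
    rw [this]; exact hq
  obtain ⟨k, hk, hmin⟩ := Int.exists_least_of_bdd (P := fun k => (k, ⌊(2 : ℝ) ^ k * y⌋) ∈ heavy w t)
    hb ⟨q.1, hq'⟩
  have hkq := hmin _ hq'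
  refine ⟨_, ⟨hk, fun r hr hrk => ?_⟩, hkq, dyadic_subset hkq hy (mem_dyadic_floor _ _)⟩
  rcases dyadic_disjoint_or_subset (q := (k, ⌊(2 : ℝ) ^ k * y⌋)) hrk.le with h | h
  · exact h
  · have hyr : ⌊(2 : ℝ) ^ r.1 * y⌋ = r.2 := h (mem_dyadic_floor k y)
    exact absurd (hmin r.1 (by rw [hyr]; exact hr)) (not_le.2 hrk)

lemma setLIntegral_le_of_not_mem_stopSet {w : ℝ → ℝ≥0∞} {t : ℝ≥0∞} (hw : ∫⁻ y, w y ≠ ∞)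
    (ht : t ≠ 0) {x : ℝ} (hx : x ∉ stopSet w t) {q : ℤ × ℤ} (hq : x ∈ dyadic q) :
    ∫⁻ y in dyadic q, w y ≤ t * volume (dyadic q) := by
  by_contra h
  obtain ⟨r, hr, -, hs⟩ := exists_stopping hw ht (q := q) (not_le.1 h)
  exact hx (Set.mem_iUnion.2 ⟨⟨r, hr⟩, hs hq⟩)

lemma setLIntegral_le_of_not_mem_tripleUnion {w : ℝ → ℝ≥0∞} {t : ℝ≥0∞} (hw : ∫⁻ y, w y ≠ ∞)
    (ht : t ≠ 0) {x : ℝ} (hx : x ∉ tripleUnion (stopping w t)) {q : ℤ × ℤ}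
    (hq : x ∈ dyadicTriple q) : ∫⁻ y in dyadic q, w y ≤ t * volume (dyadic q) := by
  by_contra h
  obtain ⟨r, hr, hl, hs⟩ := exists_stopping hw ht (q := q) (not_le.1 h)
  exact hx (Set.mem_iUnion.2 ⟨⟨r, hr⟩, mem_triple_of_subset hl hs hq⟩)

lemma setLIntegral_stopping_le {w : ℝ → ℝ≥0∞} {t : ℝ≥0∞} {q : ℤ × ℤ} (hq : q ∈ stopping w t) :
    ∫⁻ y in dyadic q, w y ≤ 2 * t * volume (dyadic q) := by
  obtain ⟨y, hy⟩ := dyadic_nonempty q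
  set r : ℤ × ℤ := (q.1 - 1, ⌊(2 : ℝ) ^ (q.1 - 1) * y⌋)
  have hyr : y ∈ dyadic r := mem_dyadic_floor _ _
  have hr : r ∉ heavy w t := fun h =>
    Set.disjoint_left.1 (hq.2 r h (by simp [r])) hy hyr
  have hsub : dyadic q ⊆ dyadic r := dyadic_subset (by simp [r]) hy hyr
  have hv : volume (dyadic r) = 2 * volume (dyadic q) := by
    rw [volume_dyadic, volume_dyadic, show (2 : ℝ≥0∞) = ENNReal.ofReal 2 by norm_num,
      ← ENNReal.ofReal_mul (by norm_num)]
    congr 1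
    rw [show -r.1 = 1 + -q.1 by simp [r]; ring, zpow_add₀ (by norm_num)]
    simp
  calc ∫⁻ y in dyadic q, w y ≤ ∫⁻ y in dyadic r, w y := lintegral_mono_set hsub
    _ ≤ t * volume (dyadic r) := not_lt.1 hr
    _ = 2 * t * volume (dyadic q) := by rw [hv]; ring

lemma volume_stopSet (w : ℝ → ℝ≥0∞) (t : ℝ≥0∞) :
    volume (stopSet w t) = ∑' q : stopping w t, volume (dyadic q) :=
  measure_iUnion (stopping_pairwise w t) fun q => measurableSet_dyadic q

lemma volume_tripleUnion_le (w : ℝ → ℝ≥0∞) (t : ℝ≥0∞) :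
    volume (tripleUnion (stopping w t)) ≤ 3 * volume (stopSet w t) := by
  rw [volume_stopSet, ← ENNReal.tsum_mul_left]
  refine (measure_iUnion_le _).trans (le_of_eq ?_)
  simp_rw [volume_dyadicTriple]

lemma volume_stopSet_le (w : ℝ → ℝ≥0∞) (t : ℝ≥0∞) (ht : t ≠ ∞) (hwm : Measurable w) :
    t * volume (stopSet w (2 * t)) ≤ ∫⁻ y in {y | t < w y}, w y := by
  rw [volume_stopSet, ← ENNReal.tsum_mul_left]
  have hm : MeasurableSet {y | t < w y} := measurableSet_lt measurable_const hwm
  calc ∑' q : stopping w (2 * t), t * volume (dyadic q)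
      ≤ ∑' q : stopping w (2 * t), ∫⁻ y in dyadic q, {y | t < w y}.indicator w y := by
        refine ENNReal.tsum_le_tsum fun q => ?_
        have h1 : 2 * t * volume (dyadic q) < ∫⁻ y in dyadic q, w y := q.2.1
        have h2 : ∫⁻ y in dyadic q, w y ≤
            (∫⁻ y in dyadic q, {y | t < w y}.indicator w y) + t * volume (dyadic q) := by
          rw [← setLIntegral_const, ← lintegral_add_right _ measurable_const]
          refine lintegral_mono fun y => ?_
          by_cases hy : t < w y
          · simp [Set.indicator, hy]
          · simp [Set.indicator, hy, not_lt.1 hy]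
        have h3 : t * volume (dyadic q) ≠ ∞ :=
          ENNReal.mul_ne_top ht (volume_dyadic_ne_top _)
        have h4 := h1.le.trans h2
        rw [show 2 * t * volume (dyadic q) = t * volume (dyadic q) + t * volume (dyadic q) by
          ring] at h4
        exact (ENNReal.add_le_add_iff_right h3).1 h4
    _ = ∫⁻ y in stopSet w (2 * t), {y | t < w y}.indicator w y :=
        (lintegral_iUnion (fun q => measurableSet_dyadic _) (stopping_pairwise w (2 * t)) _).symm
    _ ≤ ∫⁻ y, {y | t < w y}.indicator w y := setLIntegral_le_lintegral _ _
    _ = _ := lintegral_indicator hm _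

lemma lintegral_Ioo_rpow {a r : ℝ} (ha : 0 ≤ a) (hr : 0 < r) :
    ∫⁻ t in Set.Ioo 0 a, ENNReal.ofReal (t ^ (r - 1)) = ENNReal.ofReal (a ^ r / r) := by
  have h_int : IntervalIntegrable (fun t : ℝ => t ^ (r - 1)) volume 0 a :=
    intervalIntegral.intervalIntegrable_rpow' (by linarith)
  rw [setLIntegral_congr Ioo_ae_eq_Ioc, ← ofReal_integral_eq_lintegral_ofReal]
  · rw [← intervalIntegral.integral_of_le ha, integral_rpow (Or.inl (by linarith))]
    simp [Real.zero_rpow hr.ne']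
  · exact (intervalIntegrable_iff_integrableOn_Ioc_of_le ha).1 h_int
  · filter_upwards [ae_restrict_mem measurableSet_Ioc] with t ht
    exact Real.rpow_nonneg ht.1.le _

lemma lintegral_Ioi_rpow {a r : ℝ} (ha : 0 < a) (hr : 0 < r) :
    ∫⁻ t in Set.Ioi a, ENNReal.ofReal (t ^ (-r - 1)) = ENNReal.ofReal (a ^ (-r) / r) := by
  rw [← ofReal_integral_eq_lintegral_ofReal]
  · rw [integral_Ioi_rpow_of_lt (by linarith) ha]
    congr 1
    have : -r - 1 + 1 = -r := by ring
    rw [this]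
    field_simp
  · exact integrableOn_Ioi_rpow_of_lt (by linarith) ha
  · filter_upwards [ae_restrict_mem measurableSet_Ioi] with t ht
    exact Real.rpow_nonneg (ha.trans ht).le _

lemma rpow_eq_lintegral_indicator (F : ℝ≥0∞) {p : ℝ} (hp : 0 < p) :
    F ^ p = ∫⁻ t in Set.Ioi (0 : ℝ), ENNReal.ofReal (p * t ^ (p - 1)) *
      (if ENNReal.ofReal t < F then 1 else 0) := by
  have key : ∀ a : ℝ, 0 ≤ a → ∫⁻ t in Set.Ioo 0 a, ENNReal.ofReal (p * t ^ (p - 1)) =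
      ENNReal.ofReal a ^ p := by
    intro a ha
    simp_rw [ENNReal.ofReal_mul hp.le]
    rw [lintegral_const_mul _ (by fun_prop), lintegral_Ioo_rpow ha hp,
      ← ENNReal.ofReal_mul hp.le, ENNReal.ofReal_rpow_of_nonneg ha hp.le]
    congr 1
    field_simp
  have sub : ∀ a : ℝ, ∫⁻ t in Set.Ioo 0 a, ENNReal.ofReal (p * t ^ (p - 1)) =
      ∫⁻ t in Set.Ioi (0 : ℝ), ENNReal.ofReal (p * t ^ (p - 1)) * (if t < a then 1 else 0) := by
    intro a
    rw [← Set.Ioi_inter_Iio, Set.inter_comm, ← Measure.restrict_restrict measurableSet_Iio,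
      ← lintegral_indicator measurableSet_Iio]
    refine lintegral_congr fun t => ?_
    by_cases h : t < a <;> simp [Set.indicator, h]
  by_cases hF : F = ∞
  · subst hF
    symm
    rw [ENNReal.top_rpow_of_pos hp, eq_top_iff]
    refine ENNReal.le_of_forall_nnreal_lt fun r _ => ?_
    have : (r : ℝ≥0∞) = ENNReal.ofReal ((r : ℝ) ^ p⁻¹) ^ p := by
      rw [ENNReal.ofReal_rpow_of_nonneg (by positivity) hp.le, ← Real.rpow_mul r.coe_nonneg,
        inv_mul_cancel₀ hp.ne', Real.rpow_one, ENNReal.ofReal_coe_nnreal]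
    rw [this, ← key _ (by positivity), sub]
    refine lintegral_mono fun t => ?_
    gcongr
    split_ifs <;> simp_all
  · lift F to ℝ≥0 using hF
    have h1 : (F : ℝ≥0∞) = ENNReal.ofReal F := by simp
    conv_lhs => rw [h1]
    rw [← key _ F.coe_nonneg, sub]
    refine setLIntegral_congr_fun measurableSet_Ioi fun t ht => ?_
    simp only [h1, ENNReal.ofReal_lt_ofReal_iff_of_nonneg (le_of_lt ht)]

/-- The layer-cake formula for `ℝ≥0∞`-valued functions. -/
lemma lintegral_rpow_eq_layer {F : ℝ → ℝ≥0∞} (hF : Measurable F) {p : ℝ} (hp : 0 < p) :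
    ∫⁻ x, F x ^ p = ∫⁻ t in Set.Ioi (0 : ℝ), ENNReal.ofReal (p * t ^ (p - 1)) *
      volume {x | ENNReal.ofReal t < F x} := by
  simp_rw [rpow_eq_lintegral_indicator _ hp]
  rw [lintegral_lintegral_swap]
  · refine lintegral_congr fun t => ?_
    have hm : MeasurableSet {x | ENNReal.ofReal t < F x} := measurableSet_lt measurable_const hF
    rw [lintegral_const_mul' _ _ ENNReal.ofReal_ne_top]
    congr 1
    rw [← lintegral_indicator_one hm]
    refine lintegral_congr fun x => ?_
    simp [Set.indicator]
  · refine Measurable.aemeasurable ?_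
    refine Measurable.mul (by fun_prop) ?_
    refine Measurable.ite ?_ measurable_const measurable_const
    exact measurableSet_lt (by fun_prop) (by fun_prop)

/-- The superlevel sets of the dyadic maximal function of `w` satisfy the maximal inequality. -/
lemma lintegral_volume_stopSet_le {w : ℝ → ℝ≥0∞} (hw : Measurable w) (hfin : ∀ x, w x ≠ ∞)
    {p : ℝ} (hp : 1 < p) :
    ∫⁻ t in Set.Ioi (0 : ℝ), ENNReal.ofReal (p * t ^ (p - 1)) *
      volume (stopSet w (ENNReal.ofReal t)) ≤
      ENNReal.ofReal (2 * p * 2 ^ (p - 1) / (p - 1)) * ∫⁻ x, w x ^ p := by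
  have step : ∀ t ∈ Set.Ioi (0 : ℝ), ENNReal.ofReal (p * t ^ (p - 1)) *
      volume (stopSet w (ENNReal.ofReal t)) ≤ ∫⁻ x, ENNReal.ofReal (2 * p * t ^ (p - 2)) *
        (if ENNReal.ofReal (t / 2) < w x then w x else 0) := by
    intro t ht
    have ht' : 0 < t := ht
    have h := volume_stopSet_le w (ENNReal.ofReal (t / 2)) ENNReal.ofReal_ne_top hw
    have e : 2 * ENNReal.ofReal (t / 2) = ENNReal.ofReal t := by
      rw [show (2 : ℝ≥0∞) = ENNReal.ofReal 2 by norm_num, ← ENNReal.ofReal_mul (by norm_num)]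
      congr 1; ring
    rw [e] at h
    have e2 : ENNReal.ofReal (p * t ^ (p - 1)) =
        ENNReal.ofReal (2 * p * t ^ (p - 2)) * ENNReal.ofReal (t / 2) := by
      rw [← ENNReal.ofReal_mul (by positivity)]
      congr 1
      rw [show p - 1 = (p - 2) + 1 by ring, Real.rpow_add_one ht'.ne']
      ring
    rw [lintegral_const_mul' _ _ ENNReal.ofReal_ne_top, e2, mul_assoc]
    gcongr
    refine h.trans (le_of_eq ?_)
    rw [← lintegral_indicator (measurableSet_lt measurable_const hw)]
    refine lintegral_congr fun x => ?_
    simp [Set.indicator]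
  refine (setLIntegral_mono' measurableSet_Ioi step).trans ?_
  rw [lintegral_lintegral_swap]
  · rw [← lintegral_const_mul' _ _ ENNReal.ofReal_ne_top]
    refine lintegral_mono fun x => ?_
    have hr : (0 : ℝ) < p - 1 := by linarith
    set a := (w x).toReal
    have ha : 0 ≤ a := ENNReal.toReal_nonneg
    have hwa : w x = ENNReal.ofReal a := (ENNReal.ofReal_toReal (hfin x)).symm
    calc ∫⁻ t in Set.Ioi (0 : ℝ), ENNReal.ofReal (2 * p * t ^ (p - 2)) *
          (if ENNReal.ofReal (t / 2) < w x then w x else 0)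
        = ∫⁻ t in Set.Ioo 0 (2 * a), ENNReal.ofReal (2 * p) * w x *
            ENNReal.ofReal (t ^ (p - 1 - 1)) := by
          rw [← Set.Ioi_inter_Iio, Set.inter_comm, ← Measure.restrict_restrict measurableSet_Iio,
            ← lintegral_indicator measurableSet_Iio]
          refine setLIntegral_congr_fun measurableSet_Ioi fun t ht => ?_
          have ht' : (0 : ℝ) < t := ht
          have hiff : ENNReal.ofReal (t / 2) < w x ↔ t < 2 * a := by
            rw [hwa, ENNReal.ofReal_lt_ofReal_iff_of_nonneg (by positivity)]
            constructor <;> intro h <;> linarith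
          simp only [hiff, Set.indicator, Set.mem_Iio]
          split_ifs with h
          · rw [ENNReal.ofReal_mul (by positivity), show p - 1 - 1 = p - 2 by ring]
            ring
          · simp
      _ = ENNReal.ofReal (2 * p) * w x * ENNReal.ofReal ((2 * a) ^ (p - 1) / (p - 1)) := by
          rw [lintegral_const_mul' _ _ (ENNReal.mul_ne_top ENNReal.ofReal_ne_top (hfin x)),
            lintegral_Ioo_rpow (by positivity) hr]
      _ ≤ _ := by
          rw [hwa, ENNReal.ofReal_rpow_of_nonneg ha (by linarith),
            ← ENNReal.ofReal_mul (by positivity), ← ENNReal.ofReal_mul (by positivity),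
            ← ENNReal.ofReal_mul (by positivity)]
          apply ENNReal.ofReal_le_ofReal
          apply le_of_eq
          rw [Real.mul_rpow (by norm_num) ha]
          by_cases h0 : a = 0
          · rw [h0, Real.zero_rpow (by linarith), Real.zero_rpow (by linarith)]; simp
          have : a ^ p = a ^ (p - 1) * a := by
            rw [← Real.rpow_add_one h0]; congr 1; ring
          rw [this]
          ring
  · refine Measurable.aemeasurable ?_
    refine Measurable.mul (by fun_prop) ?_
    refine Measurable.ite ?_ (by fun_prop) measurable_const
    exact measurableSet_lt (by fun_prop) (by fun_prop)

lemma lintegral_sq_sublevel_le {w : ℝ → ℝ≥0∞} (hw : Measurable w) (hfin : ∀ x, w x ≠ ∞)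
    {p : ℝ} (hp : 0 < p) (hp2 : p < 2) :
    ∫⁻ t in Set.Ioi (0 : ℝ), ENNReal.ofReal (p * t ^ (p - 3)) *
      (∫⁻ x, if w x ≤ ENNReal.ofReal t then w x ^ 2 else 0) ≤
      ENNReal.ofReal (p / (2 - p)) * ∫⁻ x, w x ^ p := by
  simp_rw [← lintegral_const_mul' _ _ ENNReal.ofReal_ne_top]
  rw [lintegral_lintegral_swap]
  · refine lintegral_mono fun x => ?_
    set a := (w x).toReal
    have ha : 0 ≤ a := ENNReal.toReal_nonneg
    have hwa : w x = ENNReal.ofReal a := (ENNReal.ofReal_toReal (hfin x)).symm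
    rcases ha.eq_or_lt with h0 | h0
    · rw [hwa, ← h0]; simp
    calc ∫⁻ t in Set.Ioi (0 : ℝ), ENNReal.ofReal (p * t ^ (p - 3)) *
          (if w x ≤ ENNReal.ofReal t then w x ^ 2 else 0)
        ≤ ∫⁻ t in Set.Ici a, ENNReal.ofReal p * w x ^ 2 *
            ENNReal.ofReal (t ^ (-(2 - p) - 1)) := by
          rw [← lintegral_indicator measurableSet_Ici, ← lintegral_indicator measurableSet_Ioi]
          refine lintegral_mono fun t => ?_
          simp only [Set.indicator, Set.mem_Ioi, Set.mem_Ici]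
          split_ifs with h1 h2 h3 h3
          · rw [ENNReal.ofReal_mul hp.le, show -(2 - p) - 1 = p - 3 by ring]
            apply le_of_eq; ring
          · rw [hwa, ENNReal.ofReal_le_ofReal_iff h1.le] at h2
            exact absurd h2 h3
          all_goals simp
      _ = ENNReal.ofReal p * w x ^ 2 * ENNReal.ofReal (a ^ (-(2 - p)) / (2 - p)) := by
          rw [lintegral_const_mul' _ _ (ENNReal.mul_ne_top ENNReal.ofReal_ne_top
            (ENNReal.pow_ne_top (hfin x))), setLIntegral_congr Ioi_ae_eq_Ici.symm,
            lintegral_Ioi_rpow h0 (by linarith)]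
      _ ≤ _ := by
          have h2p : 0 < 2 - p := by linarith
          rw [hwa, ENNReal.ofReal_rpow_of_nonneg ha hp.le, ← ENNReal.ofReal_pow ha,
            ← ENNReal.ofReal_mul hp.le,
            ← ENNReal.ofReal_mul (by positivity), ← ENNReal.ofReal_mul (by positivity)]
          apply ENNReal.ofReal_le_ofReal
          apply le_of_eq
          have : a ^ p = a ^ 2 * a ^ (-(2 - p)) := by
            rw [← Real.rpow_natCast, ← Real.rpow_add h0]; congr 1; push_cast; ring
          rw [this]
          ring
  · refine Measurable.aemeasurable ?_
    refine Measurable.mul (by fun_prop) ?_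
    refine Measurable.ite ?_ (by fun_prop) measurable_const
    exact measurableSet_le (by fun_prop) (by fun_prop)

/-- Bounded integrable Borel functions. -/
structure Nice (f : ℝ → ℂ) : Prop where
  meas : Measurable f
  int : Integrable f
  bdd : ∃ C : ℝ, ∀ x, ‖f x‖ ≤ C

/-- A sublinear operator to which the Calderón–Zygmund decomposition applies: it is bounded on
`L²`, and bounded from atoms on dyadic intervals to `L¹` away from the triples of the
intervals. -/
structure CZOp (G : (ℝ → ℂ) → ℝ → ℝ≥0∞) (A : ℝ≥0∞) : Prop where
  meas : ∀ f, Nice f → Measurable (G f)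
  add : ∀ f g, Nice f → Nice g → ∀ x, G (f + g) x ≤ G f x + G g x
  l2 : ∀ f, Nice f → ∫⁻ x, G f x ^ 2 ≤ A ^ 2 * ∫⁻ x, ‖f x‖ₑ ^ 2
  bad : ∀ Q : Set (ℤ × ℤ), Pairwise (fun q r : Q => Disjoint (dyadic q) (dyadic r)) →
    ∀ b, Nice b → (∀ x, x ∉ ⋃ q : Q, dyadic q → b x = 0) →
    (∀ q ∈ Q, ∫ y in dyadic q, b y = 0) →
    ∫⁻ x in (tripleUnion Q)ᶜ, G b x ≤ A * ∫⁻ x, ‖b x‖ₑ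

lemma Nice.lintegral_ne_top {f : ℝ → ℂ} (hf : Nice f) : ∫⁻ x, ‖f x‖ₑ ≠ ∞ := hf.int.2.ne

lemma Nice.sub {f g : ℝ → ℂ} (hf : Nice f) (hg : Nice g) : Nice (f - g) := by
  obtain ⟨C, hC⟩ := hf.bdd
  obtain ⟨C', hC'⟩ := hg.bdd
  exact ⟨hf.meas.sub hg.meas, hf.int.sub hg.int, C + C', fun x =>
    (norm_sub_le _ _).trans (add_le_add (hC x) (hC' x))⟩

lemma volume_stopSet_mul_le (w : ℝ → ℝ≥0∞) (t : ℝ≥0∞) :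
    t * volume (stopSet w t) ≤ ∫⁻ y, w y := by
  rw [volume_stopSet, ← ENNReal.tsum_mul_left]
  calc ∑' q : stopping w t, t * volume (dyadic q)
      ≤ ∑' q : stopping w t, ∫⁻ y in dyadic q, w y := ENNReal.tsum_le_tsum fun q => q.2.1.le
    _ = ∫⁻ y in stopSet w t, w y :=
        (lintegral_iUnion (fun q => measurableSet_dyadic _) (stopping_pairwise w t) _).symm
    _ ≤ _ := setLIntegral_le_lintegral _ _

/-- Off the stopping set a continuous function is bounded by the threshold. -/
lemma le_of_not_mem_stopSet {f : ℝ → ℂ} (hf : Continuous f) (hfi : Integrable f) {t : ℝ}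
    (ht : 0 < t) {x : ℝ} (hx : x ∉ stopSet (fun y => ‖f y‖ₑ) (ENNReal.ofReal t)) :
    ‖f x‖ₑ ≤ ENNReal.ofReal t := by
  by_contra hlt
  rw [not_le] at hlt
  have ho : IsOpen {y | ENNReal.ofReal t < ‖f y‖ₑ} :=
    isOpen_lt continuous_const hf.enorm
  obtain ⟨ε, hε, hball⟩ := Metric.isOpen_iff.1 ho x hlt
  obtain ⟨N, hN⟩ := exists_pow_lt_of_lt_one hε (by norm_num : (1 / 2 : ℝ) < 1)
  set q : ℤ × ℤ := ((N : ℤ), ⌊(2 : ℝ) ^ (N : ℤ) * x⌋)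
  have hxq : x ∈ dyadic q := mem_dyadic_floor _ _
  have hsub : ∀ y ∈ dyadic q, ENNReal.ofReal t < ‖f y‖ₑ := by
    intro y hy
    apply hball
    rw [Metric.mem_ball, Real.dist_eq]
    refine (abs_sub_le_of_mem_dyadic hy hxq).trans_lt ?_
    simpa [q] using hN
  have h1 := setLIntegral_le_of_not_mem_stopSet (w := fun y => ‖f y‖ₑ) hfi.2.ne
    (by simpa using ht) hx hxq
  have h2 : ENNReal.ofReal t * volume (dyadic q) < ∫⁻ y in dyadic q, ‖f y‖ₑ := by
    rw [← setLIntegral_const]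
    refine setLIntegral_strict_mono (measurableSet_dyadic q) (volume_dyadic_ne_zero q)
      (by fun_prop) ?_ ?_
    · rw [setLIntegral_const]
      exact ENNReal.mul_ne_top ENNReal.ofReal_ne_top (volume_dyadic_ne_top q)
    · exact ae_of_all _ fun y hy => hsub y hy
  exact absurd h1 (not_le.2 h2)

/-- The Calderón–Zygmund decomposition. -/
lemma exists_cz_decomposition {f : ℝ → ℂ} (hf : Nice f) {t : ℝ} (ht : 0 < t) :
    ∃ g b : ℝ → ℂ, Nice g ∧ Nice b ∧ f = g + b ∧
      (∀ x, x ∉ stopSet (fun y => ‖f y‖ₑ) (ENNReal.ofReal t) → b x = 0) ∧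
      (∀ q ∈ stopping (fun y => ‖f y‖ₑ) (ENNReal.ofReal t), ∫ y in dyadic q, b y = 0) ∧
      (∀ x ∈ stopSet (fun y => ‖f y‖ₑ) (ENNReal.ofReal t), ‖g x‖ₑ ≤ 2 * ENNReal.ofReal t) ∧
      ∫⁻ x, ‖b x‖ₑ ≤
        4 * ENNReal.ofReal t * volume (stopSet (fun y => ‖f y‖ₑ) (ENNReal.ofReal t)) := by
  set w : ℝ → ℝ≥0∞ := fun y => ‖f y‖ₑ
  set T := ENNReal.ofReal t
  have hT : T ≠ 0 := by simpa [T] using ht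
  have hTt : T ≠ ∞ := ENNReal.ofReal_ne_top
  have hdisj := stopping_pairwise w T
  set av : ℤ × ℤ → ℂ := fun q => ⨍ y in dyadic q, f y
  have hav : ∀ q ∈ stopping w T, ‖av q‖ₑ ≤ 2 * T := by
    intro q hq
    have h := setLIntegral_stopping_le hq
    have hv := volume_dyadic_ne_zero q
    have hv' := volume_dyadic_ne_top q
    calc ‖av q‖ₑ = (volume (dyadic q))⁻¹ * ‖∫ y in dyadic q, f y‖ₑ := by
          simp only [av, setAverage_eq, enorm_smul]
          congr 1
          rw [Real.enorm_of_nonneg (by positivity), Measure.real,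
            ENNReal.ofReal_inv_of_pos (ENNReal.toReal_pos hv hv'), ENNReal.ofReal_toReal hv']
      _ ≤ (volume (dyadic q))⁻¹ * (2 * T * volume (dyadic q)) := by
          gcongr
          exact (enorm_integral_le_lintegral_enorm _).trans h
      _ = 2 * T := by
          rw [mul_comm (2 * T), ← mul_assoc, ENNReal.inv_mul_cancel hv hv', one_mul]
  obtain ⟨g, hgm, hg⟩ := exists_measurable_piecewise
    (fun i : Option (stopping w T) => i.elim (stopSet w T)ᶜ (fun q => dyadic q))
    (by rintro (_ | q)
        · exact (measurableSet_stopSet _ _).compl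
        · exact measurableSet_dyadic q)
    (fun i => i.elim f (fun q _ => av q))
    (by rintro (_ | q)
        · exact hf.meas
        · exact measurable_const)
    (by
      rintro (_ | q) (_ | r) hqr x ⟨h1, h2⟩
      · exact absurd rfl hqr
      · exact absurd (Set.mem_iUnion.2 ⟨r, h2⟩) h1
      · exact absurd (Set.mem_iUnion.2 ⟨q, h1⟩) h2
      · have : q ≠ r := fun h => hqr (by rw [h])
        exact absurd h2 (Set.disjoint_left.1 (hdisj this) h1))
  have hg0 : ∀ x, x ∉ stopSet w T → g x = f x := fun x hx => hg none hx
  have hgq : ∀ q : stopping w T, ∀ x ∈ dyadic q, g x = av q := fun q x hx => hg (some q) hx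
  have hgΩ : ∀ x ∈ stopSet w T, ‖g x‖ₑ ≤ 2 * T := by
    intro x hx
    obtain ⟨q, hq⟩ := Set.mem_iUnion.1 hx
    rw [hgq q x hq]
    exact hav q q.2
  have hb0 : ∀ x, x ∉ stopSet w T → (f - g) x = 0 := fun x hx => by simp [hg0 x hx]
  have hbint : ∫⁻ x, ‖(f - g) x‖ₑ ≤ 4 * T * volume (stopSet w T) := by
    calc ∫⁻ x, ‖(f - g) x‖ₑ = ∫⁻ x in stopSet w T, ‖(f - g) x‖ₑ := by
          rw [← lintegral_indicator (measurableSet_stopSet _ _)]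
          refine lintegral_congr fun x => ?_
          by_cases hx : x ∈ stopSet w T
          · simp [hx]
          · rw [hb0 x hx]; simp [hx]
      _ = ∑' q : stopping w T, ∫⁻ x in dyadic q, ‖(f - g) x‖ₑ :=
          lintegral_iUnion (fun q => measurableSet_dyadic _) hdisj _
      _ ≤ ∑' q : stopping w T, 4 * T * volume (dyadic q) := by
          refine ENNReal.tsum_le_tsum fun q => ?_
          calc ∫⁻ x in dyadic q, ‖(f - g) x‖ₑ ≤ ∫⁻ x in dyadic q, (w x + 2 * T) := by
                refine setLIntegral_mono' (measurableSet_dyadic _) fun x hx => ?_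
                refine (enorm_sub_le (E := ℂ)).trans ?_
                gcongr
                exact hgΩ x (Set.mem_iUnion.2 ⟨q, hx⟩)
            _ ≤ 2 * T * volume (dyadic q) + 2 * T * volume (dyadic q) := by
                rw [lintegral_add_right _ measurable_const, setLIntegral_const]
                gcongr
                exact setLIntegral_stopping_le q.2
            _ = _ := by ring
      _ = _ := by rw [ENNReal.tsum_mul_left, volume_stopSet]
  have hfin : 4 * T * volume (stopSet w T) ≠ ∞ := by
    rw [mul_assoc]
    exact ENNReal.mul_ne_top (by norm_num)
      (ne_top_of_le_ne_top hf.lintegral_ne_top (volume_stopSet_mul_le w T))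
  obtain ⟨C, hC⟩ := hf.bdd
  have hgb : ∃ C', ∀ x, ‖g x‖ ≤ C' := by
    refine ⟨max C (2 * t), fun x => ?_⟩
    by_cases hx : x ∈ stopSet w T
    · refine le_max_of_le_right ?_
      have := hgΩ x hx
      rw [← ofReal_norm, show (2 : ℝ≥0∞) = ENNReal.ofReal 2 by norm_num,
        ← ENNReal.ofReal_mul (by norm_num), ENNReal.ofReal_le_ofReal_iff (by positivity)] at this
      exact this
    · rw [hg0 x hx]; exact le_max_of_le_left (hC x)
  have hbi : Integrable (f - g) :=
    ⟨(hf.meas.sub hgm).aestronglyMeasurable, lt_of_le_of_lt hbint hfin.lt_top⟩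
  have hgi : Integrable g := by
    have := hf.int.sub hbi
    simpa using this
  have hgN : Nice g := ⟨hgm, hgi, hgb⟩
  refine ⟨g, f - g, hgN, hf.sub hgN, by simp, hb0, ?_, hgΩ, hbint⟩
  intro q hq
  simp only [Pi.sub_apply]
  rw [integral_sub hf.int.integrableOn hgi.integrableOn,
    setIntegral_congr_fun (measurableSet_dyadic q) (hgq ⟨q, hq⟩), setIntegral_const]
  simp only [av, setAverage_eq, Measure.real]
  rw [smul_smul, mul_inv_cancel₀, one_smul, sub_self]
  exact (ENNReal.toReal_pos (volume_dyadic_ne_zero q) (volume_dyadic_ne_top q)).ne.symm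

/-- The distributional estimate behind the Calderón–Zygmund theorem. -/
lemma CZOp.level_le {G : (ℝ → ℂ) → ℝ → ℝ≥0∞} {A : ℝ≥0∞} (hG : CZOp G A) (hA0 : A ≠ 0)
    (hA : A ≠ ∞) {f : ℝ → ℂ} (hf : Nice f) (hc : Continuous f) {t : ℝ} (ht : 0 < t) :
    ENNReal.ofReal t ^ 2 * volume {x | 2 * A * ENNReal.ofReal t < G f x} ≤
      11 * ENNReal.ofReal t ^ 2 * volume (stopSet (fun y => ‖f y‖ₑ) (ENNReal.ofReal t)) +
      ∫⁻ x, if ‖f x‖ₑ ≤ ENNReal.ofReal t then ‖f x‖ₑ ^ 2 else 0 := by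
  obtain ⟨g, b, hg, hb, hfgb, hb0, hbQ, hgΩ, hbint⟩ := exists_cz_decomposition hf ht
  set w : ℝ → ℝ≥0∞ := fun y => ‖f y‖ₑ
  set T := ENNReal.ofReal t
  have hT : T ≠ 0 := by simpa [T] using ht
  have hTt : T ≠ ∞ := ENNReal.ofReal_ne_top
  set Ω := stopSet w T
  have hΩm : MeasurableSet Ω := measurableSet_stopSet _ _
  set Ω' := tripleUnion (stopping w T)
  have hΩ'm : MeasurableSet Ω' := measurableSet_tripleUnion _
  have hAT : A * T ≠ 0 := mul_ne_zero hA0 hT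
  have hATt : A * T ≠ ∞ := ENNReal.mul_ne_top hA hTt
  have hgood : T ^ 2 * volume {x | A * T < G g x} ≤
      4 * T ^ 2 * volume Ω + ∫⁻ x, if ‖f x‖ₑ ≤ T then ‖f x‖ₑ ^ 2 else 0 := by
    have h1 : (A * T) ^ 2 * volume {x | A * T < G g x} ≤ A ^ 2 * ∫⁻ x, ‖g x‖ₑ ^ 2 := by
      refine le_trans ?_ (hG.l2 g hg)
      calc (A * T) ^ 2 * volume {x | A * T < G g x}
          ≤ (A * T) ^ 2 * volume {x | (A * T) ^ 2 ≤ G g x ^ 2} := by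
            gcongr with x
            intro h
            gcongr
        _ ≤ _ := mul_meas_ge_le_lintegral ((hG.meas g hg).pow_const 2) _
    have h2 : T ^ 2 * volume {x | A * T < G g x} ≤ ∫⁻ x, ‖g x‖ₑ ^ 2 := by
      rw [mul_pow, mul_assoc] at h1
      exact (ENNReal.mul_le_mul_iff_right (pow_ne_zero 2 hA0) (ENNReal.pow_ne_top hA)).1 h1
    refine h2.trans ?_
    calc ∫⁻ x, ‖g x‖ₑ ^ 2 ≤ ∫⁻ x, (Ω.indicator (fun _ => 4 * T ^ 2) x +
          if ‖f x‖ₑ ≤ T then ‖f x‖ₑ ^ 2 else 0) := by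
          refine lintegral_mono fun x => ?_
          by_cases hx : x ∈ Ω
          · simp only [Set.indicator_of_mem hx]
            refine le_add_right ?_
            calc ‖g x‖ₑ ^ 2 ≤ (2 * T) ^ 2 := by gcongr; exact hgΩ x hx
              _ = 4 * T ^ 2 := by ring
          · have hfx : ‖f x‖ₑ ≤ T := le_of_not_mem_stopSet hc hf.int ht hx
            have hgx : g x = f x := by
              have := congrFun hfgb x
              simp only [Pi.add_apply, hb0 x hx, add_zero] at this
              exact this.symm
            simp [hx, hfx, hgx]
      _ = _ := by
          rw [lintegral_add_left (measurable_const.indicator hΩm), lintegral_indicator hΩm,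
            setLIntegral_const]
  have hbad : T ^ 2 * volume {x | A * T < G b x} ≤ 7 * T ^ 2 * volume Ω := by
    have h1 : A * T * volume ({x | A * T < G b x} ∩ Ω'ᶜ) ≤ A * (4 * T * volume Ω) := by
      calc A * T * volume ({x | A * T < G b x} ∩ Ω'ᶜ)
          ≤ A * T * (volume.restrict Ω'ᶜ) {x | A * T ≤ G b x} := by
            rw [← Measure.restrict_apply' hΩ'm.compl]
            gcongr with x
            exact le_of_lt
        _ ≤ ∫⁻ x in Ω'ᶜ, G b x := mul_meas_ge_le_lintegral (hG.meas b hb) _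
        _ ≤ A * ∫⁻ x, ‖b x‖ₑ := hG.bad _ (stopping_pairwise w T) b hb hb0 hbQ
        _ ≤ _ := by gcongr
    have h2 : T * volume ({x | A * T < G b x} ∩ Ω'ᶜ) ≤ 4 * T * volume Ω := by
      rw [mul_assoc A] at h1
      exact (ENNReal.mul_le_mul_iff_right hA0 hA).1 h1
    calc T ^ 2 * volume {x | A * T < G b x}
        ≤ T ^ 2 * (volume Ω' + volume ({x | A * T < G b x} ∩ Ω'ᶜ)) := by
          gcongr
          refine (measure_mono ?_).trans (measure_union_le _ _)
          intro x hx
          by_cases h : x ∈ Ω'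
          · exact Or.inl h
          · exact Or.inr ⟨hx, h⟩
      _ = T ^ 2 * volume Ω' + T * (T * volume ({x | A * T < G b x} ∩ Ω'ᶜ)) := by ring
      _ ≤ T ^ 2 * (3 * volume Ω) + T * (4 * T * volume Ω) := by
          gcongr
          exact volume_tripleUnion_le w T
      _ = _ := by ring
  have hsub : {x | 2 * A * T < G f x} ⊆ {x | A * T < G g x} ∪ {x | A * T < G b x} := by
    intro x hx
    by_contra h
    simp only [Set.mem_union, Set.mem_ofPred_eq, not_or, not_lt] at h hx
    have h1 := hG.add g b hg hb x
    rw [← hfgb] at h1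
    refine absurd (hx.trans_le (h1.trans (add_le_add h.1 h.2))) ?_
    rw [not_lt]
    apply le_of_eq; ring
  calc T ^ 2 * volume {x | 2 * A * T < G f x}
      ≤ T ^ 2 * (volume {x | A * T < G g x} + volume {x | A * T < G b x}) := by
        gcongr
        exact (measure_mono hsub).trans (measure_union_le _ _)
    _ = T ^ 2 * volume {x | A * T < G g x} + T ^ 2 * volume {x | A * T < G b x} := by ring
    _ ≤ _ := add_le_add hgood hbad
    _ = _ := by ring

/-- The constant in the Calderón–Zygmund theorem. -/
noncomputable def czConst (p : ℝ) : ℝ≥0∞ :=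
  11 * ENNReal.ofReal (2 * p * 2 ^ (p - 1) / (p - 1)) + ENNReal.ofReal (p / (2 - p))

/-- The Calderón–Zygmund theorem for `1 < p < 2`. -/
theorem CZOp.lintegral_rpow_le {G : (ℝ → ℂ) → ℝ → ℝ≥0∞} {A : ℝ≥0∞} (hG : CZOp G A) (hA0 : A ≠ 0)
    (hA : A ≠ ∞) {p : ℝ} (hp : 1 < p) (hp2 : p < 2) {f : ℝ → ℂ} (hf : Nice f)
    (hc : Continuous f) :
    ∫⁻ x, G f x ^ p ≤ (2 * A) ^ p * (czConst p * ∫⁻ x, ‖f x‖ₑ ^ p) := by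
  have h2A0 : 2 * A ≠ 0 := mul_ne_zero (by norm_num) hA0
  have h2A : 2 * A ≠ ∞ := ENNReal.mul_ne_top (by norm_num) hA
  have hp0 : 0 < p := by linarith
  have e : ∀ x, G f x ^ p = (2 * A) ^ p * ((2 * A)⁻¹ * G f x) ^ p := by
    intro x
    rw [← ENNReal.mul_rpow_of_nonneg _ _ hp0.le, ← mul_assoc, ENNReal.mul_inv_cancel h2A0 h2A,
      one_mul]
  simp_rw [e]
  rw [lintegral_const_mul _ (((hG.meas f hf).const_mul _).pow_const _)]
  gcongr
  rw [lintegral_rpow_eq_layer ((hG.meas f hf).const_mul _) hp0]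
  have hw : Measurable (fun x => ‖f x‖ₑ) := hf.meas.enorm
  have step : ∀ t ∈ Set.Ioi (0 : ℝ), ENNReal.ofReal (p * t ^ (p - 1)) *
      volume {x | ENNReal.ofReal t < (2 * A)⁻¹ * G f x} ≤
      11 * (ENNReal.ofReal (p * t ^ (p - 1)) *
        volume (stopSet (fun y => ‖f y‖ₑ) (ENNReal.ofReal t))) +
      ENNReal.ofReal (p * t ^ (p - 3)) *
        ∫⁻ x, if ‖f x‖ₑ ≤ ENNReal.ofReal t then ‖f x‖ₑ ^ 2 else 0 := by
    intro t ht
    have ht' : 0 < t := ht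
    have h := hG.level_le hA0 hA hf hc ht'
    have es : {x | ENNReal.ofReal t < (2 * A)⁻¹ * G f x} =
        {x | 2 * A * ENNReal.ofReal t < G f x} := by
      ext x
      simp only [Set.mem_ofPred_eq]
      rw [mul_comm _ (G f x), ← div_eq_mul_inv,
        ENNReal.lt_div_iff_mul_lt (Or.inl h2A0) (Or.inl h2A), mul_comm]
    have e2 : ENNReal.ofReal (p * t ^ (p - 1)) =
        ENNReal.ofReal (p * t ^ (p - 3)) * ENNReal.ofReal t ^ 2 := by
      rw [← ENNReal.ofReal_pow ht'.le, ← ENNReal.ofReal_mul (by positivity)]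
      congr 1
      rw [show p - 1 = (p - 3) + (2 : ℕ) by push_cast; ring, Real.rpow_add_natCast ht'.ne']
      ring
    rw [es, e2, mul_assoc]
    calc _ ≤ _ := mul_le_mul_right h _
      _ = _ := by ring
  refine (setLIntegral_mono' measurableSet_Ioi step).trans ?_
  rw [lintegral_add_right', czConst, add_mul]
  · rw [lintegral_const_mul' _ _ (by norm_num), mul_assoc]
    gcongr
    · exact lintegral_volume_stopSet_le hw (fun x => enorm_ne_top) hp
    · exact lintegral_sq_sublevel_le hw (fun x => enorm_ne_top) hp0 hp2
  · refine Measurable.aemeasurable ?_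
    refine Measurable.mul (by fun_prop) ?_
    refine Measurable.lintegral_prod_right' (f := fun z : ℝ × ℝ =>
      if ‖f z.2‖ₑ ≤ ENNReal.ofReal z.1 then ‖f z.2‖ₑ ^ 2 else 0) ?_
    have hfm := hf.meas
    refine Measurable.ite ?_ (by fun_prop) measurable_const
    exact measurableSet_le (by fun_prop) (by fun_prop)

/-- The cubically decaying majorant of the profiles. -/
noncomputable def kap (z : ℝ) : ℝ := ((1 + |z|) ^ 3)⁻¹

lemma kap_pos (z : ℝ) : 0 < kap z := by unfold kap; positivity

lemma continuous_kap : Continuous kap := by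
  unfold kap
  exact Continuous.inv₀ (by fun_prop) fun z => by positivity

@[fun_prop]
lemma measurable_kap : Measurable kap := continuous_kap.measurable

lemma kap_le_one (z : ℝ) : kap z ≤ 1 := by
  unfold kap
  exact inv_le_one_of_one_le₀ (one_le_pow₀ (by linarith [abs_nonneg z]))

lemma kap_add_le (z u : ℝ) : kap (z + u) ≤ (1 + |u|) ^ 3 * kap z := by
  unfold kap
  rw [← div_eq_mul_inv, inv_eq_one_div, div_le_div_iff₀ (by positivity) (by positivity), one_mul,
    ← mul_pow]
  gcongr
  have h : |z| ≤ |z + u| + |u| := by simpa using abs_sub (z + u) u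
  nlinarith [abs_nonneg u, abs_nonneg (z + u)]

/-- The first moment of the majorant. -/
noncomputable def kapMoment : ℝ≥0∞ := ∫⁻ z, ENNReal.ofReal ((1 + |z|) * kap z)

lemma kapMoment_ne_top : kapMoment ≠ ∞ := by
  have h : Integrable fun z : ℝ => (1 + ‖z‖) ^ (-(2 : ℝ)) :=
    integrable_one_add_norm (by simp)
  refine (lt_of_le_of_lt ?_ h.lintegral_lt_top).ne
  refine lintegral_mono fun z => ENNReal.ofReal_le_ofReal (le_of_eq ?_)
  have : (0 : ℝ) < 1 + |z| := by positivity
  rw [Real.rpow_neg (by positivity), Real.norm_eq_abs, kap]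
  norm_cast
  field_simp

/-- The `L¹`-normalised dilate and translate of the majorant. -/
noncomputable def kk (k : ℤ) (a x : ℝ) : ℝ≥0∞ := ENNReal.ofReal (2 ^ k * kap (2 ^ k * x + a))

@[fun_prop]
lemma measurable_kk (k : ℤ) (a : ℝ) : Measurable (kk k a) := by
  unfold kk; fun_prop

lemma kk_add_le (k : ℤ) (a u x : ℝ) :
    kk k (a + u) x ≤ ENNReal.ofReal ((1 + |u|) ^ 3) * kk k a x := by
  unfold kk
  rw [← ENNReal.ofReal_mul (by positivity)]
  apply ENNReal.ofReal_le_ofReal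
  have := kap_add_le (2 ^ k * x + a) u
  have h2 := two_zpow_pos k
  rw [← add_assoc]
  nlinarith

lemma lintegral_dilate (F : ℝ → ℝ≥0∞) (k : ℤ) (a : ℝ) :
    ∫⁻ x, ENNReal.ofReal (2 ^ k) * F (2 ^ k * x + a) = ∫⁻ x, F x := by
  have h2 := two_zpow_pos k
  rw [lintegral_const_mul' _ _ ENNReal.ofReal_ne_top]
  have h1 : ∫⁻ x, F (2 ^ k * x + a) = ENNReal.ofReal ((2 ^ k)⁻¹) * ∫⁻ x, F (x + a) := by
    have e := (Homeomorph.mulLeft₀ ((2 : ℝ) ^ k) h2.ne').measurableEmbedding.lintegral_map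
      (μ := volume) (fun x => F (x + a))
    have e2 : Measure.map (fun x : ℝ => 2 ^ k * x) volume
        = ENNReal.ofReal |(2 ^ k : ℝ)⁻¹| • volume := Real.map_volume_mul_left h2.ne'
    simp only [Homeomorph.coe_mulLeft₀] at e
    rw [← e, e2, lintegral_smul_measure, abs_of_pos (by positivity), smul_eq_mul]
  rw [h1, lintegral_add_right_eq_self F, ← mul_assoc, ← ENNReal.ofReal_mul h2.le,
    mul_inv_cancel₀ h2.ne', ENNReal.ofReal_one, one_mul]

/-- The mass and the first moment at scale `2^{-k}` of a nonnegative kernel. -/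
structure Mom (M : ℝ → ℝ≥0∞) (k : ℤ) (C : ℝ≥0∞) (R : ℝ) : Prop where
  meas : Measurable M
  mass : ∫⁻ x, M x ≤ C
  mom : ∫⁻ x, M x * ENNReal.ofReal (1 + 2 ^ k * |x|) ≤ C * ENNReal.ofReal R

lemma mom_kk (k : ℤ) (a : ℝ) : Mom (kk k a) k kapMoment (1 + |a|) := by
  have h2 := two_zpow_pos k
  refine ⟨measurable_kk k a, ?_, ?_⟩
  · unfold kapMoment
    rw [← lintegral_dilate (fun z => ENNReal.ofReal ((1 + |z|) * kap z)) k a]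
    refine lintegral_mono fun x => ?_
    unfold kk
    rw [← ENNReal.ofReal_mul h2.le]
    apply ENNReal.ofReal_le_ofReal
    have := kap_pos (2 ^ k * x + a)
    gcongr
    nlinarith [abs_nonneg (2 ^ k * x + a)]
  · unfold kapMoment
    rw [← lintegral_dilate (fun z => ENNReal.ofReal ((1 + |z|) * kap z)) k a,
      ← lintegral_mul_const' _ _ ENNReal.ofReal_ne_top]
    refine lintegral_mono fun x => ?_
    unfold kk
    have := kap_pos (2 ^ k * x + a)
    rw [← ENNReal.ofReal_mul h2.le, ← ENNReal.ofReal_mul (by positivity),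
      ← ENNReal.ofReal_mul (by positivity)]
    apply ENNReal.ofReal_le_ofReal
    have h3 : 2 ^ k * |x| ≤ |2 ^ k * x + a| + |a| := by
      have := abs_sub (2 ^ k * x + a) a
      rwa [add_sub_cancel_right, abs_mul, abs_of_pos h2] at this
    have h4 : 1 + 2 ^ k * |x| ≤ (1 + |2 ^ k * x + a|) * (1 + |a|) := by
      nlinarith [abs_nonneg a, abs_nonneg (2 ^ k * x + a)]
    calc 2 ^ k * kap (2 ^ k * x + a) * (1 + 2 ^ k * |x|)
        ≤ 2 ^ k * kap (2 ^ k * x + a) * ((1 + |2 ^ k * x + a|) * (1 + |a|)) := by gcongr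
      _ = _ := by ring

/-- Convolution of nonnegative kernels. -/
noncomputable def lconv (M N : ℝ → ℝ≥0∞) (x : ℝ) : ℝ≥0∞ := ∫⁻ y, M y * N (x - y)

@[fun_prop]
lemma measurable_lconv {M N : ℝ → ℝ≥0∞} (hM : Measurable M) (hN : Measurable N) :
    Measurable (lconv M N) := by
  unfold lconv
  exact Measurable.lintegral_prod_right' (f := fun z : ℝ × ℝ => M z.2 * N (z.1 - z.2))
    (by fun_prop)

lemma lintegral_lconv {M N : ℝ → ℝ≥0∞} (hM : Measurable M) (hN : Measurable N) :
    ∫⁻ x, lconv M N x = (∫⁻ x, M x) * ∫⁻ x, N x := by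
  unfold lconv
  rw [lintegral_lintegral_swap (by fun_prop), ← lintegral_mul_const _ hM]
  refine lintegral_congr fun y => ?_
  rw [lintegral_const_mul _ (by fun_prop), lintegral_sub_right_eq_self N]

lemma Mom.lconv {M N : ℝ → ℝ≥0∞} {k : ℤ} {C D : ℝ≥0∞} {R S : ℝ} (hR : 0 ≤ R)
    (hM : Mom M k C R) (hN : Mom N k D S) : Mom (lconv M N) k (C * D) (R * S) := by
  have h2 := two_zpow_pos k
  have hMm := hM.meas
  have hNm := hN.meas
  refine ⟨measurable_lconv hMm hNm, ?_, ?_⟩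
  · rw [lintegral_lconv hMm hNm]; exact mul_le_mul' hM.mass hN.mass
  · calc ∫⁻ x, ShiftedParaproduct.lconv M N x * ENNReal.ofReal (1 + 2 ^ k * |x|)
        ≤ ∫⁻ x, ShiftedParaproduct.lconv (fun y => M y * ENNReal.ofReal (1 + 2 ^ k * |y|))
          (fun y => N y * ENNReal.ofReal (1 + 2 ^ k * |y|)) x := by
          refine lintegral_mono fun x => ?_
          unfold ShiftedParaproduct.lconv
          rw [← lintegral_mul_const' _ _ ENNReal.ofReal_ne_top]
          refine lintegral_mono fun y => ?_
          calc M y * N (x - y) * ENNReal.ofReal (1 + 2 ^ k * |x|)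
              ≤ M y * N (x - y) * ENNReal.ofReal ((1 + 2 ^ k * |y|) * (1 + 2 ^ k * |x - y|)) := by
                gcongr
                have : |x| ≤ |y| + |x - y| := by simpa using abs_add_le y (x - y)
                have h3 : 0 ≤ 2 ^ k * |y| * (2 ^ k * |x - y|) := by positivity
                nlinarith
            _ = _ := by rw [ENNReal.ofReal_mul (by positivity)]; ring
      _ = _ := lintegral_lconv (by fun_prop) (by fun_prop)
      _ ≤ (C * ENNReal.ofReal R) * (D * ENNReal.ofReal S) := mul_le_mul' hM.mom hN.mom
      _ = _ := by rw [ENNReal.ofReal_mul hR]; ring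

lemma Mom.tail {M : ℝ → ℝ≥0∞} {k : ℤ} {C : ℝ≥0∞} {R : ℝ} (hM : Mom M k C R) {δ : ℝ}
    (hδ : 0 < δ) :
    ∫⁻ x in {x | δ ≤ |x|}, M x ≤ C * min 1 (ENNReal.ofReal (R / (2 ^ k * δ))) := by
  have h2 := two_zpow_pos k
  have hMm := hM.meas
  rcases le_total 1 (ENNReal.ofReal (R / (2 ^ k * δ))) with h | h
  · rw [min_eq_left h, mul_one]
    exact (setLIntegral_le_lintegral _ _).trans hM.mass
  · rw [min_eq_right h, div_eq_mul_inv, ENNReal.ofReal_mul' (by positivity), ← mul_assoc]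
    refine le_trans ?_ (mul_le_mul_left hM.mom _)
    rw [← lintegral_mul_const' _ _ ENNReal.ofReal_ne_top,
      ← lintegral_indicator (measurableSet_le measurable_const (by fun_prop))]
    refine lintegral_mono fun x => ?_
    by_cases hx : δ ≤ |x|
    · rw [Set.indicator_of_mem (by exact hx), mul_assoc, ← ENNReal.ofReal_mul (by positivity)]
      refine le_mul_of_one_le_right' ?_
      rw [ENNReal.one_le_ofReal, ← div_eq_mul_inv, one_le_div (by positivity)]
      nlinarith
    · rw [Set.indicator_of_notMem (by exact hx)]; exact zero_le

lemma exists_sum_min_le : ∃ C : ℝ≥0, ∀ (Λ : Finset ℤ) (δ R : ℝ), 0 < δ → 1 ≤ R →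
    ∑ k ∈ Λ, min 1 (ENNReal.ofReal (2 ^ k * δ)) * min 1 (ENNReal.ofReal (R / (2 ^ k * δ))) ≤
      C * ENNReal.ofReal (1 + Real.log R) := by
  have hsum : Summable fun k : ℤ => ((1 : ℝ) / 2) ^ k.natAbs := by
    apply Summable.of_nat_of_neg
    · simpa using summable_geometric_two
    · simpa using summable_geometric_two
  set S := ∑' k : ℤ, ((1 : ℝ) / 2) ^ k.natAbs
  have hS0 : 0 ≤ S := tsum_nonneg fun _ => by positivity
  have hS : ∀ (Λ : Finset ℤ) (m : ℤ), ∑ k ∈ Λ, ((1 : ℝ) / 2) ^ (k - m).natAbs ≤ S := by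
    intro Λ m
    have h1 := (Equiv.subRight m).summable_iff.2 hsum
    have h2 : ∑' k : ℤ, ((1 : ℝ) / 2) ^ (k - m).natAbs = S :=
      (Equiv.subRight m).tsum_eq (fun k : ℤ => ((1 : ℝ) / 2) ^ k.natAbs)
    rw [← h2]
    exact h1.sum_le_tsum _ (fun _ _ => by positivity)
  refine ⟨(3 * S + 3 + 1 / Real.log 2).toNNReal, fun Λ δ R hδ hR => ?_⟩
  obtain ⟨m, hm1, hm2⟩ := exists_mem_Ico_zpow (y := (2 : ℝ)) (inv_pos.2 hδ) (by norm_num)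
  have hlogR : 0 ≤ Real.log R := Real.log_nonneg hR
  set N := ⌈Real.logb 2 R⌉₊
  have hRN : R ≤ 2 ^ N := by
    rw [← Real.rpow_natCast, ← Real.logb_le_iff_le_rpow (by norm_num) (by linarith)]
    exact Nat.le_ceil _
  have hN : (N : ℝ) ≤ Real.log R / Real.log 2 + 1 :=
    (Nat.ceil_lt_add_one (Real.logb_nonneg (by norm_num) hR)).le
  have hmδ1 : 2 ^ m * δ ≤ 1 := by
    rwa [← le_div_iff₀ hδ, one_div]
  have hmδ2 : 1 < 2 ^ m * δ * 2 := by
    have := (inv_lt_iff_one_lt_mul₀' hδ).1 hm2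
    rw [zpow_add_one₀ (by norm_num)] at this
    linarith
  set J : Finset ℤ := Finset.Icc (m + 1) (m + N)
  have hterm : ∀ k ∈ Λ, min 1 (ENNReal.ofReal (2 ^ k * δ)) *
      min 1 (ENNReal.ofReal (R / (2 ^ k * δ))) ≤ ENNReal.ofReal
        (((1 : ℝ) / 2) ^ (k - m).natAbs + (if k ∈ J then 1 else 0)
          + 2 * ((1 : ℝ) / 2) ^ (k - (m + N)).natAbs) := by
    intro k _
    rcases le_or_gt k m with h | h
    · refine (mul_le_mul' (min_le_right _ _) (min_le_left _ _)).trans ?_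
      rw [mul_one]
      apply ENNReal.ofReal_le_ofReal
      have h3 : (2 : ℝ) ^ k * δ ≤ (1 / 2) ^ (k - m).natAbs := by
        obtain ⟨j, hj⟩ := Int.eq_ofNat_of_zero_le (sub_nonneg.2 h)
        have hk : k = m - j := by omega
        have hj2 : (k - m).natAbs = j := by omega
        rw [hj2, hk, zpow_sub₀ (by norm_num), zpow_natCast, one_div, inv_pow]
        calc (2 : ℝ) ^ m / 2 ^ j * δ = (2 ^ m * δ) * (2 ^ j)⁻¹ := by ring
          _ ≤ 1 * (2 ^ j)⁻¹ := by gcongr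
          _ = _ := one_mul _
      have h4 : (0 : ℝ) ≤ if k ∈ J then 1 else 0 := by split_ifs <;> norm_num
      have h5 : (0 : ℝ) ≤ 2 * ((1 : ℝ) / 2) ^ (k - (m + N)).natAbs := by positivity
      linarith
    rcases le_or_gt k (m + N) with h' | h'
    · refine (mul_le_mul' (min_le_left _ _) (min_le_left _ _)).trans ?_
      rw [mul_one, ENNReal.one_le_ofReal, if_pos (Finset.mem_Icc.2 ⟨by omega, h'⟩)]
      have h4 : (0 : ℝ) ≤ ((1 : ℝ) / 2) ^ (k - m).natAbs := by positivity
      have h5 : (0 : ℝ) ≤ 2 * ((1 : ℝ) / 2) ^ (k - (m + N)).natAbs := by positivity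
      linarith
    · refine (mul_le_mul' (min_le_left _ _) (min_le_right _ _)).trans ?_
      rw [one_mul]
      apply ENNReal.ofReal_le_ofReal
      have h3 : R / (2 ^ k * δ) ≤ 2 * (1 / 2) ^ (k - (m + N)).natAbs := by
        obtain ⟨j, hj⟩ := Int.eq_ofNat_of_zero_le (sub_nonneg.2 h'.le)
        have hk : k = m + N + j := by omega
        have hj2 : (k - (m + N)).natAbs = j := by omega
        rw [hj2, hk, zpow_add₀ (by norm_num), zpow_add₀ (by norm_num), zpow_natCast, zpow_natCast,
          one_div, inv_pow, div_le_iff₀ (by positivity)]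
        calc R ≤ 2 ^ N * 1 := by linarith
          _ ≤ 2 ^ N * (2 ^ m * δ * 2) := by gcongr
          _ = _ := by field_simp
      have h4 : (0 : ℝ) ≤ if k ∈ J then 1 else 0 := by split_ifs <;> norm_num
      have h5 : (0 : ℝ) ≤ ((1 : ℝ) / 2) ^ (k - m).natAbs := by positivity
      linarith
  have hpos : ∀ k, (0 : ℝ) ≤ ((1 : ℝ) / 2) ^ (k - m).natAbs + (if k ∈ J then 1 else 0)
          + 2 * ((1 : ℝ) / 2) ^ (k - (m + N)).natAbs := by
    intro k
    split_ifs <;> positivity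
  refine (Finset.sum_le_sum hterm).trans ?_
  have hl2 : 0 < Real.log 2 := Real.log_pos (by norm_num)
  change _ ≤ ENNReal.ofReal _ * _
  rw [← ENNReal.ofReal_sum_of_nonneg fun k _ => hpos k, ← ENNReal.ofReal_mul (by positivity)]
  apply ENNReal.ofReal_le_ofReal
  rw [Finset.sum_add_distrib, Finset.sum_add_distrib, ← Finset.mul_sum]
  have hJ : ∑ k ∈ Λ, (if k ∈ J then (1 : ℝ) else 0) ≤ N := by
    rw [← Finset.sum_filter, Finset.sum_const, nsmul_eq_mul, mul_one]
    have : (Λ.filter (· ∈ J)).card ≤ J.card :=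
      Finset.card_le_card fun k hk => (Finset.mem_filter.1 hk).2
    have hJc : J.card = N := by simp [J]
    exact_mod_cast this.trans hJc.le
  have e1 := hS Λ m
  have e2 := hS Λ (m + N)
  calc _ ≤ 3 * S + (Real.log R / Real.log 2 + 1) := by linarith
    _ ≤ (3 * S + 3 + 1 / Real.log 2) * (1 + Real.log R) := by
        have : Real.log R / Real.log 2 = 1 / Real.log 2 * Real.log R := by ring
        rw [this]
        have h1 : 0 ≤ 1 / Real.log 2 := by positivity
        have h2 : 0 ≤ S * Real.log R := by positivity
        nlinarith

/-- The dilated and translated profile `2^k α(2^k x + a)`. -/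
noncomputable def dilR (α : ℝ → ℂ) (k : ℤ) (a : ℝ) : ℝ → ℂ :=
  fun x => (2 : ℂ) ^ k * α ((2 : ℝ) ^ k * x + a)

lemma dilShift_eq_dilR (α : ℝ → ℂ) (k n : ℤ) : dilShift α k n = dilR α k n := rfl

lemma dil_eq_dilR (α : ℝ → ℂ) (k : ℤ) : dil α k = dilR α k 0 := by
  ext x; simp [dil, dilR]

/-- A continuous profile with cubic decay and a matching local Lipschitz estimate. -/
structure Prof (α : ℝ → ℂ) (c : ℝ≥0) : Prop where
  cont : Continuous α
  bd : ∀ z, ‖α z‖ ≤ c * kap z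
  lip : ∀ z h, |h| ≤ 1 → ‖α (z + h) - α z‖ ≤ c * |h| * kap z

lemma exists_prof (α : SchwartzMap ℝ ℂ) : ∃ c, Prof α c := by
  have key : ∀ n : ℕ, ∃ C : ℝ≥0, ∀ x, ‖iteratedDeriv n α x‖ ≤ C * kap x := by
    intro n
    set B := 2 ^ 3 * ((Finset.Iic (3, n)).sup fun m : ℕ × ℕ => SchwartzMap.seminorm ℝ m.1 m.2) α
    have h := fun x => SchwartzMap.one_add_le_sup_seminorm_apply (𝕜 := ℝ) (m := (3, n)) (k := 3)
      (n := n) le_rfl le_rfl α x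
    have hB : 0 ≤ B := by positivity
    refine ⟨B.toNNReal, fun x => ?_⟩
    have := h x
    rw [norm_iteratedFDeriv_eq_norm_iteratedDeriv] at this
    rw [Real.coe_toNNReal _ hB, kap, ← div_eq_mul_inv, le_div_iff₀ (by positivity), mul_comm]
    exact this
  obtain ⟨C, hC⟩ := key 0
  obtain ⟨D, hD⟩ := key 1
  refine ⟨C + 8 * D, α.continuous, fun z => ?_, fun z h hh => ?_⟩
  · have := hC z
    rw [iteratedDeriv_zero] at this
    have hk := kap_pos z
    refine this.trans ?_
    gcongr
    simp
  · have hb : ∀ w ∈ Set.uIcc z (z + h), ‖deriv α w‖ ≤ 8 * D * kap z := by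
      intro w hw
      have hw' : |w - z| ≤ 1 := by
        have := Set.abs_sub_left_of_mem_uIcc hw
        simpa using this.trans (by simpa using hh)
      have h1 := hD w
      rw [iteratedDeriv_one] at h1
      have h2 := kap_add_le z (w - z)
      rw [add_sub_cancel] at h2
      have h3 : (1 + |w - z|) ^ 3 ≤ 8 := by
        calc (1 + |w - z|) ^ 3 ≤ (1 + 1) ^ 3 := by gcongr
          _ = 8 := by norm_num
      have hk := kap_pos z
      calc _ ≤ _ := h1
        _ ≤ D * (8 * kap z) := by gcongr; exact h2.trans (by gcongr)
        _ = _ := by ring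
    have := Convex.norm_image_sub_le_of_norm_deriv_le (fun w _ => α.differentiableAt) hb
      (convex_uIcc z (z + h)) Set.left_mem_uIcc Set.right_mem_uIcc
    rw [add_sub_cancel_left, Real.norm_eq_abs] at this
    refine this.trans ?_
    have hk := kap_pos z
    rw [mul_right_comm]
    gcongr
    push_cast
    linarith [C.2]

lemma norm_dilR (α : ℝ → ℂ) (k : ℤ) (a x : ℝ) : ‖dilR α k a x‖ = 2 ^ k * ‖α (2 ^ k * x + a)‖ := by
  simp [dilR]

lemma Prof.continuous_dilR {α : ℝ → ℂ} {c : ℝ≥0} (hα : Prof α c) (k : ℤ) (a : ℝ) :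
    Continuous (dilR α k a) := by
  have := hα.cont
  unfold dilR; fun_prop

lemma Prof.enorm_dilR_le {α : ℝ → ℂ} {c : ℝ≥0} (hα : Prof α c) (k : ℤ) (a x : ℝ) :
    ‖dilR α k a x‖ₑ ≤ c * kk k a x := by
  have h2 := two_zpow_pos k
  rw [← ofReal_norm, norm_dilR, kk, ENNReal.coe_nnreal_eq, ← ENNReal.ofReal_mul c.coe_nonneg]
  apply ENNReal.ofReal_le_ofReal
  have := hα.bd (2 ^ k * x + a)
  calc _ ≤ 2 ^ k * (c * kap (2 ^ k * x + a)) := by gcongr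
    _ = _ := by ring

lemma Prof.norm_dilR_le {α : ℝ → ℂ} {c : ℝ≥0} (hα : Prof α c) (k : ℤ) (a x : ℝ) :
    ‖dilR α k a x‖ ≤ 2 ^ k * c := by
  have h2 := two_zpow_pos k
  rw [norm_dilR]
  have := hα.bd (2 ^ k * x + a)
  have h3 := kap_le_one (2 ^ k * x + a)
  gcongr
  exact this.trans (mul_le_of_le_one_right c.2 h3)

/-- The data `w` weighted on each interval of `Q` by the gain from cancellation at scale `k`. -/
noncomputable def cancelWeight (Q : Set (ℤ × ℤ)) (k : ℤ) (w : ℝ → ℝ≥0∞) (t : ℝ) : ℝ≥0∞ :=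
  ∑' q : Q, (dyadic q).indicator
    (fun t => w t * min 1 (ENNReal.ofReal (2 ^ k * 2 ^ (-q.1.1)))) t

@[fun_prop]
lemma measurable_cancelWeight (Q : Set (ℤ × ℤ)) (k : ℤ) {w : ℝ → ℝ≥0∞} (hw : Measurable w) :
    Measurable (cancelWeight Q k w) := by
  unfold cancelWeight
  exact Measurable.tsum fun q =>
    (hw.mul_const _).indicator (measurableSet_dyadic _)

lemma lconv_cancelWeight (Q : Set (ℤ × ℤ)) (k : ℤ) {w M : ℝ → ℝ≥0∞} (hw : Measurable w)
    (hM : Measurable M) (x : ℝ) :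
    lconv (cancelWeight Q k w) M x = ∑' q : Q, ∫⁻ t in dyadic q,
      w t * min 1 (ENNReal.ofReal (2 ^ k * 2 ^ (-q.1.1))) * M (x - t) := by
  unfold lconv cancelWeight
  simp_rw [← ENNReal.tsum_mul_right]
  have hm : ∀ q : Q, AEMeasurable (fun t => (dyadic q).indicator
      (fun t => w t * min 1 (ENNReal.ofReal (2 ^ k * 2 ^ (-q.1.1)))) t * M (x - t)) :=
    fun q => (((hw.mul_const _).indicator (measurableSet_dyadic _)).mul
      (by fun_prop)).aemeasurable
  rw [lintegral_tsum hm]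
  refine tsum_congr fun q => ?_
  rw [← lintegral_indicator (measurableSet_dyadic _)]
  refine lintegral_congr fun t => ?_
  by_cases ht : t ∈ dyadic q
  · simp [ht]
  · simp [ht]

lemma integrable_conv {b K : ℝ → ℂ} (hb : Integrable b) (hK : Continuous K) {C : ℝ}
    (hC : ∀ x, ‖K x‖ ≤ C) (x : ℝ) : Integrable fun t => b t * K (x - t) :=
  hb.mul_bdd (c := C) (by fun_prop) (Filter.Eventually.of_forall fun t => hC _)

/-- The cancellation estimate. -/
lemma Prof.enorm_conv_le {α : ℝ → ℂ} {c : ℝ≥0} (hα : Prof α c) (k : ℤ) (a : ℝ)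
    {Q : Set (ℤ × ℤ)} (hQ : Pairwise fun q r : Q => Disjoint (dyadic q) (dyadic r))
    {b : ℝ → ℂ} (hb : Nice b) (hb0 : ∀ x, x ∉ ⋃ q : Q, dyadic q → b x = 0)
    (hbq : ∀ q ∈ Q, ∫ y in dyadic q, b y = 0) (x : ℝ) :
    ‖conv b (dilR α k a) x‖ₑ ≤ c * lconv (cancelWeight Q k fun t => ‖b t‖ₑ) (kk k a) x := by
  have h2 := two_zpow_pos k
  have hbm := hb.meas
  have h_int := integrable_conv hb.int (hα.continuous_dilR k a) (hα.norm_dilR_le k a) x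
  have e1 : conv b (dilR α k a) x = ∫ t in ⋃ q : Q, dyadic q, b t * dilR α k a (x - t) := by
    unfold conv
    rw [setIntegral_eq_integral_of_forall_compl_eq_zero]
    intro t ht
    rw [hb0 t ht, zero_mul]
  have hsum := hasSum_integral_iUnion (fun q : Q => measurableSet_dyadic (q : ℤ × ℤ)) hQ
    h_int.integrableOn
  rw [e1, ← hsum.tsum_eq, lconv_cancelWeight _ _ (by fun_prop) (by fun_prop),
    ← ENNReal.tsum_mul_left]
  refine (enorm_tsum_le_tsum_enorm).trans (ENNReal.tsum_le_tsum fun q => ?_)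
  obtain ⟨y, hy⟩ := dyadic_nonempty (q : ℤ × ℤ)
  have hδ := two_zpow_pos (-q.1.1)
  have main : ∀ κ : ℂ, (∀ t ∈ dyadic q, ‖dilR α k a (x - t) - κ‖ₑ ≤
      c * (min 1 (ENNReal.ofReal (2 ^ k * 2 ^ (-q.1.1))) * kk k a (x - t))) →
      ‖∫ t in dyadic q, b t * dilR α k a (x - t)‖ₑ ≤ c * ∫⁻ t in dyadic q,
      ‖b t‖ₑ * min 1 (ENNReal.ofReal (2 ^ k * 2 ^ (-q.1.1))) * kk k a (x - t) := by
    intro κ hκ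
    have e2 : ∫ t in dyadic q, b t * dilR α k a (x - t) =
        ∫ t in dyadic q, b t * (dilR α k a (x - t) - κ) := by
      simp_rw [mul_sub]
      rw [integral_sub h_int.integrableOn (hb.int.mul_const κ).integrableOn,
        integral_mul_const, hbq q q.2, zero_mul, sub_zero]
    rw [e2]
    refine (enorm_integral_le_lintegral_enorm _).trans ?_
    rw [← lintegral_const_mul' _ _ ENNReal.coe_ne_top]
    refine setLIntegral_mono' (measurableSet_dyadic _) fun t ht => ?_
    rw [enorm_mul]
    calc _ ≤ ‖b t‖ₑ * _ := by exact mul_le_mul' le_rfl (hκ t ht)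
      _ = _ := by ring
  rcases le_or_gt (1 : ℝ) (2 ^ k * 2 ^ (-q.1.1)) with h | h
  · refine main 0 fun t _ => ?_
    rw [min_eq_left (by rwa [ENNReal.one_le_ofReal]), one_mul, sub_zero]
    exact hα.enorm_dilR_le k a _
  · refine main (dilR α k a (x - y)) fun t ht => ?_
    rw [min_eq_right (by rw [← ENNReal.ofReal_one]; exact ENNReal.ofReal_le_ofReal h.le), kk,
      ← ENNReal.ofReal_mul (by positivity), ENNReal.coe_nnreal_eq,
      ← ENNReal.ofReal_mul c.coe_nonneg, ← ofReal_norm]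
    apply ENNReal.ofReal_le_ofReal
    have hty := abs_sub_le_of_mem_dyadic ht hy
    set z := 2 ^ k * (x - t) + a with hz
    have habs : |2 ^ k * (t - y)| ≤ 2 ^ k * 2 ^ (-q.1.1) := by
      rw [abs_mul, abs_of_pos h2]; gcongr
    have hl := hα.lip z (2 ^ k * (t - y)) (habs.trans h.le)
    have hzy : z + 2 ^ k * (t - y) = 2 ^ k * (x - y) + a := by rw [hz]; ring
    rw [hzy] at hl
    have hk := kap_pos z
    calc ‖dilR α k a (x - t) - dilR α k a (x - y)‖
        = 2 ^ k * ‖α (2 ^ k * (x - y) + a) - α z‖ := by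
          rw [dilR, dilR, ← mul_sub, norm_mul, norm_sub_rev]; simp [hz]
      _ ≤ 2 ^ k * (c * (2 ^ k * 2 ^ (-q.1.1)) * kap z) := by
          gcongr
          exact hl.trans (by gcongr)
      _ = _ := by ring

lemma tsum_indicator_dyadic_le {Q : Set (ℤ × ℤ)}
    (hQ : Pairwise fun q r : Q => Disjoint (dyadic q) (dyadic r)) (y : ℝ≥0∞) (t : ℝ) :
    ∑' q : Q, (dyadic q).indicator (fun _ => y) t ≤ y := by
  by_cases h : ∃ q : Q, t ∈ dyadic q
  · obtain ⟨q, hq⟩ := h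
    rw [tsum_eq_single q fun r hr => Set.indicator_of_notMem
      (fun ht => Set.disjoint_left.1 (hQ hr) ht hq) _]
    exact Set.indicator_le_self _ _ _
  · push Not at h
    rw [ENNReal.tsum_eq_zero.2 fun q => Set.indicator_of_notMem (h q) _]
    exact zero_le

lemma exists_bad_bound : ∃ D : ℝ≥0, ∀ (Q : Set (ℤ × ℤ)),
    (Pairwise fun q r : Q => Disjoint (dyadic q) (dyadic r)) →
    ∀ (Λ : Finset ℤ) (M : ℤ → ℝ → ℝ≥0∞) (C : ℝ≥0∞) (R : ℝ), 1 ≤ R →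
    (∀ k ∈ Λ, Mom (M k) k C R) → ∀ w : ℝ → ℝ≥0∞, Measurable w →
    ∫⁻ x in (tripleUnion Q)ᶜ, ∑ k ∈ Λ, lconv (cancelWeight Q k w) (M k) x ≤
      C * (D * ENNReal.ofReal (1 + Real.log R)) * ∫⁻ x, w x := by
  obtain ⟨D, hD⟩ := exists_sum_min_le
  refine ⟨D, fun Q hQ Λ M C R hR hM w hw => ?_⟩
  have hMm : ∀ k ∈ Λ, Measurable (M k) := fun k hk => (hM k hk).meas
  rw [lintegral_finsetSum' _ fun k hk =>
    (measurable_lconv (measurable_cancelWeight Q k hw) (hMm k hk)).aemeasurable]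
  have h1 : ∀ k ∈ Λ, ∫⁻ x in (tripleUnion Q)ᶜ, lconv (cancelWeight Q k w) (M k) x ≤
      ∫⁻ t, ∑' q : Q, (dyadic q).indicator (fun t => w t *
        (C * (min 1 (ENNReal.ofReal (2 ^ k * 2 ^ (-q.1.1))) *
          min 1 (ENNReal.ofReal (R / (2 ^ k * 2 ^ (-q.1.1))))))) t := by
    intro k hk
    have := hMm k hk
    unfold lconv
    rw [lintegral_lintegral_swap (by fun_prop)]
    refine lintegral_mono fun t => ?_
    rw [lintegral_const_mul _ (by fun_prop)]
    unfold cancelWeight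
    rw [← ENNReal.tsum_mul_right]
    refine ENNReal.tsum_le_tsum fun q => ?_
    by_cases ht : t ∈ dyadic q
    swap
    · simp [ht]
    rw [Set.indicator_of_mem ht, Set.indicator_of_mem ht]
    have h3 : ∫⁻ x in (tripleUnion Q)ᶜ, M k (x - t) ≤
        C * min 1 (ENNReal.ofReal (R / (2 ^ k * 2 ^ (-q.1.1)))) := by
      refine le_trans ?_ ((hM k hk).tail (two_zpow_pos (-q.1.1)))
      rw [← lintegral_indicator (measurableSet_tripleUnion Q).compl,
        ← lintegral_indicator (measurableSet_le measurable_const (by fun_prop)),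
        ← lintegral_sub_right_eq_self (Set.indicator {x : ℝ | 2 ^ (-q.1.1) ≤ |x|} (M k)) t]
      refine lintegral_mono fun x => ?_
      by_cases hx : x ∈ (tripleUnion Q)ᶜ
      · rw [Set.indicator_of_mem hx, Set.indicator_of_mem]
        refine le_abs_sub_of_not_mem_triple (fun hx' => hx ?_) ht
        exact Set.mem_iUnion.2 ⟨q, hx'⟩
      · rw [Set.indicator_of_notMem hx]; exact zero_le
    calc _ ≤ w t * min 1 (ENNReal.ofReal (2 ^ k * 2 ^ (-q.1.1))) *
          (C * min 1 (ENNReal.ofReal (R / (2 ^ k * 2 ^ (-q.1.1))))) := by gcongr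
      _ = _ := by ring
  refine (Finset.sum_le_sum h1).trans ?_
  rw [← lintegral_finsetSum' _ fun k _ => (Measurable.tsum fun q =>
    (hw.mul_const _).indicator (measurableSet_dyadic _)).aemeasurable,
    ← lintegral_const_mul _ hw]
  refine lintegral_mono fun t => ?_
  dsimp only
  rw [← Summable.tsum_finsetSum fun _ _ => ENNReal.summable]
  refine le_trans (ENNReal.tsum_le_tsum fun q => ?_) (tsum_indicator_dyadic_le hQ
    (C * (D * ENNReal.ofReal (1 + Real.log R)) * w t) t)
  by_cases ht : t ∈ dyadic q
  swap
  · simp [ht]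
  simp only [Set.indicator_of_mem ht]
  rw [← Finset.mul_sum, ← Finset.mul_sum, mul_comm]
  gcongr
  exact hD Λ _ R (two_zpow_pos _) hR

lemma lintegral_enorm_sq_fourier (h : 𝓢(ℝ, ℂ)) :
    ∫⁻ ξ, ‖𝓕 h ξ‖ₑ ^ 2 = ∫⁻ x, ‖h x‖ₑ ^ 2 := by
  have key : ∀ f : 𝓢(ℝ, ℂ), ∫⁻ x, ‖f x‖ₑ ^ 2 = ENNReal.ofReal (∫ x, ‖f x‖ ^ 2) := by
    intro f
    rw [ofReal_integral_eq_lintegral_ofReal]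
    · refine lintegral_congr fun x => ?_
      rw [← ofReal_norm, ENNReal.ofReal_pow (norm_nonneg _)]
    · exact (memLp_two_iff_integrable_sq_norm f.continuous.aestronglyMeasurable).1 (f.memLp 2)
    · exact Filter.Eventually.of_forall fun x => by positivity
  rw [key, key, SchwartzMap.integral_norm_sq_fourier]

lemma conv_eq_schwartz (f K : 𝓢(ℝ, ℂ)) :
    conv f K = SchwartzMap.convolution (ContinuousLinearMap.mul ℂ ℂ) f K := by
  ext x
  rw [SchwartzMap.convolution_apply]
  rfl

lemma lintegral_conv_sq_le_schwartz (f K : 𝓢(ℝ, ℂ)) {C : ℝ≥0} (hC : ∀ ξ, ‖𝓕 K ξ‖ ≤ C) :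
    ∫⁻ x, ‖conv f K x‖ₑ ^ 2 ≤ C ^ 2 * ∫⁻ x, ‖f x‖ₑ ^ 2 := by
  rw [conv_eq_schwartz, ← lintegral_enorm_sq_fourier, ← lintegral_enorm_sq_fourier f,
    ← lintegral_const_mul' _ _ (by simp)]
  refine lintegral_mono fun ξ => ?_
  rw [SchwartzMap.fourier_convolution, SchwartzMap.pairing_apply_apply,
    ContinuousLinearMap.mul_apply', enorm_mul, mul_pow, mul_comm]
  gcongr
  rw [← ofReal_norm, ENNReal.coe_nnreal_eq]
  exact ENNReal.ofReal_le_ofReal (hC ξ)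

lemma eLpNorm_two_sq (f : ℝ → ℂ) : eLpNorm f 2 ^ 2 = ∫⁻ x, ‖f x‖ₑ ^ 2 := by
  have := eLpNorm_nnreal_pow_eq_lintegral (f := f) (μ := volume) (p := 2) (by norm_num)
  simpa using this

lemma Nice.memLp_two {g : ℝ → ℂ} (hg : Nice g) : MemLp g 2 := by
  obtain ⟨C, hC⟩ := hg.bdd
  refine (memLp_two_iff_integrable_sq_norm hg.meas.aestronglyMeasurable).2 ?_
  have := hg.meas
  refine (hg.int.norm.const_mul C).mono' (by fun_prop) (Filter.Eventually.of_forall fun x => ?_)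
  rw [Real.norm_eq_abs, abs_of_nonneg (by positivity), sq]
  exact mul_le_mul_of_nonneg_right (hC x) (norm_nonneg _)

lemma enorm_conv_le (f K : ℝ → ℂ) (x : ℝ) :
    ‖conv f K x‖ₑ ≤ lconv (fun t => ‖f t‖ₑ) (fun t => ‖K t‖ₑ) x := by
  unfold conv lconv
  refine (enorm_integral_le_lintegral_enorm _).trans (le_of_eq ?_)
  simp_rw [enorm_mul]

lemma nice_schwartz (K : 𝓢(ℝ, ℂ)) : Nice K :=
  ⟨K.continuous.measurable, K.integrable, SchwartzMap.seminorm ℝ 0 0 K,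
    fun x => SchwartzMap.norm_le_seminorm ℝ K x⟩

lemma Nice.integrable_conv {b K : ℝ → ℂ} (hb : Nice b) (hK : Nice K) (x : ℝ) :
    Integrable fun t => b t * K (x - t) := by
  obtain ⟨C, hC⟩ := hK.bdd
  have := hK.meas
  exact hb.int.mul_bdd (c := C) (Measurable.aestronglyMeasurable (by fun_prop))
    (Filter.Eventually.of_forall fun t => hC _)

lemma enorm_conv_le_eLpNorm {f K : ℝ → ℂ} (hf : AEStronglyMeasurable f) (hK : Measurable K)
    (x : ℝ) : ‖conv f K x‖ₑ ≤ eLpNorm f 2 * eLpNorm K 2 := by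
  refine (enorm_conv_le f K x).trans ?_
  have h := ENNReal.lintegral_mul_le_Lp_mul_Lq (μ := volume) (p := 2) (q := 2)
    ⟨by norm_num, by norm_num, by norm_num⟩ hf.enorm
    (g := fun t => ‖K (x - t)‖ₑ) (by fun_prop)
  refine h.trans (le_of_eq ?_)
  rw [lintegral_sub_left_eq_self (fun t => ‖K t‖ₑ ^ (2 : ℝ)) x]
  rw [eLpNorm_eq_lintegral_rpow_enorm_toReal (by norm_num) (by norm_num),
    eLpNorm_eq_lintegral_rpow_enorm_toReal (by norm_num) (by norm_num)]
  simp

lemma edist_conv_le {f g K : ℝ → ℂ} (hf : Nice f) (hg : Nice g) (hK : Nice K) (x : ℝ) :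
    edist (conv f K x) (conv g K x) ≤ eLpNorm (f - g) 2 * eLpNorm K 2 := by
  have e : conv f K x - conv g K x = conv (f - g) K x := by
    unfold conv
    rw [← integral_sub (hf.integrable_conv hK x) (hg.integrable_conv hK x)]
    simp [sub_mul]
  rw [edist_eq_enorm_sub, e]
  exact enorm_conv_le_eLpNorm (hf.meas.sub hg.meas).aestronglyMeasurable hK.meas x

lemma Nice.exists_schwartz_approx {g : ℝ → ℂ} (hg : Nice g) :
    ∃ (f : ℕ → 𝓢(ℝ, ℂ)) (ε : ℕ → ℝ≥0∞), Filter.Tendsto ε Filter.atTop (nhds 0) ∧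
      ∀ j, eLpNorm (g - ⇑(f j)) 2 ≤ ε j := by
  obtain ⟨ε, -, hε, hlim⟩ := exists_seq_strictAnti_tendsto (0 : ℝ)
  have happ : ∀ j : ℕ, ∃ f : 𝓢(ℝ, ℂ), eLpNorm (g - ⇑f) 2 ≤ ENNReal.ofReal (ε j) := by
    intro j
    obtain ⟨f, h1, h2, h3⟩ := MemLp.exist_eLpNorm_sub_le (p := 2) (by norm_num) (by norm_num)
      hg.memLp_two (hε j)
    exact ⟨h1.toSchwartzMap h2, h3⟩
  choose f hf using happ
  refine ⟨f, fun j => ENNReal.ofReal (ε j), ?_, hf⟩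
  have := ENNReal.tendsto_ofReal hlim
  rwa [ENNReal.ofReal_zero] at this

lemma lintegral_conv_sq_le {g : ℝ → ℂ} (hg : Nice g) (K : 𝓢(ℝ, ℂ)) {C : ℝ≥0}
    (hC : ∀ ξ, ‖𝓕 K ξ‖ ≤ C) :
    ∫⁻ x, ‖conv g K x‖ₑ ^ 2 ≤ C ^ 2 * ∫⁻ x, ‖g x‖ₑ ^ 2 := by
  rw [← eLpNorm_two_sq, ← eLpNorm_two_sq, ← mul_pow]
  gcongr
  obtain ⟨f, ε, hlim0, hf⟩ := hg.exists_schwartz_approx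
  have hK2 : eLpNorm K 2 ≠ ∞ := (nice_schwartz K).memLp_two.2.ne
  have hpt : ∀ x, Filter.Tendsto (fun j => conv (f j) K x) Filter.atTop (nhds (conv g K x)) := by
    intro x
    rw [tendsto_iff_edist_tendsto_0]
    have h2 : Filter.Tendsto (fun j : ℕ => ε j * eLpNorm K 2)
        Filter.atTop (nhds 0) := by
      have := ENNReal.Tendsto.mul_const hlim0 (Or.inr hK2)
      rwa [zero_mul] at this
    refine tendsto_of_tendsto_of_tendsto_of_le_of_le (g := fun _ => 0) tendsto_const_nhds h2
      (fun _ => zero_le) fun j => ?_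
    rw [edist_comm]
    refine (edist_conv_le hg (nice_schwartz (f j)) (nice_schwartz K) x).trans ?_
    gcongr
    exact hf j
  have hC2 : ∀ j, eLpNorm (conv (f j) K) 2 ≤ C * (eLpNorm g 2 + ε j) := by
    intro j
    have h1 := lintegral_conv_sq_le_schwartz (f j) K hC
    rw [← eLpNorm_two_sq, ← eLpNorm_two_sq, ← mul_pow] at h1
    have h2 := (ENNReal.pow_le_pow_left_iff two_ne_zero).1 h1
    refine h2.trans ?_
    gcongr
    have h3 := eLpNorm_sub_le (μ := volume) (p := 2) hg.meas.aestronglyMeasurable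
      (hg.meas.sub (f j).continuous.measurable).aestronglyMeasurable (by norm_num)
    have e : g - (g - ⇑(f j)) = ⇑(f j) := by ext x; simp
    rw [e] at h3
    exact h3.trans (add_le_add le_rfl (hf j))
  have hlim : Filter.Tendsto (fun j => C * (eLpNorm g 2 + ε j)) Filter.atTop
      (nhds (C * eLpNorm g 2)) := by
    have := ENNReal.Tendsto.const_mul (a := (C : ℝ≥0∞))
      ((tendsto_const_nhds (x := eLpNorm g 2)).add hlim0) (Or.inr ENNReal.coe_ne_top)
    rwa [add_zero] at this
  have hm : ∀ j, AEStronglyMeasurable (conv (f j) K) := fun j => by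
    rw [conv_eq_schwartz]
    exact (SchwartzMap.continuous _).aestronglyMeasurable
  have hlow := Lp.eLpNorm_lim_le_liminf_eLpNorm (p := 2) hm _ (Filter.Eventually.of_forall hpt)
  refine hlow.trans ?_
  rw [← hlim.liminf_eq]
  exact Filter.liminf_le_liminf (Filter.Eventually.of_forall hC2)

/-- The dilated and translated profile as a Schwartz function. -/
noncomputable def dilS (α : 𝓢(ℝ, ℂ)) (k : ℤ) (a : ℝ) : 𝓢(ℝ, ℂ) :=
  (2 : ℂ) ^ k • SchwartzMap.compCLMOfContinuousLinearEquiv ℂ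
    (ContinuousLinearEquiv.unitsEquivAut ℝ (Units.mk0 ((2 : ℝ) ^ k) (two_zpow_pos k).ne'))
    (SchwartzMap.compSubConstCLM ℂ (-a) α)

lemma coe_dilS (α : 𝓢(ℝ, ℂ)) (k : ℤ) (a : ℝ) : ⇑(dilS α k a) = dilR α k a := by
  ext x
  simp [dilS, dilR, mul_comm x]

lemma fourier_dilS (α : 𝓢(ℝ, ℂ)) (k : ℤ) (a ξ : ℝ) :
    𝓕 (dilS α k a) ξ =
      (Real.fourierChar (a * (2 ^ (-k) * ξ)) : ℂ) * 𝓕 α (2 ^ (-k) * ξ) := by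
  have h2 := two_zpow_pos k
  set η : ℝ := 2 ^ (-k) * ξ with hη
  have hξ : ξ = 2 ^ k * η := by
    rw [hη, ← mul_assoc, ← zpow_add₀ (by norm_num)]; simp
  rw [SchwartzMap.fourier_coe, SchwartzMap.fourier_coe, Real.fourier_real_eq, Real.fourier_real_eq]
  set F : ℝ → ℂ := fun w => Real.fourierChar (-((w - a) * η)) • α w with hF
  have e1 : ∀ v : ℝ, Real.fourierChar (-(v * ξ)) • dilS α k a v =
      (2 : ℂ) ^ k * F (2 ^ k * v + a) := by
    intro v
    rw [coe_dilS, hF, hξ]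
    simp only [dilR, Circle.smul_def, smul_eq_mul, add_sub_cancel_right]
    rw [show 2 ^ k * v * η = v * (2 ^ k * η) by ring]
    ring
  have e2 : ∫ v : ℝ, F (2 ^ k * v + a) = ((2 ^ k)⁻¹ : ℝ) • ∫ v, F v := by
    have := Measure.integral_comp_mul_left (fun v => F (v + a)) ((2 : ℝ) ^ k)
    rw [this, abs_of_pos (inv_pos.2 h2), integral_add_right_eq_self F]
  have e3 : ∀ v, F v = (Real.fourierChar (a * η) : ℂ) * (Real.fourierChar (-(v * η)) • α v) := by
    intro v
    rw [← smul_eq_mul, ← Circle.smul_def, smul_smul, ← AddChar.map_add_eq_mul]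
    simp only [hF]
    congr 2
    ring
  simp_rw [e1]
  rw [integral_const_mul, e2]
  simp_rw [e3]
  rw [integral_const_mul, Complex.real_smul, ← mul_assoc]
  push_cast
  rw [mul_inv_cancel₀ (zpow_ne_zero _ two_ne_zero), one_mul]

lemma norm_fourier_dilS (α : 𝓢(ℝ, ℂ)) (k : ℤ) (a ξ : ℝ) :
    ‖𝓕 (dilS α k a) ξ‖ = ‖𝓕 α (2 ^ (-k) * ξ)‖ := by
  rw [fourier_dilS, norm_mul, Circle.norm_coe, one_mul]

/-- The Fourier transform of `α` is bounded by `C` and lives on `1/2 < |ξ| < 2`. -/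
structure Band (α : 𝓢(ℝ, ℂ)) (C : ℝ≥0) : Prop where
  bd : ∀ ξ, ‖𝓕 α ξ‖ ≤ C
  supp : ∀ ξ, 𝓕 α ξ ≠ 0 → 1 / 2 < |ξ| ∧ |ξ| < 2

lemma Band.sum_le {α : 𝓢(ℝ, ℂ)} {C : ℝ≥0} (hα : Band α C) (Λ : Finset ℤ) (ξ : ℝ) :
    ∑ k ∈ Λ, ‖𝓕 α (2 ^ (-k) * ξ)‖ ≤ 2 * C := by
  by_cases hξ : ξ = 0
  · have : 𝓕 α 0 = 0 := by
      by_contra h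
      have := (hα.supp 0 h).1
      norm_num at this
    simp [hξ, this]
  obtain ⟨m, hm1, hm2⟩ := exists_mem_Ico_zpow (y := (2 : ℝ)) (abs_pos.2 hξ) (by norm_num)
  have hz : ∀ k : ℤ, k ∉ Finset.Icc m (m + 1) → ‖𝓕 α (2 ^ (-k) * ξ)‖ = 0 := by
    intro k hk
    by_contra h
    obtain ⟨h1, h2⟩ := hα.supp _ (norm_ne_zero_iff.1 h)
    have hk2 := two_zpow_pos k
    rw [abs_mul, abs_of_pos (two_zpow_pos _), zpow_neg] at h1 h2
    rw [inv_mul_lt_iff₀ hk2] at h2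
    rw [lt_inv_mul_iff₀ hk2] at h1
    apply hk
    rw [Finset.mem_Icc]
    have h3 : (2 : ℝ) ^ m < 2 ^ (k + 1) := by
      rw [zpow_add_one₀ (by norm_num)]; linarith
    have h4 : (2 : ℝ) ^ k < 2 ^ (m + 2) := by
      have : (2 : ℝ) ^ (m + 2) = 2 ^ (m + 1) * 2 := by
        rw [← zpow_add_one₀ (by norm_num)]; congr 1; ring
      rw [this]; linarith
    have h3' := (zpow_lt_zpow_iff_right₀ (by norm_num : (1 : ℝ) < 2)).1 h3
    have h4' := (zpow_lt_zpow_iff_right₀ (by norm_num : (1 : ℝ) < 2)).1 h4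
    omega
  calc ∑ k ∈ Λ, ‖𝓕 α (2 ^ (-k) * ξ)‖
      = ∑ k ∈ Λ with k ∈ Finset.Icc m (m + 1), ‖𝓕 α (2 ^ (-k) * ξ)‖ := by
        rw [Finset.sum_filter]
        refine Finset.sum_congr rfl fun k _ => ?_
        split_ifs with h
        · rfl
        · exact hz k h
    _ ≤ ∑ k ∈ Finset.Icc m (m + 1), ‖𝓕 α (2 ^ (-k) * ξ)‖ :=
        Finset.sum_le_sum_of_subset_of_nonneg
          (fun k hk => (Finset.mem_filter.1 hk).2) (fun _ _ _ => norm_nonneg _)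
    _ ≤ ∑ k ∈ Finset.Icc m (m + 1), (C : ℝ) := Finset.sum_le_sum fun k _ => hα.bd _
    _ = 2 * C := by
        rw [Finset.sum_const, Int.card_Icc, nsmul_eq_mul]
        congr 1
        have : (m + 1 + 1 - m).toNat = 2 := by omega
        rw [this]; norm_num

lemma conv_sum_smul_dilS {g : ℝ → ℂ} (hg : Nice g) (α : 𝓢(ℝ, ℂ)) (Λ : Finset ℤ) (a : ℝ)
    (ε : ℤ → ℂ) (x : ℝ) :
    conv g (∑ k ∈ Λ, ε k • dilS α k a : 𝓢(ℝ, ℂ)) x =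
      ∑ k ∈ Λ, ε k * conv g (dilR α k a) x := by
  unfold conv
  rw [Finset.sum_congr rfl fun k _ => (integral_const_mul (ε k) _).symm, ← integral_finsetSum]
  · refine integral_congr_ae (Filter.Eventually.of_forall fun t => ?_)
    simp only [sum_apply, smul_apply, coe_dilS, smul_eq_mul,
      Finset.mul_sum]
    exact Finset.sum_congr rfl fun k _ => by ring
  · intro k _
    have := hg.integrable_conv (nice_schwartz (dilS α k a)) x
    rw [coe_dilS] at this
    exact this.const_mul _

/-- Uniform `L²` bounds for the signed sums of the frequency-localised pieces. -/
lemma Band.lintegral_sum_sq_le {α : 𝓢(ℝ, ℂ)} {C : ℝ≥0} (hα : Band α C) {g : ℝ → ℂ}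
    (hg : Nice g) (Λ : Finset ℤ) (a : ℝ) {ε : ℤ → ℂ} (hε : ∀ k, ‖ε k‖ ≤ 1) :
    ∫⁻ x, ‖∑ k ∈ Λ, ε k * conv g (dilR α k a) x‖ₑ ^ 2 ≤
      ((2 * C : ℝ≥0) : ℝ≥0∞) ^ 2 * ∫⁻ x, ‖g x‖ₑ ^ 2 := by
  simp_rw [← conv_sum_smul_dilS hg α Λ a ε]
  refine lintegral_conv_sq_le hg _ fun ξ => ?_
  have e : 𝓕 (∑ k ∈ Λ, ε k • dilS α k a) = ∑ k ∈ Λ, ε k • 𝓕 (dilS α k a) := by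
    simp
  rw [e, sum_apply]
  refine (norm_sum_le _ _).trans (le_trans ?_ (hα.sum_le Λ ξ))
  refine Finset.sum_le_sum fun k _ => ?_
  rw [smul_apply, norm_smul, norm_fourier_dilS]
  exact mul_le_of_le_one_left (norm_nonneg _) (hε k)

/-- The function `ψ` as a Schwartz function. -/
noncomputable def psiS (φ : 𝓢(ℝ, ℂ)) : 𝓢(ℝ, ℂ) := dilS φ 1 0 - φ

lemma coe_psiS (φ : 𝓢(ℝ, ℂ)) : ⇑(psiS φ) = psiOf φ := by
  ext x
  simp [psiS, coe_dilS, dilR, psiOf]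

/-- The reflection `x ↦ α (-x)` of a Schwartz function. -/
noncomputable def reflS (α : 𝓢(ℝ, ℂ)) : 𝓢(ℝ, ℂ) :=
  SchwartzMap.compCLMOfContinuousLinearEquiv ℂ (ContinuousLinearEquiv.neg ℝ) α

@[simp]
lemma reflS_apply (α : 𝓢(ℝ, ℂ)) (x : ℝ) : reflS α x = α (-x) := by
  simp [reflS]

lemma fourier_reflS (α : 𝓢(ℝ, ℂ)) (ξ : ℝ) : 𝓕 (reflS α) ξ = 𝓕 α (-ξ) := by
  rw [SchwartzMap.fourier_coe, SchwartzMap.fourier_coe, Real.fourier_real_eq, Real.fourier_real_eq,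
    ← integral_neg_eq_self]
  simp

lemma Band.refl {α : 𝓢(ℝ, ℂ)} {C : ℝ≥0} (h : Band α C) : Band (reflS α) C where
  bd ξ := by rw [fourier_reflS]; exact h.bd _
  supp ξ hξ := by
    rw [fourier_reflS] at hξ
    simpa using h.supp _ hξ

lemma ft1_eq_fourier (φ : 𝓢(ℝ, ℂ)) (ξ : ℝ) : ft1 φ ξ = 𝓕 φ ξ := by
  rw [SchwartzMap.fourier_coe, Real.fourier_real_eq_integral_exp_smul]
  unfold ft1
  refine integral_congr_ae (Filter.Eventually.of_forall fun x => ?_)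
  simp only [smul_eq_mul]
  rw [mul_comm]

lemma exists_band_psiS {φ : 𝓢(ℝ, ℂ)} (h1 : ∀ ξ : ℝ, |ξ| ≤ 1 / 2 → ft1 φ ξ = 1)
    (h2 : ∀ ξ : ℝ, 1 ≤ |ξ| → ft1 φ ξ = 0) : ∃ C, Band (psiS φ) C := by
  obtain ⟨C, hC⟩ := (nice_schwartz (𝓕 (psiS φ))).bdd
  refine ⟨C.toNNReal, fun ξ => (hC ξ).trans (Real.le_coe_toNNReal C), fun ξ hξ => ?_⟩
  have e : 𝓕 (psiS φ) ξ = ft1 φ (2⁻¹ * ξ) - ft1 φ ξ := by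
    have : 𝓕 (psiS φ) = 𝓕 (dilS φ 1 0) - 𝓕 φ := by
      exact map_sub (FourierTransform.fourierCLM ℂ 𝓢(ℝ, ℂ)) _ _
    rw [this, sub_apply, fourier_dilS, ft1_eq_fourier, ft1_eq_fourier]
    simp
  rw [e] at hξ
  refine ⟨?_, ?_⟩
  · by_contra! h
    apply hξ
    rw [h1 ξ h, h1 _ ?_, sub_self]
    rw [abs_mul, abs_of_pos (by norm_num : (0 : ℝ) < 2⁻¹)]
    linarith [abs_nonneg ξ]
  · by_contra! h
    apply hξ
    rw [h2 ξ (by linarith), h2 _ ?_, sub_self]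
    rw [abs_mul, abs_of_pos (by norm_num : (0 : ℝ) < 2⁻¹)]
    linarith

lemma dilR_reflS (α : 𝓢(ℝ, ℂ)) (k : ℤ) (a x : ℝ) :
    dilR (reflS α) k (-a) x = dilR α k a (-x) := by
  simp only [dilR, reflS_apply]
  congr 2
  ring

lemma Nice.conv {f : ℝ → ℂ} (hf : Nice f) (K : 𝓢(ℝ, ℂ)) : Nice (conv f K) := by
  have hi : Integrable (_root_.conv f K) :=
    hf.int.integrable_convolution (ContinuousLinearMap.mul ℝ ℂ) K.integrable
  obtain ⟨C, hC⟩ := (nice_schwartz K).bdd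
  have hfm := hf.meas
  have hKm := K.continuous.measurable
  refine ⟨?_, hi, (∫ t, ‖f t‖) * C, fun x => ?_⟩
  · unfold _root_.conv
    refine StronglyMeasurable.measurable ?_
    refine StronglyMeasurable.integral_prod_right' (f := fun z : ℝ × ℝ => f z.2 * K (z.1 - z.2)) ?_
    exact Measurable.stronglyMeasurable (by fun_prop)
  · unfold _root_.conv
    refine (norm_integral_le_integral_norm _).trans ?_
    rw [← integral_mul_const]
    refine integral_mono (hf.integrable_conv (nice_schwartz K) x).norm (hf.int.norm.mul_const _)
      fun t => ?_
    rw [norm_mul]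
    exact mul_le_mul_of_nonneg_left (hC _) (norm_nonneg _)

lemma Nice.continuous_conv {f : ℝ → ℂ} (hf : Nice f) (K : 𝓢(ℝ, ℂ)) :
    Continuous (_root_.conv f K) := by
  obtain ⟨C, hC⟩ := (nice_schwartz K).bdd
  have hfm := hf.meas
  have hKm := K.continuous.measurable
  refine continuous_of_dominated (bound := fun t => ‖f t‖ * C) (fun x => ?_) (fun x => ?_) ?_ ?_
  · exact Measurable.aestronglyMeasurable (by fun_prop)
  · refine Filter.Eventually.of_forall fun t => ?_
    rw [norm_mul]
    exact mul_le_mul_of_nonneg_left (hC _) (norm_nonneg _)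
  · exact hf.int.norm.mul_const _
  · refine Filter.Eventually.of_forall fun t => ?_
    exact continuous_const.mul (K.continuous.comp (by fun_prop))

lemma integral_conv_mul {f h : ℝ → ℂ} (hf : Nice f) (hh : Nice h) (α : 𝓢(ℝ, ℂ)) (k : ℤ) (a : ℝ) :
    ∫ x, conv f (dilR α k a) x * h x = ∫ x, f x * conv h (dilR (reflS α) k (-a)) x := by
  have hK := (dilS α k a).integrable (μ := volume)
  rw [coe_dilS] at hK
  obtain ⟨C, hC⟩ := hh.bdd
  have hi : Integrable (fun z : ℝ × ℝ => f z.2 * dilR α k a (z.1 - z.2)) :=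
    hf.int.convolution_integrand (ContinuousLinearMap.mul ℝ ℂ) hK
  have hi2 : Integrable (fun z : ℝ × ℝ => f z.2 * dilR α k a (z.1 - z.2) * h z.1) :=
    hi.mul_bdd (c := C) (hh.meas.comp measurable_fst).aestronglyMeasurable
      (Filter.Eventually.of_forall fun z => hC _)
  unfold conv
  simp_rw [← integral_mul_const, ← integral_const_mul]
  rw [integral_integral_swap hi2]
  refine integral_congr_ae (Filter.Eventually.of_forall fun t => ?_)
  refine integral_congr_ae (Filter.Eventually.of_forall fun x => ?_)
  simp only [dilR_reflS, neg_sub]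
  ring

lemma Nice.add {f g : ℝ → ℂ} (hf : Nice f) (hg : Nice g) : Nice (f + g) := by
  obtain ⟨C, hC⟩ := hf.bdd
  obtain ⟨D, hD⟩ := hg.bdd
  exact ⟨hf.meas.add hg.meas, hf.int.add hg.int, C + D, fun x =>
    (norm_add_le _ _).trans (add_le_add (hC x) (hD x))⟩

lemma Nice.const_mul {f : ℝ → ℂ} (hf : Nice f) (c : ℂ) : Nice fun x => c * f x := by
  obtain ⟨C, hC⟩ := hf.bdd
  refine ⟨hf.meas.const_mul c, hf.int.const_mul c, ‖c‖ * C, fun x => ?_⟩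
  rw [norm_mul]
  exact mul_le_mul_of_nonneg_left (hC x) (norm_nonneg _)

lemma nice_zero : Nice fun _ => 0 := ⟨measurable_const, integrable_zero _ _ _, 0, by simp⟩

lemma Nice.sum {F : ℤ → ℝ → ℂ} (Λ : Finset ℤ) (hF : ∀ k ∈ Λ, Nice (F k)) :
    Nice fun x => ∑ k ∈ Λ, F k x := by
  classical
  induction Λ using Finset.induction_on with
  | empty => simpa using nice_zero
  | insert k Λ hk ih =>
    simp_rw [Finset.sum_insert hk]
    exact (hF k (Finset.mem_insert_self _ _)).add
      (ih fun j hj => hF j (Finset.mem_insert_of_mem hj))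

lemma Nice.mul {f g : ℝ → ℂ} (hf : Nice f) (hg : Nice g) : Nice fun x => f x * g x := by
  obtain ⟨C, hC⟩ := hf.bdd
  obtain ⟨D, hD⟩ := hg.bdd
  refine ⟨hf.meas.mul hg.meas, hf.int.mul_bdd (c := D) hg.meas.aestronglyMeasurable
    (Filter.Eventually.of_forall hD), C * D, fun x => ?_⟩
  rw [norm_mul]
  exact mul_le_mul (hC x) (hD x) (norm_nonneg _) ((norm_nonneg _).trans (hC x))

lemma Nice.conv_dilR {f : ℝ → ℂ} (hf : Nice f) (α : 𝓢(ℝ, ℂ)) (k : ℤ) (a : ℝ) :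
    Nice (_root_.conv f (dilR α k a)) := coe_dilS α k a ▸ hf.conv _

lemma Nice.continuous_conv_dilR {f : ℝ → ℂ} (hf : Nice f) (α : 𝓢(ℝ, ℂ)) (k : ℤ) (a : ℝ) :
    Continuous (_root_.conv f (dilR α k a)) := coe_dilS α k a ▸ hf.continuous_conv _

/-- Duality: an `L^p` bound follows from testing against nice continuous functions. -/
lemma lintegral_rpow_le_of_pairing {F : ℝ → ℂ} (hF : Nice F) (hc : Continuous F) {p q : ℝ}
    (hp : 2 ≤ p) (hpq : p.HolderConjugate q) {B : ℝ≥0∞}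
    (h : ∀ u : ℝ → ℂ, Nice u → Continuous u →
      ‖∫ x, F x * u x‖ₑ ≤ B * (∫⁻ x, ‖u x‖ₑ ^ q) ^ (1 / q)) :
    ∫⁻ x, ‖F x‖ₑ ^ p ≤ B ^ p := by
  have hp0 : 0 < p := by linarith
  obtain ⟨C, hC⟩ := hF.bdd
  have hC0 : 0 ≤ C := (norm_nonneg _).trans (hC 0)
  have hFm := hF.meas
  set r : ℝ → ℝ := fun x => ‖F x‖ ^ (p - 2) with hr
  have hrc : Continuous r := hc.norm.rpow_const fun x => Or.inr (by linarith)
  have hrb : ∀ x, ‖r x‖ ≤ C ^ (p - 2) := fun x => by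
    rw [Real.norm_of_nonneg (by positivity)]
    exact Real.rpow_le_rpow (norm_nonneg _) (hC x) (by linarith)
  set u : ℝ → ℂ := fun x => (r x : ℂ) * (starRingEnd ℂ) (F x) with hu
  have huc : Continuous u := by fun_prop
  have hun : ∀ x, ‖u x‖ = ‖F x‖ ^ (p - 1) := by
    intro x
    rw [hu]
    simp only [norm_mul, Complex.norm_real, RCLike.norm_conj]
    rw [Real.norm_of_nonneg (by positivity), hr]
    rcases (norm_nonneg (F x)).eq_or_lt with h0 | h0
    · rw [← h0, mul_zero, Real.zero_rpow (by linarith)]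
    · rw [← Real.rpow_add_one h0.ne']
      congr 1
      ring
  have hub : ∀ x, ‖u x‖ ≤ C ^ (p - 2) * C := fun x => by
    rw [hu]
    simp only [norm_mul, Complex.norm_real, RCLike.norm_conj]
    exact mul_le_mul (hrb x) (hC x) (norm_nonneg _) (by positivity)
  have hui : Integrable u := by
    refine (hF.int.norm.const_mul (C ^ (p - 2))).mono' huc.aestronglyMeasurable
      (Filter.Eventually.of_forall fun x => ?_)
    rw [hu]
    simp only [norm_mul, Complex.norm_real, RCLike.norm_conj]
    exact mul_le_mul_of_nonneg_right (hrb x) (norm_nonneg _)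
  have hnu : Nice u := ⟨huc.measurable, hui, _, hub⟩
  have hfu : ∀ x, F x * u x = ((‖F x‖ ^ p : ℝ) : ℂ) := by
    intro x
    have : F x * u x = (r x : ℂ) * ((‖F x‖ ^ 2 : ℝ) : ℂ) := by
      rw [hu]
      simp only
      rw [mul_left_comm, Complex.mul_conj']
      push_cast; rfl
    rw [this, ← Complex.ofReal_mul, hr]
    congr 1
    rcases (norm_nonneg (F x)).eq_or_lt with h0 | h0
    · rw [← h0, Real.zero_rpow hp0.ne']; simp
    · rw [← Real.rpow_natCast, ← Real.rpow_add h0]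
      congr 1
      push_cast; ring
  have hpi : Integrable fun x => ‖F x‖ ^ p := by
    have := (hF.mul hnu).int.norm
    simp_rw [hfu, Complex.norm_real] at this
    refine this.congr (Filter.Eventually.of_forall fun x => ?_)
    exact Real.norm_of_nonneg (by positivity)
  have hI : ‖∫ x, F x * u x‖ₑ = ∫⁻ x, ‖F x‖ₑ ^ p := by
    simp_rw [hfu]
    rw [integral_complex_ofReal, ← ofReal_norm, Complex.norm_real, Real.norm_of_nonneg
      (integral_nonneg fun x => by positivity), ofReal_integral_eq_lintegral_ofReal hpi
      (Filter.Eventually.of_forall fun x => by positivity)]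
    refine lintegral_congr fun x => ?_
    rw [← ofReal_norm, ENNReal.ofReal_rpow_of_nonneg (norm_nonneg _) hp0.le]
  have hq : ∀ x, ‖u x‖ₑ ^ q = ‖F x‖ₑ ^ p := by
    intro x
    rw [← ofReal_norm, hun, ← ofReal_norm, ENNReal.ofReal_rpow_of_nonneg (by positivity)
      hpq.symm.nonneg, ENNReal.ofReal_rpow_of_nonneg (norm_nonneg _) hp0.le,
      ← Real.rpow_mul (norm_nonneg _), hpq.sub_one_mul_conj]
  have hmain := h u hnu huc
  rw [hI] at hmain
  simp_rw [hq] at hmain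
  have hfin : ∫⁻ x, ‖F x‖ₑ ^ p ≠ ∞ := by
    rw [← hI]; exact enorm_ne_top
  set I := ∫⁻ x, ‖F x‖ₑ ^ p
  rcases eq_or_ne I 0 with h0 | h0
  · rw [h0]; exact zero_le
  have e : I = I ^ (1 / p) * I ^ (1 / q) := by
    rw [← ENNReal.rpow_add _ _ h0 hfin, one_div, one_div, hpq.inv_add_inv_eq_one, ENNReal.rpow_one]
  have hq0 : I ^ (1 / q) ≠ 0 := by
    simp [ENNReal.rpow_eq_zero_iff, h0, hfin]
  have hqt : I ^ (1 / q) ≠ ∞ := ENNReal.rpow_ne_top_of_nonneg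
    (by have := hpq.symm.nonneg; positivity) hfin
  have h1 : I ^ (1 / p) ≤ B := by
    rw [← ENNReal.mul_le_mul_iff_left hq0 hqt, ← e]
    exact hmain
  calc I = (I ^ (1 / p)) ^ p := by
        rw [← ENNReal.rpow_mul, one_div_mul_cancel hp0.ne', ENNReal.rpow_one]
    _ ≤ B ^ p := ENNReal.rpow_le_rpow h1 hp0.le

lemma enorm_parallelogram (a b : ℂ) :
    ‖a + b‖ₑ ^ 2 + ‖a - b‖ₑ ^ 2 = 2 * (‖a‖ₑ ^ 2 + ‖b‖ₑ ^ 2) := by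
  have h := parallelogram_law_with_norm ℝ a b
  simp_rw [← ofReal_norm]
  rw [← ENNReal.ofReal_pow (norm_nonneg _), ← ENNReal.ofReal_pow (norm_nonneg _),
    ← ENNReal.ofReal_pow (norm_nonneg _), ← ENNReal.ofReal_pow (norm_nonneg _),
    ← ENNReal.ofReal_add (by positivity) (by positivity),
    ← ENNReal.ofReal_add (by positivity) (by positivity),
    show (2 : ℝ≥0∞) = ENNReal.ofReal 2 by simp, ← ENNReal.ofReal_mul (by norm_num), h]

/-- Some choice of signs makes the signed sum dominate the square function in `L^{2r}`. -/
lemma exists_signs {r : ℝ} (hr : 1 ≤ r) {F : ℤ → ℝ → ℂ} (hF : ∀ k, Measurable (F k))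
    (Λ : Finset ℤ) : ∀ u : ℝ → ℂ, Measurable u → ∃ ε : ℤ → ℂ, (∀ k, ‖ε k‖ ≤ 1) ∧
      ∫⁻ x, (‖u x‖ₑ ^ 2 + ∑ k ∈ Λ, ‖F k x‖ₑ ^ 2) ^ r ≤
        ∫⁻ x, (‖u x + ∑ k ∈ Λ, ε k * F k x‖ₑ ^ 2) ^ r := by
  classical
  induction Λ using Finset.induction_on with
  | empty => exact fun u _ => ⟨0, by simp, by simp⟩
  | insert k Λ hk ih =>
    intro u hu
    have hFk := hF k
    have key : ∃ σ : ℂ, ‖σ‖ ≤ 1 ∧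
        ∫⁻ x, (‖u x‖ₑ ^ 2 + ∑ j ∈ insert k Λ, ‖F j x‖ₑ ^ 2) ^ r ≤
          ∫⁻ x, (‖u x + σ * F k x‖ₑ ^ 2 + ∑ j ∈ Λ, ‖F j x‖ₑ ^ 2) ^ r := by
      set J : ℂ → ℝ≥0∞ := fun σ =>
        ∫⁻ x, (‖u x + σ * F k x‖ₑ ^ 2 + ∑ j ∈ Λ, ‖F j x‖ₑ ^ 2) ^ r with hJ
      set I := ∫⁻ x, (‖u x‖ₑ ^ 2 + ∑ j ∈ insert k Λ, ‖F j x‖ₑ ^ 2) ^ r with hI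
      have hle : I ≤ 2⁻¹ * J 1 + 2⁻¹ * J (-1) := by
        rw [hI, hJ]
        simp only
        rw [← lintegral_const_mul _ (by fun_prop), ← lintegral_const_mul _ (by fun_prop),
          ← lintegral_add_left (by fun_prop)]
        refine lintegral_mono fun x => ?_
        have hc := ENNReal.rpow_arith_mean_le_arith_mean2_rpow 2⁻¹ 2⁻¹
          (‖u x + 1 * F k x‖ₑ ^ 2 + ∑ j ∈ Λ, ‖F j x‖ₑ ^ 2)
          (‖u x + (-1) * F k x‖ₑ ^ 2 + ∑ j ∈ Λ, ‖F j x‖ₑ ^ 2) (ENNReal.inv_two_add_inv_two) hr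
        refine le_trans (le_of_eq ?_) hc
        congr 1
        rw [Finset.sum_insert hk, ← mul_add, one_mul, neg_one_mul, ← sub_eq_add_neg,
          add_add_add_comm, enorm_parallelogram, ← two_mul, ← mul_add, ← mul_assoc,
          ENNReal.inv_mul_cancel (by norm_num) (by norm_num), one_mul, add_assoc]
      by_contra! hcon
      have h1 := hcon 1 (by simp)
      have h2 := hcon (-1) (by simp)
      have hlt : 2⁻¹ * J 1 + 2⁻¹ * J (-1) < 2⁻¹ * I + 2⁻¹ * I := by
        apply ENNReal.add_lt_add <;>
        · rw [ENNReal.mul_lt_mul_iff_right (by norm_num) (by norm_num)]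
          assumption
      rw [← add_mul, ENNReal.inv_two_add_inv_two, one_mul] at hlt
      exact absurd hle (not_le.2 hlt)
    obtain ⟨σ, hσ, hσI⟩ := key
    obtain ⟨ε, hε, hεI⟩ := ih (fun x => u x + σ * F k x) (by fun_prop)
    refine ⟨Function.update ε k σ, fun j => ?_, hσI.trans (hεI.trans (le_of_eq ?_))⟩
    · rcases eq_or_ne j k with rfl | hjk
      · simpa using hσ
      · simpa [hjk] using hε j
    · refine lintegral_congr fun x => ?_
      rw [Finset.sum_insert hk, Function.update_self, add_assoc]
      congr 5
      refine Finset.sum_congr rfl fun j hj => ?_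
      rw [Function.update_of_ne (by rintro rfl; exact hk hj)]

/-- The logarithmic growth factor `1 + log (1 + |a|)`. -/
noncomputable def lg (a : ℝ) : ℝ≥0∞ := ENNReal.ofReal (1 + Real.log (1 + |a|))

lemma one_le_lg (a : ℝ) : 1 ≤ lg a := by
  unfold lg
  rw [ENNReal.one_le_ofReal]
  linarith [Real.log_nonneg (by linarith [abs_nonneg a] : 1 ≤ 1 + |a|)]

lemma lg_ne_top (a : ℝ) : lg a ≠ ∞ := ENNReal.ofReal_ne_top

lemma lg_ne_zero (a : ℝ) : lg a ≠ 0 := (zero_lt_one.trans_le (one_le_lg a)).ne'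

lemma lg_neg (a : ℝ) : lg (-a) = lg a := by simp [lg]

lemma lg_sub_le (n u : ℝ) : lg (n - u) ≤ lg n * ENNReal.ofReal (1 + |u|) := by
  unfold lg
  have hn := abs_nonneg n
  have hu := abs_nonneg u
  have h1 := Real.log_nonneg (by linarith : 1 ≤ 1 + |n|)
  rw [← ENNReal.ofReal_mul (by linarith)]
  refine ENNReal.ofReal_le_ofReal ?_
  have h2 : Real.log (1 + |n - u|) ≤ Real.log ((1 + |n|) * (1 + |u|)) := by
    refine Real.log_le_log (by positivity) ?_
    nlinarith [abs_sub n u]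
  rw [Real.log_mul (by positivity) (by positivity)] at h2
  have h3 := Real.log_le_sub_one_of_pos (by linarith : 0 < 1 + |u|)
  nlinarith

lemma CZOp.mono {G : (ℝ → ℂ) → ℝ → ℝ≥0∞} {A B : ℝ≥0∞} (h : CZOp G A) (hAB : A ≤ B) :
    CZOp G B where
  meas := h.meas
  add := h.add
  l2 f hf := (h.l2 f hf).trans (by gcongr)
  bad Q hQ b hb h0 hm := (h.bad Q hQ b hb h0 hm).trans (by gcongr)

lemma conv_add {f g : ℝ → ℂ} (hf : Nice f) (hg : Nice g) (α : 𝓢(ℝ, ℂ)) (k : ℤ) (a x : ℝ) :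
    conv (f + g) (dilR α k a) x = conv f (dilR α k a) x + conv g (dilR α k a) x := by
  have h1 := hf.integrable_conv (nice_schwartz (dilS α k a)) x
  have h2 := hg.integrable_conv (nice_schwartz (dilS α k a)) x
  rw [coe_dilS] at h1 h2
  unfold conv
  rw [← integral_add h1 h2]
  simp [add_mul]

lemma czConst_ne_top (p : ℝ) : czConst p ≠ ∞ := by
  unfold czConst
  finiteness

/-- Signed sums of frequency pieces are Calderón–Zygmund operators. -/
lemma Band.exists_czOp {α : 𝓢(ℝ, ℂ)} {C : ℝ≥0} (hα : Band α C) :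
    ∃ D : ℝ≥0, D ≠ 0 ∧ ∀ (a : ℝ) (Λ : Finset ℤ) (ε : ℤ → ℂ), (∀ k, ‖ε k‖ ≤ 1) →
      CZOp (fun f x => ‖∑ k ∈ Λ, ε k * conv f (dilR α k a) x‖ₑ) (D * lg a) := by
  obtain ⟨c, hc⟩ := exists_prof α
  obtain ⟨D, hD⟩ := exists_bad_bound
  refine ⟨1 + 2 * C + c * (kapMoment.toNNReal * D), by positivity, fun a Λ ε hε => ?_⟩
  set E : ℝ≥0 := 1 + 2 * C + c * (kapMoment.toNNReal * D) with hE
  have hE1 : ((2 * C : ℝ≥0) : ℝ≥0∞) ≤ E * lg a := by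
    refine le_trans ?_ (le_mul_of_one_le_right zero_le (one_le_lg a))
    rw [ENNReal.coe_le_coe, hE, add_right_comm]
    exact le_add_self
  have hE2 : (c : ℝ≥0∞) * (kapMoment * D) ≤ E := by
    rw [← ENNReal.coe_toNNReal kapMoment_ne_top]
    norm_cast
    exact le_add_self
  refine ⟨fun f hf => ?_, fun f g hf hg x => ?_, fun f hf => ?_, fun Q hQ b hb hb0 hbm => ?_⟩
  · exact ((Nice.sum Λ fun k _ => (hf.conv_dilR α k a).const_mul (ε k)).meas).enorm
  · simp_rw [conv_add hf hg, mul_add, Finset.sum_add_distrib]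
    exact enorm_add_le _ _
  · exact (hα.lintegral_sum_sq_le hf Λ a hε).trans (by gcongr)
  · have hw := hb.meas.enorm
    calc ∫⁻ x in (tripleUnion Q)ᶜ, ‖∑ k ∈ Λ, ε k * conv b (dilR α k a) x‖ₑ
        ≤ ∫⁻ x in (tripleUnion Q)ᶜ,
            c * ∑ k ∈ Λ, lconv (cancelWeight Q k fun t => ‖b t‖ₑ) (kk k a) x := by
          refine lintegral_mono fun x => ?_
          rw [Finset.mul_sum]
          refine (enorm_sum_le _ _).trans (Finset.sum_le_sum fun k _ => ?_)
          refine le_trans ?_ (hc.enorm_conv_le k a hQ hb hb0 hbm x)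
          rw [enorm_mul]
          refine mul_le_of_le_one_left zero_le ?_
          rw [← ofReal_norm, ENNReal.ofReal_le_one]
          exact hε k
      _ = c * ∫⁻ x in (tripleUnion Q)ᶜ,
            ∑ k ∈ Λ, lconv (cancelWeight Q k fun t => ‖b t‖ₑ) (kk k a) x := by
          rw [lintegral_const_mul']
          exact ENNReal.coe_ne_top
      _ ≤ c * (kapMoment * (D * lg a) * ∫⁻ x, ‖b x‖ₑ) := by
          gcongr
          exact hD Q hQ Λ (fun k => kk k a) kapMoment (1 + |a|) (by linarith [abs_nonneg a])
            (fun k _ => mom_kk k a) _ hw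
      _ = c * (kapMoment * D) * lg a * ∫⁻ x, ‖b x‖ₑ := by ring
      _ ≤ _ := by gcongr

/-- An `L^p` bound, `p > 2`, by duality with a Calderón–Zygmund operator. -/
lemma CZOp.lintegral_rpow_le_of_adjoint {T : (ℝ → ℂ) → ℝ → ℂ} {A : ℝ≥0∞}
    (hT : CZOp (fun u x => ‖T u x‖ₑ) A) (hA0 : A ≠ 0) (hA : A ≠ ∞) {p q : ℝ}
    (hp : 2 < p) (hpq : p.HolderConjugate q) {F f : ℝ → ℂ} (hF : Nice F) (hc : Continuous F)
    (hf : Nice f)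
    (hadj : ∀ u, Nice u → Continuous u → ∫ x, F x * u x = ∫ x, f x * T u x) :
    ∫⁻ x, ‖F x‖ₑ ^ p ≤ (2 * A * czConst q ^ (1 / q)) ^ p * ∫⁻ x, ‖f x‖ₑ ^ p := by
  have hp0 : 0 < p := by linarith
  have hq0 := hpq.symm.pos
  have hq1 := hpq.symm.lt
  have hq2 : q < 2 := by
    have := hpq.sub_one_mul_conj
    nlinarith
  have h := lintegral_rpow_le_of_pairing hF hc hp.le hpq
    (B := (∫⁻ x, ‖f x‖ₑ ^ p) ^ (1 / p) * (2 * A * czConst q ^ (1 / q))) fun u hu huc => by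
      rw [hadj u hu huc]
      refine (enorm_integral_le_lintegral_enorm _).trans ?_
      simp_rw [enorm_mul]
      refine (ENNReal.lintegral_mul_le_Lp_mul_Lq volume hpq hf.meas.enorm.aemeasurable
        (hT.meas u hu).aemeasurable).trans ?_
      rw [mul_assoc]
      gcongr
      calc (∫⁻ x, ‖T u x‖ₑ ^ q) ^ (1 / q)
          ≤ ((2 * A) ^ q * (czConst q * ∫⁻ x, ‖u x‖ₑ ^ q)) ^ (1 / q) := by
            gcongr
            exact hT.lintegral_rpow_le hA0 hA hq1 hq2 hu huc
        _ = _ := by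
            rw [ENNReal.mul_rpow_of_nonneg ((2 * A) ^ q) _ (by positivity),
              ENNReal.mul_rpow_of_nonneg (czConst q) _ (by positivity), ← ENNReal.rpow_mul,
              mul_one_div_cancel hq0.ne', ENNReal.rpow_one, ← mul_assoc]
  refine h.trans (le_of_eq ?_)
  rw [ENNReal.mul_rpow_of_nonneg _ _ hp0.le, ← ENNReal.rpow_mul, one_div_mul_cancel hp0.ne',
    ENNReal.rpow_one, mul_comm]

lemma integral_sum_conv_mul {f u : ℝ → ℂ} (hf : Nice f) (hu : Nice u) (α : 𝓢(ℝ, ℂ))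
    (Λ : Finset ℤ) (a : ℝ) (ε : ℤ → ℂ) :
    ∫ x, (∑ k ∈ Λ, ε k * conv f (dilR α k a) x) * u x =
      ∫ x, f x * ∑ k ∈ Λ, ε k * conv u (dilR (reflS α) k (-a)) x := by
  simp_rw [Finset.sum_mul, Finset.mul_sum]
  rw [integral_finsetSum _ fun k _ => (((hf.conv_dilR α k a).const_mul (ε k)).mul hu).int,
    integral_finsetSum _ fun k _ =>
      (hf.mul ((hu.conv_dilR (reflS α) k (-a)).const_mul (ε k))).int]
  refine Finset.sum_congr rfl fun k _ => ?_
  simp_rw [mul_assoc, mul_left_comm _ (ε k)]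
  rw [integral_const_mul, integral_const_mul, integral_conv_mul hf hu]

lemma Band.lintegral_square_le {α : 𝓢(ℝ, ℂ)} {C : ℝ≥0} (hα : Band α C) {f : ℝ → ℂ}
    (hf : Nice f) (Λ : Finset ℤ) (a : ℝ) :
    ∫⁻ x, ∑ k ∈ Λ, ‖conv f (dilR α k a) x‖ₑ ^ 2 ≤
      ((2 * C : ℝ≥0) : ℝ≥0∞) ^ 2 * ∫⁻ x, ‖f x‖ₑ ^ 2 := by
  obtain ⟨ε, hε, h⟩ := exists_signs (le_refl (1 : ℝ))
    (fun k => (hf.conv_dilR α k a).meas) Λ (fun _ => 0) measurable_const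
  simp only [enorm_zero, ne_eq, OfNat.ofNat_ne_zero, not_false_eq_true, zero_pow, zero_add,
    ENNReal.rpow_one] at h
  exact h.trans (hα.lintegral_sum_sq_le hf Λ a hε)

/-- The shifted square function is bounded on `L^p`, `p > 2`, with a logarithmic constant. -/
lemma Band.exists_square_rpow_le {α : 𝓢(ℝ, ℂ)} {C : ℝ≥0} (hα : Band α C) {p : ℝ} (hp : 2 < p) :
    ∃ D : ℝ≥0, ∀ (a : ℝ) (Λ : Finset ℤ) (f : ℝ → ℂ), Nice f →
      ∫⁻ x, (∑ k ∈ Λ, ‖conv f (dilR α k a) x‖ₑ ^ 2) ^ (p / 2) ≤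
        (D * lg a) ^ p * ∫⁻ x, ‖f x‖ₑ ^ p := by
  obtain ⟨D, hD0, hD⟩ := hα.refl.exists_czOp
  have hpq := Real.HolderConjugate.conjExponent (by linarith : 1 < p)
  set q := p.conjExponent
  have hq1 := hpq.symm.lt
  have hcz : czConst q ^ (1 / q) ≠ ∞ :=
    ENNReal.rpow_ne_top_of_nonneg (by positivity) (czConst_ne_top q)
  refine ⟨2 * D * (czConst q ^ (1 / q)).toNNReal, fun a Λ f hf => ?_⟩
  obtain ⟨ε, hε, h⟩ := exists_signs (by linarith : 1 ≤ p / 2)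
    (fun k => (hf.conv_dilR α k a).meas) Λ (fun _ => 0) measurable_const
  simp only [enorm_zero, ne_eq, OfNat.ofNat_ne_zero, not_false_eq_true, zero_pow, zero_add] at h
  have hF : Nice fun x => ∑ k ∈ Λ, ε k * conv f (dilR α k a) x :=
    Nice.sum Λ fun k _ => (hf.conv_dilR α k a).const_mul (ε k)
  have hFc : Continuous fun x => ∑ k ∈ Λ, ε k * conv f (dilR α k a) x :=
    continuous_finsetSum _ fun k _ => continuous_const.mul (hf.continuous_conv_dilR α k a)
  refine h.trans ?_
  have h2 := (hD (-a) Λ ε hε).lintegral_rpow_le_of_adjoint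
    (mul_ne_zero (by simpa using hD0) (lg_ne_zero _))
    (ENNReal.mul_ne_top ENNReal.coe_ne_top (lg_ne_top _)) hp hpq hF hFc hf
    fun u hu _ => integral_sum_conv_mul hf hu α Λ a ε
  have e : ∀ z : ℝ≥0∞, (z ^ 2) ^ (p / 2) = z ^ p := fun z => by
    rw [← ENNReal.rpow_natCast, ← ENNReal.rpow_mul]
    congr 1
    push_cast; ring
  simp_rw [e]
  refine h2.trans (le_of_eq ?_)
  push_cast
  rw [ENNReal.coe_toNNReal hcz, lg_neg]
  congr 2
  ring

/-- The finite measure `|φ(u)| du`. -/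
noncomputable def absMeasure (φ : 𝓢(ℝ, ℂ)) : Measure ℝ := volume.withDensity fun u => ‖φ u‖ₑ

instance (φ : 𝓢(ℝ, ℂ)) : SFinite (absMeasure φ) := by
  unfold absMeasure; infer_instance

lemma lintegral_absMeasure (φ : 𝓢(ℝ, ℂ)) {g : ℝ → ℝ≥0∞} (hg : Measurable g) :
    ∫⁻ u, g u ∂(absMeasure φ) = ∫⁻ u, ‖φ u‖ₑ * g u := by
  have h := φ.continuous.measurable
  unfold absMeasure
  rw [lintegral_withDensity_eq_lintegral_mul _ (by fun_prop) hg]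
  rfl

lemma lintegral_moment_ne_top (φ : 𝓢(ℝ, ℂ)) (m : ℕ) :
    ∫⁻ u, ENNReal.ofReal ((1 + |u|) ^ m) ∂(absMeasure φ) ≠ ∞ := by
  rw [lintegral_absMeasure φ (by fun_prop)]
  have h : Integrable fun u : ℝ => 2 ^ (m - 1) * (‖φ u‖ + |u| ^ m * ‖φ u‖) := by
    refine (Integrable.add (φ.integrable (μ := volume)).norm ?_).const_mul _
    exact φ.integrable_pow_mul volume m
  refine ((lintegral_mono fun u => ?_).trans_lt h.lintegral_lt_top).ne
  rw [← ofReal_norm, ← ENNReal.ofReal_mul (norm_nonneg _)]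
  refine ENNReal.ofReal_le_ofReal ?_
  have := add_pow_le zero_le_one (abs_nonneg u) m
  rw [one_pow] at this
  nlinarith [norm_nonneg (φ u)]

/-- The moment `∫ (1 + |u|)^m |φ(u)| du`. -/
noncomputable def absMoment (φ : 𝓢(ℝ, ℂ)) (m : ℕ) : ℝ≥0 :=
  (∫⁻ u, ENNReal.ofReal ((1 + |u|) ^ m) ∂(absMeasure φ)).toNNReal

lemma coe_absMoment (φ : 𝓢(ℝ, ℂ)) (m : ℕ) :
    (absMoment φ m : ℝ≥0∞) = ∫⁻ u, ENNReal.ofReal ((1 + |u|) ^ m) ∂(absMeasure φ) :=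
  ENNReal.coe_toNNReal (lintegral_moment_ne_top φ m)

lemma absMeasure_univ (φ : 𝓢(ℝ, ℂ)) : absMeasure φ Set.univ = absMoment φ 0 := by
  rw [coe_absMoment]; simp

lemma conv_dilR_sub (f α : ℝ → ℂ) (k : ℤ) (a u x : ℝ) :
    conv f (dilR α k (a - u)) x = conv f (dilR α k a) (x - 2 ^ (-k) * u) := by
  unfold conv
  refine integral_congr_ae (Filter.Eventually.of_forall fun t => ?_)
  simp only [dilR]
  congr 3
  have := (two_zpow_pos k).ne'
  rw [zpow_neg]
  field_simp
  ring

/-- The square of the shifted square function. -/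
noncomputable def sqSum (α : 𝓢(ℝ, ℂ)) (Λ : Finset ℤ) (f : ℝ → ℂ) (a x : ℝ) : ℝ≥0∞ :=
  ∑ k ∈ Λ, ‖conv f (dilR α k a) x‖ₑ ^ 2

lemma Nice.measurable_sqSum {f : ℝ → ℂ} (hf : Nice f) (α : 𝓢(ℝ, ℂ)) (Λ : Finset ℤ) (n : ℝ) :
    Measurable fun z : ℝ × ℝ => sqSum α Λ f (n - z.2) z.1 := by
  unfold sqSum
  refine Finset.measurable_fun_sum _ fun k _ => ?_
  simp_rw [conv_dilR_sub]
  have := (hf.conv_dilR α k n).meas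
  fun_prop

lemma Nice.measurable_sqSum_left {f : ℝ → ℂ} (hf : Nice f) (α : 𝓢(ℝ, ℂ)) (Λ : Finset ℤ)
    (n x : ℝ) : Measurable fun u => sqSum α Λ f (n - u) x := by
  unfold sqSum
  refine Finset.measurable_fun_sum _ fun k _ => ?_
  simp_rw [conv_dilR_sub]
  have := (hf.conv_dilR α k n).meas
  fun_prop

/-- The square function averaged over the shifts. -/
noncomputable def avgSq (φ α : 𝓢(ℝ, ℂ)) (n : ℝ) (Λ : Finset ℤ) (f : ℝ → ℂ) (x : ℝ) : ℝ≥0∞ :=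
  (∫⁻ u, sqSum α Λ f (n - u) x ∂(absMeasure φ)) ^ (1 / 2 : ℝ)

lemma ENNReal.rpow_half_sq (z : ℝ≥0∞) : (z ^ (1 / 2 : ℝ)) ^ 2 = z := by
  rw [← ENNReal.rpow_natCast, ← ENNReal.rpow_mul]; norm_num

lemma ENNReal.sq_rpow_half (z : ℝ≥0∞) : (z ^ 2) ^ (1 / 2 : ℝ) = z := by
  rw [← ENNReal.rpow_natCast, ← ENNReal.rpow_mul]; norm_num

lemma Nice.measurable_avgSq {f : ℝ → ℂ} (hf : Nice f) (φ α : 𝓢(ℝ, ℂ)) (n : ℝ) (Λ : Finset ℤ) :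
    Measurable (avgSq φ α n Λ f) :=
  (Measurable.lintegral_prod_right' (hf.measurable_sqSum α Λ n)).pow_const _

lemma avgSq_add_le {f g : ℝ → ℂ} (hf : Nice f) (hg : Nice g) (φ α : 𝓢(ℝ, ℂ)) (n : ℝ)
    (Λ : Finset ℤ) (x : ℝ) :
    avgSq φ α n Λ (f + g) x ≤ avgSq φ α n Λ f x + avgSq φ α n Λ g x := by
  have hm : ∀ h : ℝ → ℂ, Nice h → Measurable fun u => sqSum α Λ h (n - u) x := fun h hh =>
    hh.measurable_sqSum_left α Λ n x
  have key := ENNReal.lintegral_Lp_add_le (μ := absMeasure φ) (p := 2)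
    (f := fun u => sqSum α Λ f (n - u) x ^ (1 / 2 : ℝ))
    (g := fun u => sqSum α Λ g (n - u) x ^ (1 / 2 : ℝ))
    ((hm f hf).pow_const _).aemeasurable ((hm g hg).pow_const _).aemeasurable (by norm_num)
  simp only [Pi.add_apply, ENNReal.rpow_ofNat, ENNReal.rpow_half_sq] at key
  refine le_trans ?_ key
  unfold avgSq
  gcongr with u
  have h2 := ENNReal.Lp_add_le Λ (fun k => ‖conv f (dilR α k (n - u)) x‖ₑ)
    (fun k => ‖conv g (dilR α k (n - u)) x‖ₑ) (p := 2) (by norm_num)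
  simp only [ENNReal.rpow_ofNat] at h2
  rw [← ENNReal.rpow_half_sq (sqSum α Λ (f + g) (n - u) x)]
  gcongr
  refine le_trans ?_ h2
  unfold sqSum
  gcongr with k _
  rw [conv_add hf hg]
  exact enorm_add_le _ _

lemma lintegral_avgSq_sq_le {α : 𝓢(ℝ, ℂ)} {C : ℝ≥0} (hα : Band α C) (φ : 𝓢(ℝ, ℂ)) {f : ℝ → ℂ}
    (hf : Nice f) (n : ℝ) (Λ : Finset ℤ) :
    ∫⁻ x, avgSq φ α n Λ f x ^ 2 ≤
      absMoment φ 0 * (((2 * C : ℝ≥0) : ℝ≥0∞) ^ 2 * ∫⁻ x, ‖f x‖ₑ ^ 2) := by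
  unfold avgSq
  simp_rw [ENNReal.rpow_half_sq]
  rw [lintegral_lintegral_swap (hf.measurable_sqSum α Λ n).aemeasurable]
  calc ∫⁻ u, (∫⁻ x, sqSum α Λ f (n - u) x) ∂(absMeasure φ)
      ≤ ∫⁻ u, (((2 * C : ℝ≥0) : ℝ≥0∞) ^ 2 * ∫⁻ x, ‖f x‖ₑ ^ 2) ∂(absMeasure φ) :=
        lintegral_mono fun u => hα.lintegral_square_le hf Λ (n - u)
    _ = _ := by rw [lintegral_const, absMeasure_univ, mul_comm]

lemma sum_sq_le_sq_sum (Λ : Finset ℤ) (b : ℤ → ℝ≥0∞) :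
    ∑ k ∈ Λ, b k ^ 2 ≤ (∑ k ∈ Λ, b k) ^ 2 := by
  rw [sq (∑ k ∈ Λ, b k), Finset.sum_mul]
  refine Finset.sum_le_sum fun k hk => ?_
  rw [sq]
  gcongr
  exact Finset.single_le_sum (f := b) (fun _ _ => zero_le) hk

/-- The averaged square function is a Calderón–Zygmund operator. -/
lemma Band.exists_czOp_avgSq {α : 𝓢(ℝ, ℂ)} {C : ℝ≥0} (hα : Band α C) (φ : 𝓢(ℝ, ℂ)) :
    ∃ D : ℝ≥0, D ≠ 0 ∧ ∀ (n : ℝ) (Λ : Finset ℤ), CZOp (avgSq φ α n Λ) (D * lg n) := by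
  obtain ⟨c, hc⟩ := exists_prof α
  obtain ⟨D, hD⟩ := exists_bad_bound
  set m : ℝ≥0∞ := ((absMoment φ 6 : ℝ≥0∞)) ^ (1 / 2 : ℝ) with hm
  have hmt : m ≠ ∞ := ENNReal.rpow_ne_top_of_nonneg (by norm_num) ENNReal.coe_ne_top
  set E : ℝ≥0 := (1 + absMoment φ 0) * (1 + 2 * C) + c * m.toNNReal * (kapMoment.toNNReal * D)
    with hE
  have hE1 : (absMoment φ 0 : ℝ≥0∞) * ((2 * C : ℝ≥0) : ℝ≥0∞) ^ 2 ≤ (E : ℝ≥0∞) ^ 2 := by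
    norm_cast
    calc absMoment φ 0 * (2 * C) ^ 2 ≤ (1 + absMoment φ 0) ^ 2 * (1 + 2 * C) ^ 2 := by
          gcongr
          · nlinarith [(absMoment φ 0).2]
          · exact le_add_self
      _ = ((1 + absMoment φ 0) * (1 + 2 * C)) ^ 2 := by ring
      _ ≤ E ^ 2 := by gcongr; exact le_self_add
  have hE2 : (c : ℝ≥0∞) * m * (kapMoment * D) ≤ E := by
    rw [← ENNReal.coe_toNNReal kapMoment_ne_top, ← ENNReal.coe_toNNReal hmt]
    norm_cast
    exact le_add_self
  refine ⟨E, by positivity, fun n Λ => ⟨fun f hf => hf.measurable_avgSq φ α n Λ,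
    fun f g hf hg x => avgSq_add_le hf hg φ α n Λ x, fun f hf => ?_,
    fun Q hQ b hb hb0 hbm => ?_⟩⟩
  · refine (lintegral_avgSq_sq_le hα φ hf n Λ).trans ?_
    rw [← mul_assoc]
    gcongr
    refine hE1.trans ?_
    gcongr
    exact le_mul_of_one_le_right zero_le (one_le_lg n)
  · have hw := hb.meas.enorm
    set Y : ℝ → ℝ≥0∞ := fun x =>
      ∑ k ∈ Λ, lconv (cancelWeight Q k fun t => ‖b t‖ₑ) (kk k n) x with hY
    have hpt : ∀ x, avgSq φ α n Λ b x ≤ c * m * Y x := by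
      intro x
      rw [← ENNReal.sq_rpow_half (c * m * Y x)]
      unfold avgSq
      gcongr
      calc ∫⁻ u, sqSum α Λ b (n - u) x ∂(absMeasure φ)
          ≤ ∫⁻ u, ENNReal.ofReal ((1 + |u|) ^ 6) * (c * Y x) ^ 2 ∂(absMeasure φ) := by
            refine lintegral_mono fun u => ?_
            refine (sum_sq_le_sq_sum Λ _).trans ?_
            rw [show (1 + |u|) ^ 6 = ((1 + |u|) ^ 3) ^ 2 by ring,
              ENNReal.ofReal_pow (by positivity), ← mul_pow]
            gcongr
            rw [hY, Finset.mul_sum, Finset.mul_sum]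
            refine Finset.sum_le_sum fun k _ => ?_
            refine (hc.enorm_conv_le k (n - u) hQ hb hb0 hbm x).trans ?_
            rw [mul_left_comm]
            gcongr
            unfold lconv
            rw [← lintegral_const_mul' _ _ ENNReal.ofReal_ne_top]
            refine lintegral_mono fun y => ?_
            rw [mul_left_comm]
            gcongr
            have := kk_add_le k n (-u) (x - y)
            rwa [abs_neg, ← sub_eq_add_neg] at this
        _ = absMoment φ 6 * (c * Y x) ^ 2 := by
            rw [lintegral_mul_const _ (by fun_prop), coe_absMoment]
        _ = (c * m * Y x) ^ 2 := by
            rw [mul_pow, mul_pow, mul_pow, hm, ENNReal.rpow_half_sq]; ring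
    calc ∫⁻ x in (tripleUnion Q)ᶜ, avgSq φ α n Λ b x
        ≤ ∫⁻ x in (tripleUnion Q)ᶜ, c * m * Y x := lintegral_mono fun x => hpt x
      _ = c * m * ∫⁻ x in (tripleUnion Q)ᶜ, Y x := by
          rw [lintegral_const_mul']
          exact ENNReal.mul_ne_top ENNReal.coe_ne_top hmt
      _ ≤ c * m * (kapMoment * (D * lg n) * ∫⁻ x, ‖b x‖ₑ) := by
          gcongr
          exact hD Q hQ Λ (fun k => kk k n) kapMoment (1 + |n|) (by linarith [abs_nonneg n])
            (fun k _ => mom_kk k n) _ hw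
      _ = c * m * (kapMoment * D) * lg n * ∫⁻ x, ‖b x‖ₑ := by ring
      _ ≤ _ := by gcongr

lemma lintegral_avgSq_rpow_le_of_two_lt {α : 𝓢(ℝ, ℂ)} {C : ℝ≥0} (hα : Band α C)
    (φ : 𝓢(ℝ, ℂ)) {p : ℝ} (hp : 2 < p) :
    ∃ D : ℝ≥0, ∀ (n : ℝ) (Λ : Finset ℤ) (f : ℝ → ℂ), Nice f →
      ∫⁻ x, avgSq φ α n Λ f x ^ p ≤ (D * lg n) ^ p * ∫⁻ x, ‖f x‖ₑ ^ p := by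
  obtain ⟨D, hD⟩ := hα.exists_square_rpow_le hp
  have hp0 : 0 < p := by linarith
  have hr : 1 < p / 2 := by linarith
  have hrr := Real.HolderConjugate.conjExponent hr
  set r := p / 2 with hrdef
  set r' := r.conjExponent
  set V : ℝ≥0∞ := (absMoment φ 0 : ℝ≥0∞) ^ (1 / r') with hV
  have hr'0 := hrr.symm.pos
  have hVt : V ≠ ∞ := ENNReal.rpow_ne_top_of_nonneg (by positivity) ENNReal.coe_ne_top
  set m : ℕ := ⌈p⌉₊
  set B : ℝ≥0∞ := (V ^ r * absMoment φ m) ^ (1 / p) with hB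
  have hBt : B ≠ ∞ := ENNReal.rpow_ne_top_of_nonneg (by positivity)
    (ENNReal.mul_ne_top (ENNReal.rpow_ne_top_of_nonneg (by linarith) hVt) ENNReal.coe_ne_top)
  have hBp : B ^ p = V ^ r * absMoment φ m := by
    rw [hB, ← ENNReal.rpow_mul, one_div_mul_cancel hp0.ne', ENNReal.rpow_one]
  refine ⟨B.toNNReal * D, fun n Λ f hf => ?_⟩
  have hmeas := hf.measurable_sqSum α Λ n
  have hjen : ∀ x, avgSq φ α n Λ f x ^ p ≤
      V ^ r * ∫⁻ u, sqSum α Λ f (n - u) x ^ r ∂(absMeasure φ) := by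
    intro x
    have h := ENNReal.lintegral_mul_le_Lp_mul_Lq (absMeasure φ) hrr
      (f := fun u => sqSum α Λ f (n - u) x) (g := fun _ => 1)
      (hf.measurable_sqSum_left α Λ n x).aemeasurable aemeasurable_const
    simp only [Pi.mul_apply, mul_one, ENNReal.one_rpow, lintegral_one, absMeasure_univ] at h
    unfold avgSq
    rw [← ENNReal.rpow_mul, show 1 / 2 * p = r by rw [hrdef]; ring]
    refine (ENNReal.rpow_le_rpow h (by linarith)).trans (le_of_eq ?_)
    rw [ENNReal.mul_rpow_of_nonneg _ _ (by linarith), ← ENNReal.rpow_mul,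
      one_div_mul_cancel (by linarith), ENNReal.rpow_one, mul_comm]
  calc ∫⁻ x, avgSq φ α n Λ f x ^ p
      ≤ ∫⁻ x, V ^ r * ∫⁻ u, sqSum α Λ f (n - u) x ^ r ∂(absMeasure φ) := lintegral_mono hjen
    _ = V ^ r * ∫⁻ u, (∫⁻ x, sqSum α Λ f (n - u) x ^ r) ∂(absMeasure φ) := by
        rw [lintegral_const_mul' _ _ (ENNReal.rpow_ne_top_of_nonneg (by linarith) hVt),
          lintegral_lintegral_swap (hmeas.pow_const r).aemeasurable]
    _ ≤ V ^ r * ∫⁻ u, (ENNReal.ofReal ((1 + |u|) ^ m) * ((D * lg n) ^ p * ∫⁻ x, ‖f x‖ₑ ^ p))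
          ∂(absMeasure φ) := by
        gcongr with u
        refine (hD (n - u) Λ f hf).trans ?_
        rw [← mul_assoc]
        gcongr
        calc (D * lg (n - u)) ^ p ≤ (ENNReal.ofReal (1 + |u|) * (D * lg n)) ^ p := by
              refine ENNReal.rpow_le_rpow ?_ hp0.le
              rw [mul_left_comm, mul_comm (ENNReal.ofReal _)]
              gcongr
              exact lg_sub_le n u
          _ = ENNReal.ofReal (1 + |u|) ^ p * (D * lg n) ^ p :=
              ENNReal.mul_rpow_of_nonneg _ _ hp0.le
          _ ≤ _ := by
              gcongr
              rw [ENNReal.ofReal_pow (by positivity), ← ENNReal.rpow_natCast]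
              refine ENNReal.rpow_le_rpow_of_exponent_le ?_ (Nat.le_ceil p)
              rw [ENNReal.one_le_ofReal]
              linarith [abs_nonneg u]
    _ = B ^ p * (D * lg n) ^ p * ∫⁻ x, ‖f x‖ₑ ^ p := by
        rw [lintegral_mul_const _ (by fun_prop), ← coe_absMoment, hBp]; ring
    _ = _ := by
        rw [← ENNReal.mul_rpow_of_nonneg _ _ hp0.le]
        push_cast
        rw [ENNReal.coe_toNNReal hBt, mul_assoc]

/-- The averaged square function is bounded on `L^p`, `1 < p < ∞`. -/
lemma Band.exists_avgSq_rpow_le {α : 𝓢(ℝ, ℂ)} {C : ℝ≥0} (hα : Band α C)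
    (φ : 𝓢(ℝ, ℂ)) {p : ℝ} (hp : 1 < p) :
    ∃ D : ℝ≥0, ∀ (n : ℝ) (Λ : Finset ℤ) (f : ℝ → ℂ), Nice f → Continuous f →
      ∫⁻ x, avgSq φ α n Λ f x ^ p ≤ (D * lg n) ^ p * ∫⁻ x, ‖f x‖ₑ ^ p := by
  rcases lt_trichotomy p 2 with h | rfl | h
  · obtain ⟨D, hD0, hD⟩ := hα.exists_czOp_avgSq φ
    have hp0 : 0 < p := by linarith
    have hcz : czConst p ^ (1 / p) ≠ ∞ :=
      ENNReal.rpow_ne_top_of_nonneg (by positivity) (czConst_ne_top p)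
    refine ⟨2 * D * (czConst p ^ (1 / p)).toNNReal, fun n Λ f hf hc => ?_⟩
    refine ((hD n Λ).lintegral_rpow_le (mul_ne_zero (by simpa using hD0) (lg_ne_zero _))
      (ENNReal.mul_ne_top ENNReal.coe_ne_top (lg_ne_top _)) hp h hf hc).trans (le_of_eq ?_)
    rw [← mul_assoc]
    congr 1
    push_cast
    rw [ENNReal.coe_toNNReal hcz, show 2 * (D : ℝ≥0∞) * czConst p ^ (1 / p) * lg n =
      2 * (D * lg n) * czConst p ^ (1 / p) by ring,
      ENNReal.mul_rpow_of_nonneg (2 * (D * lg n)) _ hp0.le, ← ENNReal.rpow_mul,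
      one_div_mul_cancel hp0.ne', ENNReal.rpow_one]
  · obtain ⟨D, hD0, hD⟩ := hα.exists_czOp_avgSq φ
    refine ⟨D, fun n Λ f hf _ => ?_⟩
    simpa using (hD n Λ).l2 f hf
  · obtain ⟨D, hD⟩ := lintegral_avgSq_rpow_le_of_two_lt hα φ h
    exact ⟨D, fun n Λ f hf _ => hD n Λ f hf⟩

lemma paraShift_eq (φ : 𝓢(ℝ, ℂ)) (n : ℤ) (Λ : Finset ℤ) (f g : ℝ → ℂ) (x : ℝ) :
    paraShift φ n Λ f g x = ∑ k ∈ Λ,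
      conv (fun y => conv f (dilR (psiS φ) k n) y * conv g (dilR (psiS φ) k n) y)
        (dilR φ k 0) x := by
  simp only [paraShift, dil_eq_dilR, dilShift_eq_dilR, coe_psiS]

lemma lintegral_enorm_conv_dil (F : ℝ → ℝ≥0∞) (φ : 𝓢(ℝ, ℂ)) (k : ℤ) (x : ℝ) :
    ∫⁻ t, F t * ‖dilR φ k 0 (x - t)‖ₑ = ∫⁻ u, ‖φ u‖ₑ * F (x - 2 ^ (-k) * u) := by
  have h2 := two_zpow_pos k
  rw [← lintegral_sub_left_eq_self (fun t => F t * ‖dilR φ k 0 (x - t)‖ₑ) x,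
    ← lintegral_dilate (fun u => ‖φ u‖ₑ * F (x - 2 ^ (-k) * u)) k 0]
  refine lintegral_congr fun t => ?_
  have e : (2 : ℝ) ^ (-k) * (2 ^ k * t + 0) = t := by
    rw [zpow_neg, add_zero, inv_mul_cancel_left₀ h2.ne']
  rw [e, _root_.sub_sub_cancel, dilR, enorm_mul, ← ofReal_norm, norm_zpow, Complex.norm_ofNat]
  ring

lemma enorm_paraShift_le {f g : ℝ → ℂ} (hf : Nice f) (hg : Nice g) (φ : 𝓢(ℝ, ℂ)) (n : ℤ)
    (Λ : Finset ℤ) (x : ℝ) :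
    ‖paraShift φ n Λ f g x‖ₑ ≤ avgSq φ (psiS φ) n Λ f x * avgSq φ (psiS φ) n Λ g x := by
  set α := psiS φ
  rw [paraShift_eq]
  set a : ℤ → ℝ → ℝ≥0∞ := fun k u => ‖conv f (dilR α k (n - u)) x‖ₑ with ha
  set b : ℤ → ℝ → ℝ≥0∞ := fun k u => ‖conv g (dilR α k (n - u)) x‖ₑ with hb
  have ham : ∀ k, Measurable (a k) := fun k => by
    simp only [ha, conv_dilR_sub]
    have := (hf.conv_dilR α k n).meas
    fun_prop
  have hbm : ∀ k, Measurable (b k) := fun k => by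
    simp only [hb, conv_dilR_sub]
    have := (hg.conv_dilR α k n).meas
    fun_prop
  have hab : ∀ k, Measurable fun u => a k u * b k u := fun k => (ham k).mul (hbm k)
  have h1 : ∀ k ∈ Λ, ‖conv (fun y => conv f (dilR α k n) y * conv g (dilR α k n) y)
      (dilR φ k 0) x‖ₑ ≤ ∫⁻ u, a k u * b k u ∂(absMeasure φ) := by
    intro k _
    refine (enorm_conv_le _ _ x).trans (le_of_eq ?_)
    unfold lconv
    rw [lintegral_enorm_conv_dil (fun y => ‖conv f (dilR α k n) y * conv g (dilR α k n) y‖ₑ),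
      lintegral_absMeasure φ (hab k)]
    refine lintegral_congr fun u => ?_
    rw [ha, hb, enorm_mul]
    simp only [conv_dilR_sub]
  refine (enorm_sum_le _ _).trans ((Finset.sum_le_sum h1).trans ?_)
  rw [← lintegral_finsetSum _ fun k _ => hab k]
  have h2 := ENNReal.lintegral_mul_le_Lp_mul_Lq (absMeasure φ) (p := 2) (q := 2)
    ⟨by norm_num, by norm_num, by norm_num⟩
    (f := fun u => sqSum α Λ f (n - u) x ^ (1 / 2 : ℝ))
    (g := fun u => sqSum α Λ g (n - u) x ^ (1 / 2 : ℝ))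
    ((hf.measurable_sqSum_left α Λ n x).pow_const _).aemeasurable
    ((hg.measurable_sqSum_left α Λ n x).pow_const _).aemeasurable
  simp only [ENNReal.rpow_ofNat, ENNReal.rpow_half_sq] at h2
  refine le_trans (lintegral_mono fun u => ?_) h2
  have h3 := ENNReal.inner_le_Lp_mul_Lq Λ (fun k => a k u) (fun k => b k u) (p := 2) (q := 2)
    ⟨by norm_num, by norm_num, by norm_num⟩
  simp only [ENNReal.rpow_ofNat] at h3
  exact h3

/-- The paraproduct bound for finite exponents. -/
lemma exists_lintegral_paraShift_rpow_le {φ : 𝓢(ℝ, ℂ)} {C : ℝ≥0} (hα : Band (psiS φ) C)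
    {p q s : ℝ} (hp : 1 < p) (hq : 1 < q) (hs : 0 < s) (hpq : 1 / s = 1 / p + 1 / q) :
    ∃ D : ℝ≥0, ∀ (n : ℤ) (Λ : Finset ℤ) (f g : 𝓢(ℝ, ℂ)),
      (∫⁻ x, ‖paraShift φ n Λ f g x‖ₑ ^ s) ^ (1 / s) ≤
        D * lg n ^ 2 * (∫⁻ x, ‖f x‖ₑ ^ p) ^ (1 / p) * (∫⁻ x, ‖g x‖ₑ ^ q) ^ (1 / q) := by
  obtain ⟨D₁, h₁⟩ := hα.exists_avgSq_rpow_le φ hp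
  obtain ⟨D₂, h₂⟩ := hα.exists_avgSq_rpow_le φ hq
  refine ⟨D₁ * D₂, fun n Λ f g => ?_⟩
  have hf := nice_schwartz f
  have hg := nice_schwartz g
  have hp0 : 0 < p := by linarith
  have hq0 : 0 < q := by linarith
  have hsp : s < p := by
    have : 0 < 1 / q := by positivity
    have : 1 / p < 1 / s := by linarith
    exact (one_div_lt_one_div hp0 hs).1 this
  have key : ∀ {r : ℝ} {D : ℝ≥0} {h : 𝓢(ℝ, ℂ)}, 0 < r →
      ∫⁻ x, avgSq φ (psiS φ) n Λ h x ^ r ≤ (D * lg n) ^ r * ∫⁻ x, ‖h x‖ₑ ^ r →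
      (∫⁻ x, avgSq φ (psiS φ) n Λ h x ^ r) ^ (1 / r) ≤
        D * lg n * (∫⁻ x, ‖h x‖ₑ ^ r) ^ (1 / r) := by
    intro r D h hr hle
    refine (ENNReal.rpow_le_rpow hle (by positivity)).trans (le_of_eq ?_)
    rw [ENNReal.mul_rpow_of_nonneg _ _ (by positivity), ← ENNReal.rpow_mul,
      mul_one_div_cancel hr.ne', ENNReal.rpow_one]
  calc (∫⁻ x, ‖paraShift φ n Λ f g x‖ₑ ^ s) ^ (1 / s)
      ≤ (∫⁻ x, (avgSq φ (psiS φ) n Λ f * avgSq φ (psiS φ) n Λ g) x ^ s) ^ (1 / s) := by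
        gcongr with x
        exact enorm_paraShift_le hf hg φ n Λ x
    _ ≤ (∫⁻ x, avgSq φ (psiS φ) n Λ f x ^ p) ^ (1 / p) *
          (∫⁻ x, avgSq φ (psiS φ) n Λ g x ^ q) ^ (1 / q) :=
        ENNReal.lintegral_Lp_mul_le_Lq_mul_Lr hs hsp hpq volume
          (hf.measurable_avgSq _ _ _ _).aemeasurable (hg.measurable_avgSq _ _ _ _).aemeasurable
    _ ≤ (D₁ * lg n * (∫⁻ x, ‖f x‖ₑ ^ p) ^ (1 / p)) *
          (D₂ * lg n * (∫⁻ x, ‖g x‖ₑ ^ q) ^ (1 / q)) :=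
        mul_le_mul' (key hp0 (h₁ n Λ f hf f.continuous)) (key hq0 (h₂ n Λ g hg g.continuous))
    _ = _ := by push_cast; ring

lemma lintegral_mul_le_of_floor {b S : ℝ → ℝ≥0∞} {k : ℤ} {A : ℝ≥0∞} (hS : Measurable S)
    (hb : ∀ x y, ⌊(2 : ℝ) ^ k * x⌋ = ⌊(2 : ℝ) ^ k * y⌋ → b x = b y)
    (hA : ∀ m : ℤ, ∫⁻ x in dyadic (k, m), S x ≤ A * volume (dyadic (k, m))) :
    ∫⁻ x, b x * S x ≤ A * ∫⁻ x, b x := by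
  have hU : ⋃ m : ℤ, dyadic (k, m) = Set.univ :=
    Set.eq_univ_of_forall fun x => Set.mem_iUnion.2 ⟨_, mem_dyadic_floor k x⟩
  have hd : Pairwise fun m n : ℤ => Disjoint (dyadic (k, m)) (dyadic (k, n)) := by
    intro m n hmn
    refine Set.disjoint_left.2 fun x hx hy => hmn ?_
    exact (show ⌊(2 : ℝ) ^ k * x⌋ = m from hx).symm.trans hy
  have hs (F : ℝ → ℝ≥0∞) : ∫⁻ x, F x = ∑' m : ℤ, ∫⁻ x in dyadic (k, m), F x := by
    rw [← lintegral_iUnion (fun m => measurableSet_dyadic _) hd, hU, setLIntegral_univ]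
  rw [hs fun x => b x * S x, hs b, ← ENNReal.tsum_mul_left]
  refine ENNReal.tsum_le_tsum fun m => ?_
  obtain ⟨y, hy⟩ := dyadic_nonempty (k, m)
  have hby : ∀ x ∈ dyadic (k, m), b x = b y := fun x hx =>
    hb x y ((show ⌊(2 : ℝ) ^ k * x⌋ = m from hx).trans (show _ = m from hy).symm)
  rw [setLIntegral_congr_fun (g := fun x => b y * S x) (measurableSet_dyadic _)
      fun x hx => by simp only [hby x hx],
    setLIntegral_congr_fun (f := b) (g := fun _ => b y) (measurableSet_dyadic _) hby,
    lintegral_const_mul _ hS, setLIntegral_const, mul_left_comm]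
  gcongr
  exact hA m

/-- The Carleson embedding inequality over finitely many dyadic generations. -/
lemma lintegral_sum_mul_le_of_carleson {a : ℤ → ℝ → ℝ≥0∞} (ha : ∀ k, Measurable (a k))
    {A : ℝ≥0∞} (Λ : Finset ℤ) :
    (∀ q : ℤ × ℤ, ∫⁻ x in dyadic q, ∑ k ∈ Λ with q.1 ≤ k, a k x ≤ A * volume (dyadic q)) →
    ∀ b : ℤ → ℝ → ℝ≥0∞, (∀ k, Measurable (b k)) →
    (∀ k x y, ⌊(2 : ℝ) ^ k * x⌋ = ⌊(2 : ℝ) ^ k * y⌋ → b k x = b k y) →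
    ∫⁻ x, ∑ k ∈ Λ, a k x * b k x ≤ A * ∫⁻ x, Λ.sup fun k => b k x := by
  refine Finset.induction_on_min (motive := fun Λ : Finset ℤ =>
    (∀ q : ℤ × ℤ, ∫⁻ x in dyadic q, ∑ k ∈ Λ with q.1 ≤ k, a k x ≤ A * volume (dyadic q)) →
    ∀ b : ℤ → ℝ → ℝ≥0∞, (∀ k, Measurable (b k)) →
    (∀ k x y, ⌊(2 : ℝ) ^ k * x⌋ = ⌊(2 : ℝ) ^ k * y⌋ → b k x = b k y) →
    ∫⁻ x, ∑ k ∈ Λ, a k x * b k x ≤ A * ∫⁻ x, Λ.sup fun k => b k x) Λ ?_ ?_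
  · intro _ b _ _
    simp
  · intro j Λ hj ih hA b hbm hb
    have hjΛ : j ∉ Λ := fun h => lt_irrefl _ (hj j h)
    have hj' : ∀ k ∈ insert j Λ, j ≤ k := by
      intro k hk
      rcases Finset.mem_insert.1 hk with rfl | hk
      exacts [le_rfl, (hj k hk).le]
    set b' : ℤ → ℝ → ℝ≥0∞ := fun k x => if j ≤ k then b k x - b j x else 0 with hb'
    have h1 := ih (fun q => le_trans (lintegral_mono fun x => Finset.sum_le_sum_of_subset
        (Finset.filter_subset_filter _ (Finset.subset_insert _ _))) (hA q)) b'
      (fun k => by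
        by_cases h : j ≤ k
        · simp only [hb', h, if_true]; exact (hbm k).sub (hbm j)
        · simp only [hb', h, if_false]; exact measurable_const)
      (fun k x y hxy => by
        by_cases h : j ≤ k
        · simp only [hb', h, if_true]
          rw [hb k x y hxy, hb j x y (by rw [floor_dil_of_le h, floor_dil_of_le h, hxy])]
        · simp only [hb', h, if_false])
    have h2 : ∫⁻ x, b j x * ∑ k ∈ insert j Λ, a k x ≤ A * ∫⁻ x, b j x := by
      refine lintegral_mul_le_of_floor (Finset.measurable_fun_sum _ fun k _ => ha k) (hb j)
        fun m => ?_
      have := hA (j, m)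
      rwa [Finset.filter_true_of_mem hj'] at this
    calc ∫⁻ x, ∑ k ∈ insert j Λ, a k x * b k x
        ≤ ∫⁻ x, (b j x * ∑ k ∈ insert j Λ, a k x + ∑ k ∈ Λ, a k x * b' k x) := by
          refine lintegral_mono fun x => ?_
          have e : ∑ k ∈ Λ, a k x * b' k x = ∑ k ∈ insert j Λ, a k x * b' k x := by
            rw [Finset.sum_insert hjΛ]; simp [hb']
          dsimp only
          rw [e, Finset.mul_sum, ← Finset.sum_add_distrib]
          refine Finset.sum_le_sum fun k hk => ?_
          rw [mul_comm (b j x), ← mul_add]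
          gcongr
          simp only [hb', hj' k hk, if_true]
          exact le_add_tsub
      _ = (∫⁻ x, b j x * ∑ k ∈ insert j Λ, a k x) + ∫⁻ x, ∑ k ∈ Λ, a k x * b' k x :=
          lintegral_add_left (f := fun x => b j x * ∑ k ∈ insert j Λ, a k x)
            ((hbm j).mul (Finset.measurable_fun_sum _ fun k _ => ha k)) _
      _ ≤ (A * ∫⁻ x, b j x) + A * ∫⁻ x, Λ.sup fun k => b' k x := add_le_add h2 h1
      _ = A * ∫⁻ x, (b j x + Λ.sup fun k => b' k x) := by
          rw [← mul_add, lintegral_add_left (hbm j)]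
      _ ≤ A * ∫⁻ x, (insert j Λ).sup fun k => b k x := by
          gcongr with x
          have hle : b j x ≤ (insert j Λ).sup fun k => b k x :=
            Finset.le_sup (f := fun k => b k x) (Finset.mem_insert_self _ _)
          calc b j x + Λ.sup (fun k => b' k x)
              ≤ b j x + ((insert j Λ).sup (fun k => b k x) - b j x) := by
                gcongr
                refine Finset.sup_le fun k hk => ?_
                simp only [hb', (hj k hk).le, if_true]
                gcongr
                exact Finset.le_sup (f := fun k => b k x) (Finset.mem_insert_of_mem hk)
            _ = _ := add_tsub_cancel_of_le hle

lemma Nice.indicator {f : ℝ → ℂ} (hf : Nice f) {s : Set ℝ} (hs : MeasurableSet s) :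
    Nice (s.indicator f) where
  meas := hf.meas.indicator hs
  int := hf.int.indicator hs
  bdd := by
    obtain ⟨C, hC⟩ := hf.bdd
    exact ⟨C, fun x => (norm_indicator_le_norm_self _ _).trans (hC x)⟩

lemma enorm_add_sq_le (a b : ℂ) : ‖a + b‖ₑ ^ 2 ≤ 2 * (‖a‖ₑ ^ 2 + ‖b‖ₑ ^ 2) :=
  (enorm_parallelogram a b).le.trans' le_self_add

lemma Prof.enorm_conv_indicator_compl_triple_le {α : ℝ → ℂ} {c : ℝ≥0} (hα : Prof α c) (k : ℤ)
    (a : ℝ) {f : ℝ → ℂ} {M : ℝ≥0∞} (hM : ∀ x, ‖f x‖ₑ ≤ M) {q : ℤ × ℤ} {x : ℝ}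
    (hx : x ∈ dyadic q) :
    ‖conv ((dyadicTriple q)ᶜ.indicator f) (dilR α k a) x‖ₑ ≤
      M * c * kapMoment * min 1 (ENNReal.ofReal ((1 + |a|) / (2 ^ k * 2 ^ (-q.1)))) := by
  refine (_root_.ShiftedParaproduct.enorm_conv_le _ _ x).trans ?_
  unfold lconv
  set δ : ℝ := 2 ^ (-q.1)
  have hm : MeasurableSet {z : ℝ | δ ≤ |z|} := measurableSet_le measurable_const (by fun_prop)
  calc ∫⁻ t, ‖(dyadicTriple q)ᶜ.indicator f t‖ₑ * ‖dilR α k a (x - t)‖ₑ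
      ≤ ∫⁻ t, M * c * {z : ℝ | δ ≤ |z|}.indicator (kk k a) (x - t) := by
        refine lintegral_mono fun t => ?_
        by_cases ht : t ∈ dyadicTriple q
        · rw [Set.indicator_of_notMem (by simpa using ht)]; simp
        · have h1 : δ ≤ |x - t| := by
            rw [abs_sub_comm]; exact le_abs_sub_of_not_mem_triple ht hx
          rw [Set.indicator_of_mem (s := {z : ℝ | δ ≤ |z|}) h1, mul_assoc]
          refine mul_le_mul' ?_ (hα.enorm_dilR_le k a _)
          rw [Set.indicator_of_mem ht]
          exact hM t
    _ = M * c * ∫⁻ z in {z : ℝ | δ ≤ |z|}, kk k a z := by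
        rw [lintegral_const_mul _ (by
            have := (measurable_kk k a).indicator hm
            fun_prop),
          lintegral_sub_left_eq_self ({z : ℝ | δ ≤ |z|}.indicator (kk k a)) x,
          lintegral_indicator hm]
    _ ≤ M * c * (kapMoment * min 1 (ENNReal.ofReal ((1 + |a|) / (2 ^ k * δ)))) := by
        gcongr
        exact (mom_kk k a).tail (two_zpow_pos _)
    _ = _ := by ring

/-- The Carleson measure estimate for a bounded function. -/
lemma Band.exists_carleson {α : 𝓢(ℝ, ℂ)} {C : ℝ≥0} (hα : Band α C) :
    ∃ D : ℝ≥0, ∀ (a : ℝ) (Λ : Finset ℤ) (f : ℝ → ℂ) (M : ℝ≥0∞), Nice f → (∀ x, ‖f x‖ₑ ≤ M) →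
      ∀ q : ℤ × ℤ, ∫⁻ x in dyadic q, ∑ k ∈ Λ with q.1 ≤ k, ‖conv f (dilR α k a) x‖ₑ ^ 2 ≤
        D * M ^ 2 * lg a * volume (dyadic q) := by
  obtain ⟨c, hc⟩ := exists_prof α
  obtain ⟨S, hS⟩ := exists_sum_min_le
  set κ : ℝ≥0 := kapMoment.toNNReal
  have hκ : kapMoment = κ := (ENNReal.coe_toNNReal kapMoment_ne_top).symm
  refine ⟨2 * ((2 * C) ^ 2 * 3 + (c * κ) ^ 2 * S), fun a Λ f M hf hM q => ?_⟩
  have hT := measurableSet_dyadicTriple q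
  set T := dyadicTriple q
  set f₁ := T.indicator f
  set f₂ := Tᶜ.indicator f
  have hf₁ : Nice f₁ := hf.indicator hT
  have hf₂ : Nice f₂ := hf.indicator hT.compl
  have e : f = f₁ + f₂ := (Set.indicator_self_add_compl T f).symm
  set L := Λ.filter (q.1 ≤ ·)
  have hloc : ∫⁻ x in dyadic q, ∑ k ∈ L, ‖conv f₁ (dilR α k a) x‖ₑ ^ 2 ≤
      ↑(2 * C) ^ 2 * (M ^ 2 * (3 * volume (dyadic q))) := by
    refine (setLIntegral_le_lintegral _ _).trans ((hα.lintegral_square_le hf₁ L a).trans ?_)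
    gcongr
    rw [← volume_dyadicTriple, ← setLIntegral_const, ← lintegral_indicator hT]
    refine lintegral_mono fun x => ?_
    by_cases hx : x ∈ T
    · simp only [f₁, Set.indicator_of_mem hx]
      gcongr
      exact hM x
    · simp [f₁, Set.indicator_of_notMem hx]
  have hfar : ∀ x ∈ dyadic q, ∑ k ∈ L, ‖conv f₂ (dilR α k a) x‖ₑ ^ 2 ≤
      (M * c * kapMoment) ^ 2 * (S * lg a) := by
    intro x hx
    refine le_trans ?_ (mul_le_mul_right (hS L (2 ^ (-q.1)) (1 + |a|) (two_zpow_pos _)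
      (by linarith [abs_nonneg a])) _)
    rw [Finset.mul_sum]
    refine Finset.sum_le_sum fun k hk => ?_
    have hk' : q.1 ≤ k := (Finset.mem_filter.1 hk).2
    have h1 : (1 : ℝ) ≤ 2 ^ k * 2 ^ (-q.1) := by
      rw [← zpow_add₀ two_ne_zero]
      exact one_le_zpow₀ one_le_two (by omega)
    rw [min_eq_left (by simpa using ENNReal.ofReal_le_ofReal h1), one_mul]
    refine (pow_le_pow_left' (hc.enorm_conv_indicator_compl_triple_le k a hM hx) 2).trans ?_
    rw [mul_pow]
    gcongr
    rw [sq]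
    exact mul_le_of_le_one_left' (min_le_left _ _)
  have hm₁ : Measurable fun x => ∑ k ∈ L, ‖conv f₁ (dilR α k a) x‖ₑ ^ 2 :=
    Finset.measurable_fun_sum _ fun k _ => by
      have := (hf₁.conv_dilR α k a).meas
      fun_prop
  calc ∫⁻ x in dyadic q, ∑ k ∈ L, ‖conv f (dilR α k a) x‖ₑ ^ 2
      ≤ ∫⁻ x in dyadic q, 2 * ((∑ k ∈ L, ‖conv f₁ (dilR α k a) x‖ₑ ^ 2) +
          (M * c * kapMoment) ^ 2 * (S * lg a)) := by
        refine setLIntegral_mono' (measurableSet_dyadic _) fun x hx => ?_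
        refine le_trans ?_ (mul_le_mul_right (add_le_add_right (hfar x hx) _) _)
        rw [← Finset.sum_add_distrib, Finset.mul_sum]
        refine Finset.sum_le_sum fun k _ => ?_
        rw [e, conv_add hf₁ hf₂]
        exact enorm_add_sq_le _ _
    _ = 2 * ((∫⁻ x in dyadic q, ∑ k ∈ L, ‖conv f₁ (dilR α k a) x‖ₑ ^ 2) +
          (M * c * kapMoment) ^ 2 * (S * lg a) * volume (dyadic q)) := by
        rw [lintegral_const_mul _ (hm₁.add_const _), lintegral_add_left hm₁, setLIntegral_const]
    _ ≤ 2 * (↑(2 * C) ^ 2 * (M ^ 2 * (3 * volume (dyadic q))) * lg a +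
          (M * c * kapMoment) ^ 2 * (S * lg a) * volume (dyadic q)) := by
        gcongr
        exact hloc.trans (le_mul_of_one_le_right' (one_le_lg a))
    _ = _ := by
        rw [hκ]; push_cast; ring

lemma kap_le_tsum (z : ℝ) : ENNReal.ofReal (kap z) ≤
    ∑' j : ℕ, {u : ℝ | |u| < 2 ^ j}.indicator (fun _ => ENNReal.ofReal (8 * (8⁻¹) ^ j)) z := by
  obtain ⟨j, hj, h⟩ : ∃ j : ℕ, |z| < 2 ^ j ∧ kap z ≤ 8 * (8⁻¹) ^ j := by
    rcases lt_or_ge |z| 1 with hz | hz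
    · exact ⟨0, by simpa using hz, (kap_le_one z).trans (by norm_num)⟩
    · obtain ⟨i, h1, h2⟩ := exists_nat_pow_near hz one_lt_two
      refine ⟨i + 1, h2, ?_⟩
      have e : (8 : ℝ) * 8⁻¹ ^ (i + 1) = ((2 ^ i) ^ 3)⁻¹ := by
        rw [pow_succ, ← pow_mul, mul_comm i 3, pow_mul, inv_pow]
        norm_num
        ring
      rw [e, kap]
      gcongr
      linarith
  refine le_trans ?_ (ENNReal.le_tsum j)
  rw [Set.indicator_of_mem (by exact hj)]
  exact ENNReal.ofReal_le_ofReal h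

lemma setLIntegral_dyadicTriple_le {w : ℝ → ℝ≥0∞} {t : ℝ≥0∞} (hw : ∫⁻ y, w y ≠ ∞) (ht : t ≠ 0)
    {x : ℝ} (hx : x ∉ tripleUnion (stopping w t)) {q : ℤ × ℤ} (hq : x ∈ dyadic q) :
    ∫⁻ y in dyadicTriple q, w y ≤ t * (3 * ENNReal.ofReal (2 ^ (-q.1))) := by
  have hx' : ⌊(2 : ℝ) ^ q.1 * x⌋ = q.2 := hq
  have hsub : dyadicTriple q ⊆
      dyadic (q.1, q.2 - 1) ∪ (dyadic (q.1, q.2) ∪ dyadic (q.1, q.2 + 1)) := by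
    intro y hy
    have hy' : q.2 - 1 ≤ ⌊(2 : ℝ) ^ q.1 * y⌋ ∧ ⌊(2 : ℝ) ^ q.1 * y⌋ ≤ q.2 + 1 := hy
    have : ⌊(2 : ℝ) ^ q.1 * y⌋ = q.2 - 1 ∨ ⌊(2 : ℝ) ^ q.1 * y⌋ = q.2 ∨
      ⌊(2 : ℝ) ^ q.1 * y⌋ = q.2 + 1 := by omega
    exact this
  have h (m : ℤ) (hm : m - 1 ≤ q.2 ∧ q.2 ≤ m + 1) :
      ∫⁻ y in dyadic (q.1, m), w y ≤ t * ENNReal.ofReal (2 ^ (-q.1)) := by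
    have := setLIntegral_le_of_not_mem_tripleUnion hw ht hx (q := (q.1, m))
      (show m - 1 ≤ ⌊(2 : ℝ) ^ q.1 * x⌋ ∧ ⌊(2 : ℝ) ^ q.1 * x⌋ ≤ m + 1 by rw [hx']; exact hm)
    rwa [volume_dyadic] at this
  calc ∫⁻ y in dyadicTriple q, w y
      ≤ (∫⁻ y in dyadic (q.1, q.2 - 1), w y) + ((∫⁻ y in dyadic (q.1, q.2), w y) +
          ∫⁻ y in dyadic (q.1, q.2 + 1), w y) :=
        (lintegral_mono_set hsub).trans ((lintegral_union_le _ _ _).trans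
          (add_le_add_right (lintegral_union_le _ _ _) _))
    _ ≤ t * ENNReal.ofReal (2 ^ (-q.1)) + (t * ENNReal.ofReal (2 ^ (-q.1)) +
          t * ENNReal.ofReal (2 ^ (-q.1))) :=
        add_le_add (h _ (by omega)) (add_le_add (h _ (by omega)) (h _ (by omega)))
    _ = _ := by ring

/-- Off the exceptional set, convolution with a decaying kernel is controlled on the whole
dyadic interval around the point. -/
lemma lconv_kk_le_of_not_mem {w : ℝ → ℝ≥0∞} (hwm : Measurable w) {t : ℝ≥0∞}
    (hw : ∫⁻ y, w y ≠ ∞) (ht : t ≠ 0) {x : ℝ} (hx : x ∉ tripleUnion (stopping w t)) {k : ℤ} {y : ℝ}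
    (hy : ⌊(2 : ℝ) ^ k * y⌋ = ⌊(2 : ℝ) ^ k * x⌋) : lconv w (kk k 0) y ≤ 32 * t := by
  have h2 := two_zpow_pos k
  have hm (j : ℕ) : MeasurableSet {u : ℝ | |u| < 2 ^ j} :=
    measurableSet_lt (by fun_prop) measurable_const
  have hterm (j : ℕ) : ∫⁻ u, w u * (ENNReal.ofReal (2 ^ k) * {u : ℝ | |u| < 2 ^ j}.indicator
      (fun _ => ENNReal.ofReal (8 * (8⁻¹) ^ j)) (2 ^ k * (y - u))) ≤
      24 * t * ENNReal.ofReal ((4⁻¹) ^ j) := by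
    set q : ℤ × ℤ := (k - j, ⌊(2 : ℝ) ^ (k - j) * x⌋) with hq
    have hyq : y ∈ dyadic q := by
      show ⌊(2 : ℝ) ^ (k - j) * y⌋ = ⌊(2 : ℝ) ^ (k - j) * x⌋
      rw [floor_dil_of_le (by omega : k - j ≤ k), floor_dil_of_le (by omega : k - j ≤ k), hy]
    have hj : (2 : ℝ) ^ (-q.1) = 2 ^ j * (2 ^ k)⁻¹ := by
      rw [hq, neg_sub, zpow_sub₀ two_ne_zero, zpow_natCast, div_eq_mul_inv]
    calc ∫⁻ u, w u * (ENNReal.ofReal (2 ^ k) * {u : ℝ | |u| < 2 ^ j}.indicator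
          (fun _ => ENNReal.ofReal (8 * (8⁻¹) ^ j)) (2 ^ k * (y - u)))
        ≤ ∫⁻ u, ENNReal.ofReal (2 ^ k * (8 * (8⁻¹) ^ j)) * (dyadicTriple q).indicator w u := by
          refine lintegral_mono fun u => ?_
          by_cases hu : u ∈ dyadicTriple q
          · rw [Set.indicator_of_mem hu, mul_comm, ENNReal.ofReal_mul h2.le]
            gcongr
            exact Set.indicator_le_self _ _ _
          · have h1 : (2 : ℝ) ^ (-q.1) ≤ |u - y| := le_abs_sub_of_not_mem_triple hu hyq
            rw [Set.indicator_of_notMem (s := {u : ℝ | |u| < 2 ^ j})]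
            · simp
            · show ¬ |2 ^ k * (y - u)| < 2 ^ j
              rw [not_lt, abs_mul, abs_of_pos h2, abs_sub_comm]
              rw [hj, ← div_eq_mul_inv, div_le_iff₀ h2] at h1
              linarith
      _ = ENNReal.ofReal (2 ^ k * (8 * (8⁻¹) ^ j)) * ∫⁻ u in dyadicTriple q, w u := by
          rw [lintegral_const_mul _ (hwm.indicator (measurableSet_dyadicTriple q)),
            lintegral_indicator (measurableSet_dyadicTriple q)]
      _ ≤ ENNReal.ofReal (2 ^ k * (8 * (8⁻¹) ^ j)) * (t * (3 * ENNReal.ofReal (2 ^ (-q.1)))) := by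
          gcongr
          exact setLIntegral_dyadicTriple_le hw ht hx (mem_dyadic_floor _ _)
      _ = 3 * t * (ENNReal.ofReal (2 ^ k * (8 * (8⁻¹) ^ j)) * ENNReal.ofReal (2 ^ (-q.1))) := by
          ring
      _ = 3 * t * ENNReal.ofReal (8 * (4⁻¹) ^ j) := by
          rw [← ENNReal.ofReal_mul (by positivity), hj]
          congr 2
          have : (4⁻¹ : ℝ) ^ j = 8⁻¹ ^ j * 2 ^ j := by rw [← mul_pow]; norm_num
          rw [this]
          field_simp
      _ = _ := by
          rw [ENNReal.ofReal_mul (by norm_num), ENNReal.ofReal_ofNat]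
          ring
  calc lconv w (kk k 0) y
      ≤ ∫⁻ u, ∑' j : ℕ, w u * (ENNReal.ofReal (2 ^ k) * {u : ℝ | |u| < 2 ^ j}.indicator
          (fun _ => ENNReal.ofReal (8 * (8⁻¹) ^ j)) (2 ^ k * (y - u))) := by
        refine lintegral_mono fun u => ?_
        rw [ENNReal.tsum_mul_left, ENNReal.tsum_mul_left]
        dsimp only
        gcongr
        rw [kk, add_zero, ENNReal.ofReal_mul h2.le]
        gcongr
        exact kap_le_tsum _
    _ = ∑' j : ℕ, ∫⁻ u, w u * (ENNReal.ofReal (2 ^ k) * {u : ℝ | |u| < 2 ^ j}.indicator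
          (fun _ => ENNReal.ofReal (8 * (8⁻¹) ^ j)) (2 ^ k * (y - u))) := by
        refine lintegral_tsum fun j => Measurable.aemeasurable ?_
        have : Measurable ({u : ℝ | |u| < 2 ^ j}.indicator
          (fun _ => ENNReal.ofReal (8 * (8⁻¹) ^ j))) := measurable_const.indicator (hm j)
        fun_prop
    _ ≤ ∑' j : ℕ, 24 * t * ENNReal.ofReal ((4⁻¹) ^ j) := ENNReal.tsum_le_tsum hterm
    _ = 32 * t := by
        rw [ENNReal.tsum_mul_left, ← ENNReal.ofReal_tsum_of_nonneg (fun j => by positivity)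
          (summable_geometric_of_lt_one (by norm_num) (by norm_num)),
          tsum_geometric_of_lt_one (by norm_num) (by norm_num), mul_right_comm]
        congr 1
        rw [show (24 : ℝ≥0∞) = ENNReal.ofReal 24 by simp, ← ENNReal.ofReal_mul (by norm_num)]
        norm_num

/-- The supremum of `|h ∗ α_k|` over the generation-`k` dyadic interval containing `x`. -/
noncomputable def cellSup (α : ℝ → ℂ) (h : ℝ → ℂ) (k : ℤ) (x : ℝ) : ℝ≥0∞ :=
  ⨆ y : dyadic (k, ⌊(2 : ℝ) ^ k * x⌋), ‖conv h (dilR α k 0) y‖ₑ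

lemma cellSup_congr (α h : ℝ → ℂ) {k : ℤ} {x y : ℝ} (hxy : ⌊(2 : ℝ) ^ k * x⌋ = ⌊(2 : ℝ) ^ k * y⌋) :
    cellSup α h k x = cellSup α h k y := by
  rw [cellSup, cellSup, hxy]

lemma le_cellSup (α h : ℝ → ℂ) (k : ℤ) (x : ℝ) : ‖conv h (dilR α k 0) x‖ₑ ≤ cellSup α h k x :=
  le_iSup (fun y : dyadic (k, ⌊(2 : ℝ) ^ k * x⌋) => ‖conv h (dilR α k 0) y‖ₑ)
    ⟨x, mem_dyadic_floor k x⟩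

@[fun_prop]
lemma measurable_cellSup (α h : ℝ → ℂ) (k : ℤ) : Measurable (cellSup α h k) :=
  (measurable_from_top (f := fun m : ℤ => ⨆ y : dyadic (k, m), ‖conv h (dilR α k 0) y‖ₑ)).comp
    (measurable_floor_dil k)

/-- The dyadic maximal function `sup_k cellSup` is bounded on `L²`. -/
lemma Prof.lintegral_sup_cellSup_sq_le {α : ℝ → ℂ} {c : ℝ≥0} (hα : Prof α c) {h : ℝ → ℂ}
    (hh : Nice h) (Λ : Finset ℤ) :
    ∫⁻ x, Λ.sup (fun k => cellSup α h k x ^ 2) ≤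
      (32 * (c + 1)) ^ 2 * 24 * ∫⁻ x, ‖h x‖ₑ ^ 2 := by
  set κ : ℝ≥0∞ := 32 * (c + 1) with hκ
  have hκ0 : κ ≠ 0 := by simp [hκ]
  have hκt : κ ≠ ∞ := by simp [hκ, ENNReal.mul_eq_top]
  set w : ℝ → ℝ≥0∞ := fun x => ‖h x‖ₑ
  have hwm : Measurable w := by have := hh.meas; fun_prop
  set F : ℝ → ℝ≥0∞ := fun x => κ⁻¹ * ⨆ k ∈ Λ, cellSup α h k x
  have hF : Measurable F :=
    (Measurable.biSup _ Λ.countable_toSet fun k _ => measurable_cellSup α h k).const_mul _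
  have hlev : ∀ t : ℝ, 0 < t → volume {x | ENNReal.ofReal t < F x} ≤
      3 * volume (stopSet w (ENNReal.ofReal t)) := by
    intro t ht
    refine le_trans (measure_mono fun x hx => ?_) (volume_tripleUnion_le _ _)
    by_contra hxn
    refine (not_lt.2 ?_ : ¬ ENNReal.ofReal t < F x) hx
    rw [ENNReal.inv_mul_le_iff hκ0 hκt]
    refine iSup₂_le fun k _ => iSup_le fun y => ?_
    refine (_root_.ShiftedParaproduct.enorm_conv_le _ _ _).trans ?_
    calc lconv w (fun t => ‖dilR α k 0 t‖ₑ) y ≤ c * lconv w (kk k 0) y := by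
          unfold lconv
          rw [← lintegral_const_mul _ (by fun_prop)]
          refine lintegral_mono fun u => ?_
          rw [mul_left_comm]
          gcongr
          exact hα.enorm_dilR_le _ _ _
      _ ≤ (c + 1) * (32 * ENNReal.ofReal t) := by
          gcongr
          · exact le_self_add
          · exact lconv_kk_le_of_not_mem hwm hh.lintegral_ne_top
              (by simpa using ht) hxn y.2
      _ = κ * ENNReal.ofReal t := by rw [hκ]; ring
  have hF2 : ∫⁻ x, F x ^ 2 ≤ 24 * ∫⁻ x, w x ^ 2 := by
    have h1 := lintegral_rpow_eq_layer hF (p := 2) two_pos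
    have h2 := lintegral_volume_stopSet_le hwm (fun x => enorm_ne_top) (p := 2) one_lt_two
    simp only [ENNReal.rpow_ofNat] at h1 h2
    rw [h1]
    calc _ ≤ ∫⁻ t in Set.Ioi (0 : ℝ), 3 * (ENNReal.ofReal (2 * t ^ ((2 : ℝ) - 1)) *
          volume (stopSet w (ENNReal.ofReal t))) := by
          refine setLIntegral_mono' measurableSet_Ioi fun t ht => ?_
          rw [mul_left_comm]
          gcongr
          exact hlev t ht
      _ = 3 * ∫⁻ t in Set.Ioi (0 : ℝ), (ENNReal.ofReal (2 * t ^ ((2 : ℝ) - 1)) *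
          volume (stopSet w (ENNReal.ofReal t))) := lintegral_const_mul' _ _ (by simp)
      _ ≤ 3 * (ENNReal.ofReal (2 * 2 * 2 ^ ((2 : ℝ) - 1) / (2 - 1)) * ∫⁻ x, w x ^ 2) := by
          gcongr
      _ = _ := by
          rw [← mul_assoc]
          congr 1
          norm_num
  calc ∫⁻ x, Λ.sup (fun k => cellSup α h k x ^ 2) ≤ ∫⁻ x, κ ^ 2 * F x ^ 2 := by
        refine lintegral_mono fun x => Finset.sup_le fun k hk => ?_
        rw [← mul_pow]
        simp only [F]
        rw [← mul_assoc, ENNReal.mul_inv_cancel hκ0 hκt, one_mul]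
        gcongr
        exact le_iSup₂ (f := fun k (_ : k ∈ Λ) => cellSup α h k x) k hk
    _ = κ ^ 2 * ∫⁻ x, F x ^ 2 := lintegral_const_mul _ (by fun_prop)
    _ ≤ κ ^ 2 * (24 * ∫⁻ x, w x ^ 2) := by gcongr
    _ = _ := by rw [mul_assoc]

/-- The Carleson embedding bound for the product of a square function of a bounded function and
averages of a square-integrable one. -/
lemma Band.exists_lintegral_sum_mul_le {α : 𝓢(ℝ, ℂ)} {C : ℝ≥0} (hα : Band α C) (β : 𝓢(ℝ, ℂ)) :
    ∃ D : ℝ≥0, ∀ (a : ℝ) (Λ : Finset ℤ) (f h : ℝ → ℂ) (M : ℝ≥0∞), Nice f → Nice h →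
      (∀ x, ‖f x‖ₑ ≤ M) →
      ∫⁻ x, ∑ k ∈ Λ, ‖conv f (dilR α k a) x‖ₑ ^ 2 * ‖conv h (dilR β k 0) x‖ₑ ^ 2 ≤
        D * M ^ 2 * lg a * ∫⁻ x, ‖h x‖ₑ ^ 2 := by
  obtain ⟨D, hD⟩ := hα.exists_carleson
  obtain ⟨c, hc⟩ := exists_prof β
  refine ⟨D * ((32 * (c + 1)) ^ 2 * 24), fun a Λ f h M hf hh hM => ?_⟩
  calc _ ≤ ∫⁻ x, ∑ k ∈ Λ, ‖conv f (dilR α k a) x‖ₑ ^ 2 * cellSup β h k x ^ 2 := by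
        gcongr with x k _
        exact le_cellSup _ _ _ _
    _ ≤ D * M ^ 2 * lg a * ∫⁻ x, Λ.sup fun k => cellSup β h k x ^ 2 :=
        lintegral_sum_mul_le_of_carleson (fun k => by
          have := (hf.conv_dilR α k a).meas
          fun_prop) Λ (hD a Λ f M hf hM) _ (fun k => by fun_prop) fun k x y hxy => by
            rw [cellSup_congr _ _ hxy]
    _ ≤ D * M ^ 2 * lg a * ((32 * (c + 1)) ^ 2 * 24 * ∫⁻ x, ‖h x‖ₑ ^ 2) := by
        gcongr
        exact hc.lintegral_sup_cellSup_sq_le hh Λ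
    _ = _ := by push_cast; ring

lemma lconv_assoc {f g h : ℝ → ℝ≥0∞} (hf : Measurable f) (hg : Measurable g) (hh : Measurable h)
    (x : ℝ) : lconv (lconv f g) h x = lconv f (lconv g h) x := by
  unfold lconv
  calc ∫⁻ y, (∫⁻ z, f z * g (y - z)) * h (x - y)
      = ∫⁻ y, ∫⁻ z, f z * (g (y - z) * h (x - y)) := by
        refine lintegral_congr fun y => ?_
        rw [← lintegral_mul_const _ (by fun_prop)]
        simp_rw [mul_assoc]
    _ = ∫⁻ z, ∫⁻ y, f z * (g (y - z) * h (x - y)) := lintegral_lintegral_swap (by fun_prop)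
    _ = _ := by
        refine lintegral_congr fun z => ?_
        rw [lintegral_const_mul _ (by fun_prop),
          ← lintegral_add_right_eq_self (fun y => g (y - z) * h (x - y)) z]
        congr 1
        refine lintegral_congr fun y => ?_
        congr 2 <;> ring

lemma lconv_mono {f f' g g' : ℝ → ℝ≥0∞} (hf : ∀ x, f x ≤ f' x) (hg : ∀ x, g x ≤ g' x) (x : ℝ) :
    lconv f g x ≤ lconv f' g' x :=
  lintegral_mono fun y => mul_le_mul' (hf y) (hg _)

lemma lconv_const_mul {f g : ℝ → ℝ≥0∞} {c d : ℝ≥0∞} (hc : c ≠ ∞) (hd : d ≠ ∞) (x : ℝ) :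
    lconv (fun y => c * f y) (fun y => d * g y) x = c * d * lconv f g x := by
  unfold lconv
  rw [← lintegral_const_mul' _ _ (ENNReal.mul_ne_top hc hd)]
  refine lintegral_congr fun y => ?_
  ring

lemma reflS_reflS (α : 𝓢(ℝ, ℂ)) : reflS (reflS α) = α := by
  ext x; simp [reflS_apply]

/-- The operator `g ↦ ∑ₖ (Fₖ · (g ∗ α_{k,a})) ∗ β_{k,b}`. -/
noncomputable def prodOp (F : ℤ → ℝ → ℂ) (α : ℝ → ℂ) (a : ℝ) (β : ℝ → ℂ) (b : ℝ) (Λ : Finset ℤ)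
    (g : ℝ → ℂ) (x : ℝ) : ℂ :=
  ∑ k ∈ Λ, conv (fun y => F k y * conv g (dilR α k a) y) (dilR β k b) x

section prodOp

variable {F : ℤ → ℝ → ℂ} (hF : ∀ k, Nice (F k)) (α : 𝓢(ℝ, ℂ)) (a : ℝ) (β : 𝓢(ℝ, ℂ)) (b : ℝ)
  (Λ : Finset ℤ) {g : ℝ → ℂ} (hg : Nice g)

include hF hg

lemma nice_prodOp : Nice (prodOp F α a β b Λ g) :=
  Nice.sum Λ fun k _ => ((hF k).mul (hg.conv_dilR α k a)).conv_dilR β k b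

lemma continuous_prodOp : Continuous (prodOp F α a β b Λ g) :=
  continuous_finsetSum _ fun k _ => ((hF k).mul (hg.conv_dilR α k a)).continuous_conv_dilR β k b

lemma prodOp_add {h : ℝ → ℂ} (hh : Nice h) (x : ℝ) :
    prodOp F α a β b Λ (g + h) x = prodOp F α a β b Λ g x + prodOp F α a β b Λ h x := by
  unfold prodOp
  rw [← Finset.sum_add_distrib]
  refine Finset.sum_congr rfl fun k _ => ?_
  rw [← conv_add ((hF k).mul (hg.conv_dilR α k a)) ((hF k).mul (hh.conv_dilR α k a))]
  congr 1
  ext y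
  rw [conv_add hg hh, mul_add]
  rfl

lemma integral_prodOp_mul {u : ℝ → ℂ} (hu : Nice u) :
    ∫ x, prodOp F α a β b Λ g x * u x = ∑ k ∈ Λ,
      ∫ x, F k x * (conv g (dilR α k a) x * conv u (dilR (reflS β) k (-b)) x) := by
  simp only [prodOp, Finset.sum_mul]
  rw [integral_finsetSum _ fun k _ =>
    ((((hF k).mul (hg.conv_dilR α k a)).conv_dilR β k b).mul hu).int]
  refine Finset.sum_congr rfl fun k _ => ?_
  rw [integral_conv_mul ((hF k).mul (hg.conv_dilR α k a)) hu]
  simp only [mul_assoc]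

/-- The transpose of `prodOp`. -/
lemma integral_prodOp_mul_eq {u : ℝ → ℂ} (hu : Nice u) :
    ∫ x, prodOp F α a β b Λ g x * u x =
      ∫ x, g x * prodOp F (reflS β) (-b) (reflS α) (-a) Λ u x := by
  simp_rw [mul_comm (g _)]
  rw [integral_prodOp_mul hF α a β b Λ hg hu, integral_prodOp_mul hF _ _ _ _ Λ hu hg,
    reflS_reflS, neg_neg]
  refine Finset.sum_congr rfl fun k _ => integral_congr_ae (.of_forall fun x => ?_)
  simp only
  ring

lemma lintegral_prodOp_sq_le {B : ℝ≥0∞}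
    (hB : ∀ u, Nice u → ∫⁻ x, ∑ k ∈ Λ, ‖F k x‖ₑ * (‖conv g (dilR α k a) x‖ₑ *
      ‖conv u (dilR (reflS β) k (-b)) x‖ₑ) ≤
      B * ((∫⁻ x, ‖g x‖ₑ ^ 2) ^ (1 / 2 : ℝ) * (∫⁻ x, ‖u x‖ₑ ^ 2) ^ (1 / 2 : ℝ))) :
    ∫⁻ x, ‖prodOp F α a β b Λ g x‖ₑ ^ 2 ≤ B ^ 2 * ∫⁻ x, ‖g x‖ₑ ^ 2 := by
  have h := lintegral_rpow_le_of_pairing (nice_prodOp hF α a β b Λ hg)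
    (continuous_prodOp hF α a β b Λ hg) (p := 2) (q := 2) le_rfl
    (Real.holderConjugate_iff.2 ⟨by norm_num, by norm_num⟩)
    (B := B * (∫⁻ x, ‖g x‖ₑ ^ 2) ^ (1 / 2 : ℝ)) fun u hu _ => by
      rw [integral_prodOp_mul hF α a β b Λ hg hu]
      simp only [ENNReal.rpow_ofNat]
      rw [mul_assoc]
      refine le_trans ?_ (hB u hu)
      rw [lintegral_finsetSum]
      · refine (enorm_sum_le _ _).trans (Finset.sum_le_sum fun k _ => ?_)
        refine (enorm_integral_le_lintegral_enorm _).trans (le_of_eq ?_)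
        simp only [enorm_mul]
      · intro k _
        have h1 := (hF k).meas
        have h2 := (hg.conv_dilR α k a).meas
        have h3 := (hu.conv_dilR (reflS β) k (-b)).meas
        fun_prop
  simp only [ENNReal.rpow_ofNat] at h
  refine h.trans (le_of_eq ?_)
  rw [mul_pow, ENNReal.rpow_half_sq]

end prodOp

/-- `prodOp` is a Calderón–Zygmund operator as soon as it is bounded on `L²`. -/
lemma exists_czOp_prodOp (α β : 𝓢(ℝ, ℂ)) : ∃ D : ℝ≥0, ∀ (F : ℤ → ℝ → ℂ) (a b : ℝ)
    (Λ : Finset ℤ) (M A : ℝ≥0∞), (∀ k, Nice (F k)) → (∀ k x, ‖F k x‖ₑ ≤ M) → M ≠ ∞ →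
    (∀ g, Nice g → ∫⁻ x, ‖prodOp F α a β b Λ g x‖ₑ ^ 2 ≤ A ^ 2 * ∫⁻ x, ‖g x‖ₑ ^ 2) →
    CZOp (fun g x => ‖prodOp F α a β b Λ g x‖ₑ)
      (A + D * M * ENNReal.ofReal (1 + Real.log ((1 + |a|) * (1 + |b|)))) := by
  obtain ⟨c, hc⟩ := exists_prof α
  obtain ⟨c', hc'⟩ := exists_prof β
  obtain ⟨D, hD⟩ := exists_bad_bound
  set κ := kapMoment.toNNReal
  have hκ : kapMoment = κ := (ENNReal.coe_toNNReal kapMoment_ne_top).symm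
  refine ⟨c * c' * κ ^ 2 * D, fun F a b Λ M A hF hM hMt hA =>
    ⟨fun g hg => (nice_prodOp hF α a β b Λ hg).meas.enorm, fun g h hg hh x => ?_,
      fun g hg => ?_, fun Q hQ u hu hu0 hum => ?_⟩⟩
  · rw [prodOp_add hF α a β b Λ hg hh]
    exact enorm_add_le _ _
  · refine (hA g hg).trans ?_
    gcongr
    exact le_self_add
  · have ha := abs_nonneg a
    have hb := abs_nonneg b
    have hw := hu.meas.enorm
    have hcM : M * c ≠ ∞ := ENNReal.mul_ne_top hMt ENNReal.coe_ne_top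
    have hpt : ∀ k x, ‖conv (fun y => F k y * conv u (dilR α k a) y) (dilR β k b) x‖ₑ ≤
        M * c * c' * lconv (cancelWeight Q k fun t => ‖u t‖ₑ) (lconv (kk k a) (kk k b)) x := by
      intro k x
      rw [← lconv_assoc (measurable_cancelWeight Q k hw) (measurable_kk k a) (measurable_kk k b),
        ← lconv_const_mul hcM ENNReal.coe_ne_top]
      refine (_root_.ShiftedParaproduct.enorm_conv_le _ _ x).trans (lconv_mono (fun y => ?_)
        (fun y => hc'.enorm_dilR_le k b y) x)
      rw [enorm_mul, mul_assoc]
      exact mul_le_mul' (hM k y) (hc.enorm_conv_le k a hQ hu hu0 hum y)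
    calc ∫⁻ x in (tripleUnion Q)ᶜ, ‖prodOp F α a β b Λ u x‖ₑ
        ≤ ∫⁻ x in (tripleUnion Q)ᶜ, M * c * c' * ∑ k ∈ Λ,
            lconv (cancelWeight Q k fun t => ‖u t‖ₑ) (lconv (kk k a) (kk k b)) x := by
          refine lintegral_mono fun x => ?_
          rw [Finset.mul_sum]
          exact (enorm_sum_le _ _).trans (Finset.sum_le_sum fun k _ => hpt k x)
      _ = M * c * c' * ∫⁻ x in (tripleUnion Q)ᶜ, ∑ k ∈ Λ,
            lconv (cancelWeight Q k fun t => ‖u t‖ₑ) (lconv (kk k a) (kk k b)) x :=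
          lintegral_const_mul' _ _ (ENNReal.mul_ne_top hcM ENNReal.coe_ne_top)
      _ ≤ M * c * c' * (kapMoment * kapMoment * (D * ENNReal.ofReal
            (1 + Real.log ((1 + |a|) * (1 + |b|)))) * ∫⁻ x, ‖u x‖ₑ) := by
          gcongr
          exact hD Q hQ Λ (fun k => lconv (kk k a) (kk k b)) _ _ (by nlinarith)
            (fun k _ => (mom_kk k a).lconv (by positivity) (mom_kk k b)) _ hw
      _ = ↑(c * c' * κ ^ 2 * D) * M * ENNReal.ofReal (1 + Real.log ((1 + |a|) * (1 + |b|))) *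
            ∫⁻ x, ‖u x‖ₑ := by rw [hκ]; push_cast; ring
      _ ≤ _ := by gcongr; exact le_add_self

/-- The trilinear form bound on `L^∞ × L² × L²`. -/
lemma Band.exists_form_le {α : 𝓢(ℝ, ℂ)} {C : ℝ≥0} (hα : Band α C) (γ : 𝓢(ℝ, ℂ)) :
    ∃ D : ℝ≥0, ∀ (a : ℝ) (Λ : Finset ℤ) (f g u : ℝ → ℂ) (M : ℝ≥0∞), Nice f → Nice g → Nice u →
      (∀ x, ‖f x‖ₑ ≤ M) →
      ∫⁻ x, ∑ k ∈ Λ, ‖conv f (dilR α k a) x‖ₑ * (‖conv g (dilR α k a) x‖ₑ *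
        ‖conv u (dilR γ k 0) x‖ₑ) ≤
      D * lg a * M * ((∫⁻ x, ‖g x‖ₑ ^ 2) ^ (1 / 2 : ℝ) * (∫⁻ x, ‖u x‖ₑ ^ 2) ^ (1 / 2 : ℝ)) := by
  obtain ⟨D, hD⟩ := hα.exists_lintegral_sum_mul_le γ
  refine ⟨2 * C * (D + 1), fun a Λ f g u M hf hg hu hM => ?_⟩
  have hfm := fun k => (hf.conv_dilR α k a).meas
  have hgm := fun k => (hg.conv_dilR α k a).meas
  have hum := fun k => (hu.conv_dilR γ k 0).meas
  set P : ℝ → ℝ≥0∞ := fun x => ∑ k ∈ Λ, ‖conv g (dilR α k a) x‖ₑ ^ 2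
  set R : ℝ → ℝ≥0∞ := fun x => ∑ k ∈ Λ, ‖conv f (dilR α k a) x‖ₑ ^ 2 * ‖conv u (dilR γ k 0) x‖ₑ ^ 2
  have hPm : Measurable P := Finset.measurable_fun_sum _ fun k _ => by
    have := hgm k
    fun_prop
  have hRm : Measurable R := Finset.measurable_fun_sum _ fun k _ => by
    have := hfm k
    have := hum k
    fun_prop
  have hP : ∫⁻ x, P x ≤ ↑(2 * C) ^ 2 * ∫⁻ x, ‖g x‖ₑ ^ 2 := hα.lintegral_square_le hg Λ a
  have hR : ∫⁻ x, R x ≤ ((D + 1) * lg a * M) ^ 2 * ∫⁻ x, ‖u x‖ₑ ^ 2 := by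
    refine (hD a Λ f u M hf hu hM).trans ?_
    have h1 : (D : ℝ≥0∞) ≤ (D + 1) ^ 2 := by
      rw [sq]
      exact le_self_add.trans (le_mul_of_one_le_right' le_add_self)
    have h2 : lg a ≤ lg a ^ 2 := by
      rw [sq]
      exact le_mul_of_one_le_right' (one_le_lg a)
    calc D * M ^ 2 * lg a * ∫⁻ x, ‖u x‖ₑ ^ 2
        ≤ (D + 1) ^ 2 * M ^ 2 * lg a ^ 2 * ∫⁻ x, ‖u x‖ₑ ^ 2 := by gcongr
      _ = _ := by ring
  have hsqrt : ∀ B z : ℝ≥0∞, (B ^ 2 * z) ^ (1 / 2 : ℝ) = B * z ^ (1 / 2 : ℝ) := fun B z => by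
    rw [ENNReal.mul_rpow_of_nonneg _ _ (by norm_num), ENNReal.sq_rpow_half]
  calc _ ≤ ∫⁻ x, P x ^ (1 / 2 : ℝ) * R x ^ (1 / 2 : ℝ) := by
        refine lintegral_mono fun x => ?_
        have h3 := ENNReal.inner_le_Lp_mul_Lq Λ (fun k => ‖conv g (dilR α k a) x‖ₑ)
          (fun k => ‖conv f (dilR α k a) x‖ₑ * ‖conv u (dilR γ k 0) x‖ₑ) (p := 2) (q := 2)
          ⟨by norm_num, by norm_num, by norm_num⟩
        simp only [ENNReal.rpow_ofNat, mul_pow] at h3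
        refine le_trans (le_of_eq (Finset.sum_congr rfl fun k _ => ?_)) h3
        ring
    _ ≤ (∫⁻ x, P x) ^ (1 / 2 : ℝ) * (∫⁻ x, R x) ^ (1 / 2 : ℝ) := by
        have h2 := ENNReal.lintegral_mul_le_Lp_mul_Lq volume (p := 2) (q := 2)
          ⟨by norm_num, by norm_num, by norm_num⟩
          (f := fun x => P x ^ (1 / 2 : ℝ)) (g := fun x => R x ^ (1 / 2 : ℝ))
          (hPm.pow_const _).aemeasurable (hRm.pow_const _).aemeasurable
        simp only [ENNReal.rpow_ofNat, ENNReal.rpow_half_sq] at h2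
        exact h2
    _ ≤ (↑(2 * C) ^ 2 * ∫⁻ x, ‖g x‖ₑ ^ 2) ^ (1 / 2 : ℝ) *
          (((D + 1) * lg a * M) ^ 2 * ∫⁻ x, ‖u x‖ₑ ^ 2) ^ (1 / 2 : ℝ) := by gcongr
    _ = _ := by
        rw [hsqrt, hsqrt]
        push_cast
        ring

lemma Prof.enorm_conv_le_of_bounded {α : ℝ → ℂ} {c : ℝ≥0} (hα : Prof α c) (k : ℤ) (a : ℝ)
    {f : ℝ → ℂ} {M : ℝ≥0∞} (hM : ∀ x, ‖f x‖ₑ ≤ M) (x : ℝ) :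
    ‖conv f (dilR α k a) x‖ₑ ≤ M * c * kapMoment := by
  refine (_root_.ShiftedParaproduct.enorm_conv_le _ _ x).trans ?_
  calc lconv (fun t => ‖f t‖ₑ) (fun t => ‖dilR α k a t‖ₑ) x
      ≤ ∫⁻ t, M * c * kk k a (x - t) := by
        refine lintegral_mono fun t => ?_
        rw [mul_assoc]
        exact mul_le_mul' (hM t) (hα.enorm_dilR_le k a _)
    _ = M * c * ∫⁻ t, kk k a t := by
        rw [lintegral_const_mul _ (by have := measurable_kk k a; fun_prop),
          lintegral_sub_left_eq_self (kk k a) x]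
    _ ≤ M * c * kapMoment := by
        gcongr
        exact (mom_kk k a).mass

lemma paraShift_eq_prodOp (φ : 𝓢(ℝ, ℂ)) (n : ℤ) (Λ : Finset ℤ) (f g : ℝ → ℂ) :
    paraShift φ n Λ f g = prodOp (fun k => conv f (dilR (psiS φ) k n)) (psiS φ) n φ 0 Λ g := by
  ext x
  rw [paraShift_eq, prodOp]

/-- The paraproduct with a bounded function, and its transpose, are Calderón–Zygmund operators. -/
lemma Band.exists_czOp_paraShift {φ : 𝓢(ℝ, ℂ)} {C : ℝ≥0} (hα : Band (psiS φ) C) :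
    ∃ D : ℝ≥0, D ≠ 0 ∧ ∀ (n : ℤ) (Λ : Finset ℤ) (f : ℝ → ℂ) (M : ℝ≥0∞), Nice f → M ≠ ∞ →
      (∀ x, ‖f x‖ₑ ≤ M) →
      CZOp (fun g x => ‖paraShift φ n Λ f g x‖ₑ) (D * lg n * M) ∧
      CZOp (fun g x => ‖prodOp (fun k => conv f (dilR (psiS φ) k n)) (reflS φ) (-0)
        (reflS (psiS φ)) (-n) Λ g x‖ₑ) (D * lg n * M) := by
  obtain ⟨c, hc⟩ := exists_prof (psiS φ)
  obtain ⟨D₁, h₁⟩ := hα.exists_form_le (reflS φ)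
  obtain ⟨D₂, h₂⟩ := exists_czOp_prodOp (psiS φ) φ
  obtain ⟨D₃, h₃⟩ := exists_czOp_prodOp (reflS φ) (reflS (psiS φ))
  set κ := kapMoment.toNNReal
  have hκ : kapMoment = κ := (ENNReal.coe_toNNReal kapMoment_ne_top).symm
  refine ⟨1 + (D₁ + D₂ * c * κ + D₃ * c * κ), by positivity, fun n Λ f M hf hMt hM => ?_⟩
  set F : ℤ → ℝ → ℂ := fun k => conv f (dilR (psiS φ) k n) with hFdef
  have hF : ∀ k, Nice (F k) := fun k => hf.conv_dilR _ _ _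
  have hFM : ∀ k x, ‖F k x‖ₑ ≤ M * c * κ := fun k x => by
    rw [← hκ]
    exact hc.enorm_conv_le_of_bounded k n hM x
  have hMt' : M * c * κ ≠ ∞ := by finiteness
  constructor
  · have hD : (D₁ : ℝ≥0∞) + D₂ * c * κ ≤ (1 + (D₁ + D₂ * c * κ + D₃ * c * κ) : ℝ≥0) := by
      push_cast
      exact le_self_add.trans le_add_self
    have h : CZOp (fun g x => ‖prodOp F (psiS φ) n φ 0 Λ g x‖ₑ)
        ((1 + (D₁ + D₂ * c * κ + D₃ * c * κ) : ℝ≥0) * lg n * M) := by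
      refine (h₂ F n 0 Λ (M * c * κ) (D₁ * lg n * M) hF hFM hMt' fun g hg => ?_).mono ?_
      · exact lintegral_prodOp_sq_le hF _ _ _ _ Λ hg fun u hu => by
          rw [neg_zero]
          exact h₁ n Λ f g u M hf hg hu hM
      · rw [abs_zero, add_zero, mul_one]
        change _ + _ * lg n ≤ _
        calc D₁ * lg n * M + D₂ * (M * c * κ) * lg n = (D₁ + D₂ * c * κ) * lg n * M := by ring
          _ ≤ _ := mul_le_mul' (mul_le_mul' hD le_rfl) le_rfl
    simpa only [paraShift_eq_prodOp] using h
  · have hD : (D₁ : ℝ≥0∞) + D₃ * c * κ ≤ (1 + (D₁ + D₂ * c * κ + D₃ * c * κ) : ℝ≥0) := by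
      push_cast
      rw [add_right_comm (D₁ : ℝ≥0∞)]
      exact le_self_add.trans le_add_self
    refine (h₃ F (-0) (-n) Λ (M * c * κ) (D₁ * lg n * M) hF hFM hMt' fun g hg => ?_).mono ?_
    · exact lintegral_prodOp_sq_le hF _ _ _ _ Λ hg fun u hu => by
        simp only [neg_zero, neg_neg, reflS_reflS]
        simp_rw [mul_comm (‖conv g _ _‖ₑ)]
        rw [mul_comm ((∫⁻ x, ‖g x‖ₑ ^ 2) ^ (1 / 2 : ℝ))]
        exact h₁ n Λ f u g M hf hu hg hM
    · rw [neg_zero, abs_zero, add_zero, one_mul, abs_neg]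
      change _ + _ * lg n ≤ _
      calc D₁ * lg n * M + D₃ * (M * c * κ) * lg n = (D₁ + D₃ * c * κ) * lg n * M := by ring
        _ ≤ _ := mul_le_mul' (mul_le_mul' hD le_rfl) le_rfl

/-- The paraproduct bound when one of the functions is merely bounded. -/
lemma Band.exists_lintegral_paraShift_rpow_le_of_bounded {φ : 𝓢(ℝ, ℂ)} {C : ℝ≥0}
    (hα : Band (psiS φ) C) {s : ℝ} (hs : 1 < s) :
    ∃ D : ℝ≥0, ∀ (n : ℤ) (Λ : Finset ℤ) (f g : ℝ → ℂ) (M : ℝ≥0∞), Nice f → Nice g →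
      Continuous g → M ≠ ∞ → (∀ x, ‖f x‖ₑ ≤ M) →
      ∫⁻ x, ‖paraShift φ n Λ f g x‖ₑ ^ s ≤ (D * lg n * M) ^ s * ∫⁻ x, ‖g x‖ₑ ^ s := by
  have hs0 : 0 < s := by linarith
  suffices h : ∃ D : ℝ≥0, ∀ (n : ℤ) (Λ : Finset ℤ) (f g : ℝ → ℂ) (M : ℝ≥0∞), Nice f → Nice g →
      Continuous g → M ≠ ∞ → M ≠ 0 → (∀ x, ‖f x‖ₑ ≤ M) →
      ∫⁻ x, ‖paraShift φ n Λ f g x‖ₑ ^ s ≤ (D * lg n * M) ^ s * ∫⁻ x, ‖g x‖ₑ ^ s by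
    obtain ⟨D, hD⟩ := h
    refine ⟨D, fun n Λ f g M hf hg hgc hMt hM => ?_⟩
    rcases eq_or_ne M 0 with rfl | hM0
    · have h0 : f = 0 := by ext x; simpa using hM x
      simp [h0, paraShift, conv, hs0]
    · exact hD n Λ f g M hf hg hgc hMt hM0 hM
  obtain ⟨D, hD0, hD⟩ := hα.exists_czOp_paraShift
  have hne0 : ∀ (n : ℤ) (M : ℝ≥0∞), M ≠ 0 → D * lg n * M ≠ 0 := fun n M hM =>
    mul_ne_zero (mul_ne_zero (by simpa using hD0) (lg_ne_zero _)) hM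
  have hnet : ∀ (n : ℤ) (M : ℝ≥0∞), M ≠ ∞ → D * lg n * M ≠ ∞ := fun n M hM =>
    ENNReal.mul_ne_top (ENNReal.mul_ne_top ENNReal.coe_ne_top (lg_ne_top _)) hM
  rcases lt_trichotomy s 2 with hs2 | rfl | hs2
  · have hcz : czConst s ^ (1 / s) ≠ ∞ :=
      ENNReal.rpow_ne_top_of_nonneg (by positivity) (czConst_ne_top s)
    refine ⟨2 * D * (czConst s ^ (1 / s)).toNNReal, fun n Λ f g M hf hg hgc hMt hM0 hM => ?_⟩
    refine ((hD n Λ f M hf hMt hM).1.lintegral_rpow_le (hne0 n M hM0) (hnet n M hMt) hs hs2 hg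
      hgc).trans (le_of_eq ?_)
    have e : czConst s = (czConst s ^ (1 / s)) ^ s := by
      rw [← ENNReal.rpow_mul, one_div_mul_cancel hs0.ne', ENNReal.rpow_one]
    push_cast
    rw [ENNReal.coe_toNNReal hcz, ← mul_assoc]
    nth_rw 1 [e]
    rw [← ENNReal.mul_rpow_of_nonneg _ _ hs0.le]
    congr 2
    ring
  · refine ⟨D, fun n Λ f g M hf hg hgc hMt hM0 hM => ?_⟩
    simpa only [ENNReal.rpow_ofNat] using (hD n Λ f M hf hMt hM).1.l2 g hg
  · have hpq := Real.HolderConjugate.conjExponent hs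
    set q := s.conjExponent
    have hq1 := hpq.symm.lt
    have hcz : czConst q ^ (1 / q) ≠ ∞ :=
      ENNReal.rpow_ne_top_of_nonneg (by positivity) (czConst_ne_top q)
    refine ⟨2 * D * (czConst q ^ (1 / q)).toNNReal, fun n Λ f g M hf hg hgc hMt hM0 hM => ?_⟩
    have hF : ∀ k, Nice (conv f (dilR (psiS φ) k n)) := fun k => hf.conv_dilR _ _ _
    rw [paraShift_eq_prodOp]
    refine ((hD n Λ f M hf hMt hM).2.lintegral_rpow_le_of_adjoint (hne0 n M hM0) (hnet n M hMt)
      hs2 hpq (nice_prodOp hF _ _ _ _ Λ hg) (continuous_prodOp hF _ _ _ _ Λ hg) hg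
      fun u hu _ => integral_prodOp_mul_eq hF _ _ _ _ Λ hg hu).trans (le_of_eq ?_)
    push_cast
    rw [ENNReal.coe_toNNReal hcz]
    congr 2
    ring

lemma paraShift_comm (φ : ℝ → ℂ) (n : ℤ) (Λ : Finset ℤ) (f g : ℝ → ℂ) :
    paraShift φ n Λ f g = paraShift φ n Λ g f := by
  ext x
  simp only [paraShift, mul_comm]

lemma exists_lg_sq_le : ∃ K : ℝ≥0, ∀ n : ℝ,
    lg n ^ 2 ≤ K * ENNReal.ofReal (Real.log (2 + |n|) ^ 2) := by
  have h2 : 0 < Real.log 2 := Real.log_pos one_lt_two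
  refine ⟨((1 + 1 / Real.log 2) ^ 2).toNNReal, fun n => ?_⟩
  have hn := abs_nonneg n
  have h3 : Real.log 2 ≤ Real.log (2 + |n|) := Real.log_le_log two_pos (by linarith)
  have h4 : Real.log (1 + |n|) ≤ Real.log (2 + |n|) :=
    Real.log_le_log (by linarith) (by linarith)
  have h5 : 0 ≤ Real.log (1 + |n|) := Real.log_nonneg (by linarith)
  have h6 : 1 ≤ 1 / Real.log 2 * Real.log (2 + |n|) := by
    rw [one_div_mul_eq_div]
    exact (one_le_div h2).2 h3
  rw [lg, ← ENNReal.ofReal_pow (by positivity), ENNReal.ofNNReal_toNNReal,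
    ← ENNReal.ofReal_mul (by positivity), ← mul_pow]
  gcongr
  linarith

lemma enorm_le_essSup {f : ℝ → ℂ} (hf : Continuous f) (x : ℝ) :
    ‖f x‖ₑ ≤ essSup (fun x => ‖f x‖ₑ) volume := by
  by_contra! h
  set M := essSup (fun x => ‖f x‖ₑ) volume
  have ho : IsOpen {x | M < ‖f x‖ₑ} := isOpen_lt continuous_const hf.enorm
  have h0 : volume {x | M < ‖f x‖ₑ} = 0 := by
    have := ENNReal.ae_le_essSup (μ := volume) fun x => ‖f x‖ₑ
    simpa [ae_iff, M] using this
  exact (ho.eq_empty_of_measure_zero h0).le h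

lemma essSup_enorm_ne_top (f : 𝓢(ℝ, ℂ)) : essSup (fun x => ‖f x‖ₑ) volume ≠ ∞ := by
  obtain ⟨C, hC⟩ := (nice_schwartz f).bdd
  refine ne_top_of_le_ne_top (ENNReal.ofReal_ne_top (r := C)) (essSup_le_of_ae_le _ ?_)
  exact .of_forall fun x => by
    change ‖f x‖ₑ ≤ ENNReal.ofReal C
    rw [← ofReal_norm]
    exact ENNReal.ofReal_le_ofReal (hC x)

lemma Band.exists_lintegral_paraShift_rpow_le_essSup {φ : 𝓢(ℝ, ℂ)} {C : ℝ≥0}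
    (hα : Band (psiS φ) C) {s : ℝ} (hs : 1 < s) :
    ∃ D : ℝ≥0, ∀ (n : ℤ) (Λ : Finset ℤ) (f g : 𝓢(ℝ, ℂ)),
      (∫⁻ x, ‖paraShift φ n Λ f g x‖ₑ ^ s) ^ (1 / s) ≤
        D * lg n ^ 2 * essSup (fun x => ‖f x‖ₑ) volume * (∫⁻ x, ‖g x‖ₑ ^ s) ^ (1 / s) := by
  obtain ⟨D, hD⟩ := hα.exists_lintegral_paraShift_rpow_le_of_bounded hs
  refine ⟨D, fun n Λ f g => ?_⟩
  have hs0 : 0 < s := by linarith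
  refine (ENNReal.rpow_le_rpow (hD n Λ f g _ (nice_schwartz f) (nice_schwartz g) g.continuous
    (essSup_enorm_ne_top f) (enorm_le_essSup f.continuous)) (by positivity)).trans ?_
  rw [ENNReal.mul_rpow_of_nonneg _ _ (by positivity), ← ENNReal.rpow_mul,
    mul_one_div_cancel hs0.ne', ENNReal.rpow_one]
  gcongr
  exact le_self_pow₀ (one_le_lg _) two_ne_zero

/-- The bound for the shifted paraproduct, with the logarithm written as `lg`. -/
lemma Band.exists_lqNorm_paraShift_le {φ : 𝓢(ℝ, ℂ)} {C : ℝ≥0} (hα : Band (psiS φ) C)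
    {p q : ℝ≥0∞} (hp : 1 < p) (hq : 1 < q) {s : ℝ} (hs : 0 < s)
    (hpq : (ENNReal.ofReal s)⁻¹ = p⁻¹ + q⁻¹) :
    ∃ D : ℝ≥0, ∀ (n : ℤ) (Λ : Finset ℤ) (f g : 𝓢(ℝ, ℂ)),
      LqNorm volume (ENNReal.ofReal s) (fun x => ‖paraShift φ n Λ f g x‖ₑ) ≤
        D * lg n ^ 2 * LqNorm volume p (fun x => ‖f x‖ₑ) * LqNorm volume q (fun x => ‖g x‖ₑ) := by
  have one_lt {r : ℝ≥0∞} (hr : 1 < r) (e : ENNReal.ofReal s = r) : 1 < s := by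
    rwa [← e, ← ENNReal.ofReal_one, ENNReal.ofReal_lt_ofReal_iff hs] at hr
  rcases eq_or_ne p ∞ with rfl | hpt
  · have e : ENNReal.ofReal s = q := by simpa using hpq
    obtain ⟨D, hD⟩ := hα.exists_lintegral_paraShift_rpow_le_essSup (one_lt hq e)
    refine ⟨D, fun n Λ f g => ?_⟩
    subst e
    simpa [LqNorm, hs.le] using hD n Λ f g
  rcases eq_or_ne q ∞ with rfl | hqt
  · have e : ENNReal.ofReal s = p := by simpa using hpq
    obtain ⟨D, hD⟩ := hα.exists_lintegral_paraShift_rpow_le_essSup (one_lt hp e)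
    refine ⟨D, fun n Λ f g => ?_⟩
    subst e
    rw [mul_right_comm, paraShift_comm]
    simpa [LqNorm, hs.le] using hD n Λ g f
  lift p to ℝ≥0 using hpt
  lift q to ℝ≥0 using hqt
  have hp1 : (1 : ℝ) < p := by exact_mod_cast hp
  have hq1 : (1 : ℝ) < q := by exact_mod_cast hq
  have e : 1 / s = 1 / (p : ℝ) + 1 / q := by
    have := congrArg ENNReal.toReal hpq
    rw [ENNReal.toReal_add (by simp; rintro rfl; norm_num at hp1)
      (by simp; rintro rfl; norm_num at hq1)] at this
    simpa [hs.le] using this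
  obtain ⟨D, hD⟩ := exists_lintegral_paraShift_rpow_le hα hp1 hq1 hs e
  refine ⟨D, fun n Λ f g => ?_⟩
  simpa [LqNorm, hs.le] using hD n Λ f g

end ShiftedParaproduct

/-- Boundedness of the shifted paraproduct with logarithmic dependence on the shift:
`‖Π_{n,Λ}(f,g)‖_{L^s} ≤ C (log(2+|n|))² ‖f‖_{L^p} ‖g‖_{L^q}`. -/
theorem shifted_paraproduct_bounded
    (φ : SchwartzMap ℝ ℂ)
    (hφ₁ : ∀ ξ : ℝ, |ξ| ≤ 1 / 2 → ft1 (⇑φ) ξ = 1)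
    (hφ₂ : ∀ ξ : ℝ, 1 ≤ |ξ| → ft1 (⇑φ) ξ = 0)
    (p q : ℝ≥0∞) (hp : 1 < p) (hq : 1 < q)
    (s : ℝ) (hs : 1 / 2 < s) (hHs : (ENNReal.ofReal s)⁻¹ = p⁻¹ + q⁻¹) :
    ∃ C : ℝ≥0, ∀ (n : ℤ) (Λ : Finset ℤ) (f g : SchwartzMap ℝ ℂ),
      LqNorm volume (ENNReal.ofReal s)
          (fun x => (‖paraShift (⇑φ) n Λ (⇑f) (⇑g) x‖₊ : ℝ≥0∞)) ≤
        (C : ℝ≥0∞) * ENNReal.ofReal ((Real.log (2 + |(n : ℝ)|)) ^ 2) *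
          LqNorm volume p (fun x => (‖f x‖₊ : ℝ≥0∞)) *
          LqNorm volume q (fun x => (‖g x‖₊ : ℝ≥0∞)) := by
  obtain ⟨C, hα⟩ := ShiftedParaproduct.exists_band_psiS hφ₁ hφ₂
  obtain ⟨D, hD⟩ := hα.exists_lqNorm_paraShift_le hp hq (by linarith) hHs
  obtain ⟨K, hK⟩ := ShiftedParaproduct.exists_lg_sq_le
  refine ⟨D * K, fun n Λ f g => (hD n Λ f g).trans ?_⟩
  rw [ENNReal.coe_mul, mul_assoc (D : ℝ≥0∞) K]
  exact mul_le_mul' (mul_le_mul' (mul_le_mul' le_rfl (hK n)) le_rfl) le_rfl
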